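/- Let (E,H,(·|·)) be an extended affine Lie algebra over an algebraically closed field k of characteristic 0, with core E_c and centreless core L = E_c/Z(E_c), and let R = Ctd_k(L) be the centroid of L. Assume L is fgc, i.e. finitely generated as a module over R. Then every R-linear Lie algebra automorphism g of L (one commuting with every element of Ctd_k(L)) lifts to E: there exists a Lie algebra automorphism f of E such that f(E_c) = E_c and the automorphism of L induced by f|_{E_c} (via the quotient map E_c → E_c/Z(E_c)) equals g. -/

import Mathlib

/-! Statement 17: lifting centroid-linear automorphisms of the centreless core of an fgc EALA. -/

section EALA

variable {k E : Type*} [Field k] [CharZero k] [LieRing E] [LieAlgebra k E]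

/-- The weight space of the toral subalgebra `H` for the weight `α ∈ H*`:
`E_α = {e ∈ E : [h,e] = α(h)e for all h ∈ H}`. -/
def wtSpace (H : LieSubalgebra k E) (α : Module.Dual k H) : Submodule k E where
  carrier := {e | ∀ h : H, ⁅(h : E), e⁆ = α h • e}
  add_mem' := by
    intro a b ha hb h
    simp only [lie_add, ha h, hb h, smul_add]
  zero_mem' := by
    intro h
    simp
  smul_mem' := by
    intro c a ha h
    rw [lie_smul, ha h, smul_comm]

/-- The set of roots `Ψ` of `(E,H)`: those `α ∈ H*` with `E_α ≠ 0` (note `0 ∈ Ψ`). -/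
def rootSet (H : LieSubalgebra k E) : Set (Module.Dual k H) :=
  {α | wtSpace H α ≠ ⊥}

variable (B : E →ₗ[k] E →ₗ[k] k)

/-- The representatives `t_α ∈ H` of `α ∈ H*` under the form: `(t_α | h) = α(h)` for `h ∈ H`. -/
def reps (H : LieSubalgebra k E) (α : Module.Dual k H) : Set H :=
  {t | ∀ h : H, B (t : E) (h : E) = α h}

/-- The anisotropic roots: `Ψ^an = {α ∈ Ψ : (α|α) ≠ 0}`. -/
def anisoRootSet (H : LieSubalgebra k E) : Set (Module.Dual k H) :=
  {α | α ∈ rootSet H ∧ ∃ t ∈ reps B H α, B (t : E) (t : E) ≠ 0}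

/-- The isotropic (null) roots: `Ψ⁰ = {α ∈ Ψ : (α|α) = 0}`. -/
def isoRootSet (H : LieSubalgebra k E) : Set (Module.Dual k H) :=
  {α | α ∈ rootSet H ∧ ∃ t ∈ reps B H α, B (t : E) (t : E) = 0}

/-- The core `E_c` of `(E, H, (·|·))`: the subalgebra of `E` generated by
`⋃_{α ∈ Ψ^an} E_α`. -/
def core (H : LieSubalgebra k E) : LieSubalgebra k E :=
  LieSubalgebra.lieSpan k E (⋃ α ∈ anisoRootSet B H, (wtSpace H α : Set E))

/-- An extended affine Lie algebra structure `(E, H, (·|·))` (paper §2.3):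
axioms (EA1)–(EA5), together with the requirements that the bilinear form is
nondegenerate, symmetric and invariant. -/
structure IsEALA (H : LieSubalgebra k E) : Prop where
  /-- the form is symmetric -/
  symm : ∀ x y : E, B x y = B y x
  /-- the form is invariant -/
  invariant : ∀ x y z : E, B ⁅x, y⁆ z = B x ⁅y, z⁆
  /-- the form is nondegenerate -/
  nondeg : ∀ x : E, (∀ y : E, B x y = 0) → x = 0
  /-- (EA1): `H` is nontrivial … -/
  H_ne_bot : H ≠ ⊥
  /-- … finite-dimensional … -/
  H_fd : FiniteDimensional k H
  /-- … self-centralizing (in particular abelian): `E_0 = H` … -/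
  self_centralizing : wtSpace H 0 = H.toSubmodule
  /-- … and toral: `E = ⊕_{α ∈ H*} E_α` -/
  toral : (⨆ α : Module.Dual k H, wtSpace H α) = ⊤
  /-- the restriction of the form to `H × H` is nondegenerate -/
  H_nondeg : ∀ t : H, (∀ h : H, B (t : E) (h : E) = 0) → t = 0
  /-- (EA2): `ad x` is locally nilpotent for `x ∈ E_α`, `α ∈ Ψ^an` -/
  ea2 : ∀ α ∈ anisoRootSet B H, ∀ x ∈ wtSpace H α, ∀ e : E,
    ∃ N : ℕ, (fun y => ⁅x, y⁆)^[N] e = 0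
  /-- (EA3): `Ψ^an` is connected -/
  ea3 : ∀ Ψ₁ Ψ₂ : Set (Module.Dual k H), anisoRootSet B H = Ψ₁ ∪ Ψ₂ →
    Ψ₁.Nonempty → Ψ₂.Nonempty →
    ∃ α ∈ Ψ₁, ∃ β ∈ Ψ₂, ∃ t ∈ reps B H α, ∃ s ∈ reps B H β, B (t : E) (s : E) ≠ 0
  /-- (EA4): the centralizer of the core is contained in the core -/
  ea4 : ∀ e : E, (∀ x ∈ core B H, ⁅e, x⁆ = 0) → e ∈ core B H
  /-- (EA5): the subgroup of `(H*,+)` generated by `Ψ⁰` is free abelian of finite rank -/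
  ea5 : ∃ n : ℕ, Nonempty ((AddSubgroup.closure (isoRootSet B H)) ≃+ (Fin n → ℤ))

end EALA

section Lift

variable {k E : Type*} [Field k] [CharZero k] [IsAlgClosed k] [LieRing E] [LieAlgebra k E]
variable (B : E →ₗ[k] E →ₗ[k] k) (H : LieSubalgebra k E)

/-- The centreless core `L = E_c/Z(E_c)` of the EALA `(E,H,(·|·))`. -/
abbrev centrelessCore :=
  (core B H) ⧸ (LieAlgebra.center k (core B H))

/-- The canonical quotient map `E_c → E_c/Z(E_c)`. -/
abbrev ccMk : (core B H) → centrelessCore B H :=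
  LieSubmodule.Quotient.mk (N := LieAlgebra.center k (core B H))

/-- The centroid `Ctd_k(L)` of the centreless core, as a set of `k`-linear endomorphisms:
`Ctd_k(L) = {χ ∈ End_k(L) : χ([a,b]) = [χ(a),b]}`. -/
def ccCentroid : Set (Module.End k (centrelessCore B H)) :=
  {χ | ∀ a b : centrelessCore B H, χ ⁅a, b⁆ = ⁅χ a, b⁆}

/-- The centreless core is fgc: it is finitely generated as a module over its centroid. -/
def IsFgc : Prop :=
  ∃ s : Finset (centrelessCore B H), ∀ x : centrelessCore B H,
    x ∈ Submodule.span k {y | ∃ χ ∈ ccCentroid B H, ∃ a ∈ s, χ a = y}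

end Lift

set_option linter.unusedSectionVars false

section SimultaneousWeights

variable {k V M M' : Type*} [Field k] [AddCommGroup V] [Module k V]
  [AddCommGroup M'] [Module k M'] [AddCommGroup M] [Module k M]

/-- The simultaneous eigenspace of a family `τ` of endomorphisms for the weight `α`. -/
def simWt (τ : V → Module.End k M) (α : Module.Dual k V) : Submodule k M where
  carrier := {m | ∀ v, τ v m = α v • m}
  add_mem' := by
    intro a b ha hb v
    simp only [map_add, ha v, hb v, smul_add]
  zero_mem' := by
    intro v
    simp
  smul_mem' := by
    intro c a ha v
    rw [map_smul, ha v, smul_comm]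

variable {τ : V → Module.End k M}

/-- The weight components of an element of a stable submodule lie in the submodule. -/
lemma simWt_component_mem (N : Submodule k M) (hN : ∀ v, ∀ m ∈ N, τ v m ∈ N)
    (s : Finset (Module.Dual k V)) :
    ∀ m : Module.Dual k V → M, (∀ α ∈ s, m α ∈ simWt τ α) → ∑ α ∈ s, m α ∈ N →
      ∀ α ∈ s, m α ∈ N := by
  classical
  induction s using Finset.induction_on with
  | empty => simp
  | insert a s ha ih =>
    intro m hm hsum
    have key : ∀ β ∈ s, m β ∈ N := by
      intro β hβ
      have hne : β ≠ a := fun h => ha (h ▸ hβ)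
      obtain ⟨v, hv⟩ : ∃ v, β v ≠ a v := by
        by_contra! hcon
        exact hne (LinearMap.ext hcon)
      have h2 := ih (fun γ => (γ v - a v) • m γ)
        (fun γ hγ => Submodule.smul_mem _ _ (hm γ (Finset.mem_insert_of_mem hγ))) (by
          have h3 := N.sub_mem (hN v _ hsum) (N.smul_mem (a v) hsum)
          have h4 : τ v (∑ α ∈ insert a s, m α) - a v • ∑ α ∈ insert a s, m α
              = ∑ γ ∈ s, (γ v - a v) • m γ := by
            rw [map_sum, Finset.smul_sum, ← Finset.sum_sub_distrib, Finset.sum_insert ha]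
            rw [hm a (Finset.mem_insert_self _ _) v, sub_self, zero_add]
            refine Finset.sum_congr rfl fun γ hγ => ?_
            rw [hm γ (Finset.mem_insert_of_mem hγ) v, sub_smul]
          rwa [h4] at h3) β hβ
      exact (N.smul_mem_iff (sub_ne_zero.mpr hv)).1 h2
    intro α hα
    rcases Finset.mem_insert.1 hα with rfl | hα
    · rw [Finset.sum_insert ha] at hsum
      exact (N.add_mem_iff_left (N.sum_mem key)).1 hsum
    · exact key α hα

lemma simWt_exists_decomp (htop : ⨆ α, simWt τ α = ⊤) (x : M) :
    ∃ (s : Finset (Module.Dual k V)) (m : Module.Dual k V → M),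
      (∀ α, m α ∈ simWt τ α) ∧ x = ∑ α ∈ s, m α := by
  have hx : x ∈ ⨆ α, simWt τ α := htop ▸ Submodule.mem_top
  obtain ⟨f, hf, rfl⟩ := (Submodule.mem_iSup_iff_exists_finsupp _ x).1 hx
  exact ⟨f.support, f, hf, rfl⟩

lemma simWt_sum_eq_zero (s : Finset (Module.Dual k V)) (m : Module.Dual k V → M)
    (hm : ∀ α ∈ s, m α ∈ simWt τ α) (h : ∑ α ∈ s, m α = 0) : ∀ α ∈ s, m α = 0 := by
  intro α hα
  have := simWt_component_mem (τ := τ) ⊥ (by simp) s m hm (by simp [h]) α hα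
  simpa using this

/-- Induction principle for a stable submodule of a diagonalizable module. -/
lemma simWt_induction (htop : ⨆ α, simWt τ α = ⊤) (N : Submodule k M)
    (hN : ∀ v, ∀ m ∈ N, τ v m ∈ N) (N' : Submodule k M)
    (h : ∀ α, ∀ m ∈ N, m ∈ simWt τ α → m ∈ N') : N ≤ N' := by
  intro x hx
  obtain ⟨s, m, hm, rfl⟩ := simWt_exists_decomp htop x
  have := simWt_component_mem N hN s m (fun α _ => hm α) hx
  exact N'.sum_mem fun α hα => h α _ (this α hα) (hm α)

/-- Linear maps on a diagonalizable module can be prescribed on weight spaces. -/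
lemma simWt_exists_linearMap (htop : ⨆ α, simWt τ α = ⊤)
    (φ : ∀ α, simWt τ α →ₗ[k] M') :
    ∃ Φ : M →ₗ[k] M', ∀ α (x : simWt τ α), Φ x = φ α x := by
  classical
  let c := DirectSum.coeLinearMap (simWt τ)
  have hc : ∀ v, c v = ∑ α ∈ v.support, (v α : M) := fun v => by
    simp [c, DirectSum.coeLinearMap_eq_dfinsuppSum, DFinsupp.sum]
  have hinj : Function.Injective c := by
    rw [injective_iff_map_eq_zero]
    intro v hv
    rw [hc] at hv
    ext α
    by_cases hα : α ∈ v.support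
    · simpa using simWt_sum_eq_zero _ _ (fun α _ => (v α).2) hv α hα
    · simpa using hα
  have hsurj : Function.Surjective c := by
    rw [← LinearMap.range_eq_top, eq_top_iff, ← htop, iSup_le_iff]
    intro α x hx
    exact ⟨DirectSum.lof k _ (fun α => simWt τ α) α ⟨x, hx⟩, by simp [c]⟩
  let e := LinearEquiv.ofBijective c ⟨hinj, hsurj⟩
  refine ⟨(DirectSum.toModule k _ M' φ) ∘ₗ e.symm.toLinearMap, fun α x => ?_⟩
  have : e.symm x = DirectSum.lof k _ (fun α => simWt τ α) α x := by
    rw [LinearEquiv.symm_apply_eq]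
    change (x : M) = c _
    simp [c]
  simp [this]

lemma simWt_ext (htop : ⨆ α, simWt τ α = ⊤) {f g : M →ₗ[k] M'}
    (h : ∀ α, ∀ x ∈ simWt τ α, f x = g x) : f = g := by
  ext x
  obtain ⟨s, m, hm, rfl⟩ := simWt_exists_decomp htop x
  rw [map_sum, map_sum]
  exact Finset.sum_congr rfl fun α _ => h α _ (hm α)

lemma simWt_exists_proj (htop : ⨆ α, simWt τ α = ⊤) (α : Module.Dual k V) :
    ∃ P : M →ₗ[k] M, (∀ x ∈ simWt τ α, P x = x) ∧
      (∀ β, β ≠ α → ∀ x ∈ simWt τ β, P x = 0) := by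
  classical
  obtain ⟨P, hP⟩ := simWt_exists_linearMap (M' := M) htop
    (fun β => if β = α then (simWt τ β).subtype else 0)
  refine ⟨P, fun x hx => ?_, fun β hβ x hx => ?_⟩
  · have := hP α ⟨x, hx⟩
    simpa using this
  · have := hP β ⟨x, hx⟩
    simpa [hβ] using this

/-- A stable submodule of a diagonalizable module is diagonalizable. More generally, a module
with an injective map to a diagonalizable module which is equivariant up to a shift. -/
lemma simWt_iSup_eq_top_of_injective {τ' : V → Module.End k M'} (htop : ⨆ α, simWt τ α = ⊤)
    (f : M' →ₗ[k] M) (hf : Function.Injective f) (c : Module.Dual k V)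
    (hc : ∀ v x, f (τ' v x) = τ v (f x) - c v • f x) : ⨆ α, simWt τ' α = ⊤ := by
  rw [eq_top_iff]
  intro x _
  obtain ⟨s, m, hm, hx⟩ := simWt_exists_decomp htop (f x)
  have h1 := simWt_component_mem (LinearMap.range f) (by
    rintro v _ ⟨y, rfl⟩
    exact ⟨τ' v y + c v • y, by rw [map_add, hc, map_smul, sub_add_cancel]⟩) s m
    (fun α _ => hm α) (hx ▸ ⟨x, rfl⟩)
  choose! y hy using h1
  have : x = ∑ α ∈ s, y α := by
    apply hf
    rw [hx, map_sum]
    exact Finset.sum_congr rfl fun α hα => (hy α hα).symm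
  rw [this]
  refine Submodule.sum_mem _ fun α hα => Submodule.mem_iSup_of_mem (α - c) fun v => ?_
  apply hf
  rw [hc, map_smul, hy α hα, hm α v, LinearMap.sub_apply, sub_smul]

end SimultaneousWeights

section Sl2

variable {k 𝔩 : Type*} [Field k] [CharZero k] [LieRing 𝔩] [LieAlgebra k 𝔩]

lemma IsSl2Triple.exists_nat_of_nilpotent {h e f v : 𝔩} (t : IsSl2Triple h e f) {μ : k}
    (hv : v ≠ 0) (hh : ⁅h, v⁆ = μ • v) (he : ⁅e, v⁆ = 0)
    (hf : ∃ N : ℕ, (fun y => ⁅f, y⁆)^[N] v = 0) : ∃ n : ℕ, μ = n := by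
  classical
  have P : t.HasPrimitiveVectorWith v μ := ⟨hv, hh, he⟩
  have hpow : ∀ N : ℕ, ((LieModule.toEnd k 𝔩 𝔩 f) ^ N) v = (fun y => ⁅f, y⁆)^[N] v := by
    intro N
    rw [Module.End.pow_apply]
    rfl
  have hne : Nat.find hf ≠ 0 := fun h0 => hv (by simpa [h0] using Nat.find_spec hf)
  obtain ⟨n, hn⟩ := Nat.exists_eq_succ_of_ne_zero hne
  have h1 : (fun y => ⁅f, y⁆)^[n + 1] v = 0 := by
    have := Nat.find_spec hf
    rwa [hn] at this
  have h2 : (fun y => ⁅f, y⁆)^[n] v ≠ 0 := Nat.find_min hf (by omega)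
  have h3 := P.lie_e_pow_succ_toEnd_f n
  rw [hpow, hpow, h1, lie_zero] at h3
  refine ⟨n, ?_⟩
  rcases smul_eq_zero.1 h3.symm with h4 | h4
  · rcases mul_eq_zero.1 h4 with h5 | h5
    · exact absurd h5 (by exact_mod_cast Nat.succ_ne_zero n)
    · exact sub_eq_zero.1 h5
  · exact absurd h4 h2

lemma IsSl2Triple.exists_int_of_nilpotent {h e f v : 𝔩} (t : IsSl2Triple h e f) {μ : k}
    (hv : v ≠ 0) (hh : ⁅h, v⁆ = μ • v)
    (he : ∃ N : ℕ, (fun y => ⁅e, y⁆)^[N] v = 0)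
    (hf : ∀ w : 𝔩, ∃ N : ℕ, (fun y => ⁅f, y⁆)^[N] w = 0) : ∃ n : ℤ, μ = n := by
  classical
  have hne : Nat.find he ≠ 0 := fun h0 => hv (by simpa [h0] using Nat.find_spec he)
  obtain ⟨n, hn⟩ := Nat.exists_eq_succ_of_ne_zero hne
  have h1 : (fun y => ⁅e, y⁆)^[n + 1] v = 0 := by
    have := Nat.find_spec he
    rwa [hn] at this
  have h2 : (fun y => ⁅e, y⁆)^[n] v ≠ 0 := Nat.find_min he (by omega)
  have h3 : ∀ m : ℕ, ⁅h, (fun y => ⁅e, y⁆)^[m] v⁆ = (μ + 2 * m) • (fun y => ⁅e, y⁆)^[m] v := by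
    intro m
    induction m with
    | zero => simp [hh]
    | succ m ih =>
      rw [Function.iterate_succ_apply', leibniz_lie, ih, t.lie_h_e_smul k, smul_lie, lie_smul,
        ← add_smul]
      congr 1
      push_cast
      ring
  obtain ⟨m, hm⟩ := t.exists_nat_of_nilpotent h2 (h3 n)
    (by rwa [Function.iterate_succ_apply'] at h1) (hf _)
  refine ⟨m - 2 * n, ?_⟩
  push_cast
  rw [← hm]
  ring

end Sl2

section Basics

variable {k E : Type*} [Field k] [CharZero k] [LieRing E] [LieAlgebra k E]
variable {B : E →ₗ[k] E →ₗ[k] k} {H : LieSubalgebra k E}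

lemma lie_mem_wtSpace {α β : Module.Dual k H} {x y : E} (hx : x ∈ wtSpace H α)
    (hy : y ∈ wtSpace H β) : ⁅x, y⁆ ∈ wtSpace H (α + β) := by
  intro h
  rw [leibniz_lie, hx h, hy h, smul_lie, lie_smul, ← add_smul, LinearMap.add_apply]

namespace IsEALA

variable (h : IsEALA B H)
include h

lemma iSup_simWt : ⨆ α, simWt (fun x : H => LieAlgebra.ad k E x) α = ⊤ := h.toral

lemma form_lie_left (x y z : E) : B ⁅x, y⁆ z = - B y ⁅x, z⁆ := by
  rw [← lie_skew, map_neg, LinearMap.neg_apply, h.invariant]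

lemma form_eq_zero {α β : Module.Dual k H} {x y : E} (hx : x ∈ wtSpace H α)
    (hy : y ∈ wtSpace H β) (hne : α + β ≠ 0) : B x y = 0 := by
  obtain ⟨v, hv⟩ : ∃ v, (α + β) v ≠ 0 := by
    by_contra! hcon
    exact hne (LinearMap.ext hcon)
  have h1 := h.form_lie_left v x y
  rw [hx v, hy v, map_smul, map_smul, LinearMap.smul_apply, smul_eq_mul, smul_eq_mul] at h1
  have : (α + β) v * B x y = 0 := by
    rw [LinearMap.add_apply]
    linear_combination h1
  exact (mul_eq_zero.1 this).resolve_left hv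

lemma exists_dual_mem (N : Submodule k E) (hN : ∀ v : H, ∀ m ∈ N, ⁅(v : E), m⁆ ∈ N)
    {α : Module.Dual k H} {x : E} (hx : x ∈ wtSpace H α) (hne : ∃ y ∈ N, B x y ≠ 0) :
    ∃ y ∈ N, y ∈ wtSpace H (-α) ∧ B x y = 1 := by
  by_contra! hcon
  obtain ⟨y, hy, hxy⟩ := hne
  refine hxy ?_
  have : N ≤ LinearMap.ker (B x) := by
    refine simWt_induction h.iSup_simWt N hN _ fun β m hm hm' => ?_
    by_contra h0
    rw [LinearMap.mem_ker] at h0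
    by_cases hb : α + β = 0
    · obtain rfl : β = -α := (neg_eq_of_add_eq_zero_right hb).symm
      exact hcon ((B x m)⁻¹ • m) (N.smul_mem _ hm) (Submodule.smul_mem _ _ hm')
        (by rw [map_smul, smul_eq_mul, inv_mul_cancel₀ h0])
    · exact h0 (h.form_eq_zero hx hm' hb)
  exact this hy

lemma exists_dual {α : Module.Dual k H} {x : E} (hx : x ∈ wtSpace H α) (hne : x ≠ 0) :
    ∃ y ∈ wtSpace H (-α), B x y = 1 := by
  obtain ⟨y, -, hy⟩ := h.exists_dual_mem ⊤ (fun _ _ _ => trivial) hx (by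
    by_contra! hcon
    exact hne (h.nondeg x fun y => hcon y trivial))
  exact ⟨y, hy⟩

lemma exists_toDual : ∃ t : Module.Dual k H ≃ₗ[k] H, ∀ α (x : H), B (t α : E) (x : E) = α x := by
  have := h.H_fd
  let b : H →ₗ[k] Module.Dual k H :=
    ((B.compl₁₂ H.toSubmodule.subtype H.toSubmodule.subtype : H →ₗ[k] H →ₗ[k] k))
  have hb : Function.Injective b := by
    rw [injective_iff_map_eq_zero]
    intro x hx
    exact h.H_nondeg x fun y => LinearMap.congr_fun hx y
  let e := LinearEquiv.ofInjectiveOfFinrankEq b hb Subspace.dual_finrank_eq.symm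
  refine ⟨e.symm, fun α x => ?_⟩
  have h1 : b (e.symm α) = α := e.apply_symm_apply α
  exact LinearMap.congr_fun h1 x

/-- The isomorphism `H* ≃ H` induced by the form. -/
noncomputable def toH : Module.Dual k H ≃ₗ[k] H := h.exists_toDual.choose

lemma form_toH (α : Module.Dual k H) (x : H) : B (h.toH α : E) (x : E) = α x :=
  h.exists_toDual.choose_spec α x

lemma toH_symm (α β : Module.Dual k H) : α (h.toH β) = β (h.toH α) := by
  rw [← h.form_toH, h.symm, h.form_toH]

lemma mem_reps {α : Module.Dual k H} {t : H} : t ∈ reps B H α ↔ t = h.toH α := by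
  constructor
  · intro ht
    refine sub_eq_zero.1 (h.H_nondeg _ fun x => ?_)
    have h1 := ht x
    have h2 := h.form_toH α x
    push_cast
    rw [map_sub, LinearMap.sub_apply, h1, h2, sub_self]
  · rintro rfl x
    exact h.form_toH α x

lemma mem_aniso {α : Module.Dual k H} :
    α ∈ anisoRootSet B H ↔ wtSpace H α ≠ ⊥ ∧ α (h.toH α) ≠ 0 := by
  constructor
  · rintro ⟨h1, t, ht, h2⟩
    rw [h.mem_reps] at ht
    subst ht
    exact ⟨h1, by rwa [h.form_toH] at h2⟩
  · rintro ⟨h1, h2⟩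
    exact ⟨h1, h.toH α, h.mem_reps.2 rfl, by rwa [h.form_toH]⟩

lemma mem_iso {α : Module.Dual k H} :
    α ∈ isoRootSet B H ↔ wtSpace H α ≠ ⊥ ∧ α (h.toH α) = 0 := by
  constructor
  · rintro ⟨h1, t, ht, h2⟩
    rw [h.mem_reps] at ht
    subst ht
    exact ⟨h1, by rwa [h.form_toH] at h2⟩
  · rintro ⟨h1, h2⟩
    exact ⟨h1, h.toH α, h.mem_reps.2 rfl, by rwa [h.form_toH]⟩

lemma lie_eq_toH {α : Module.Dual k H} {x y : E} (hx : x ∈ wtSpace H α)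
    (hy : y ∈ wtSpace H (-α)) : ⁅x, y⁆ = B x y • (h.toH α : E) := by
  have h1 : ⁅x, y⁆ ∈ H := by
    have := lie_mem_wtSpace hx hy
    rw [add_neg_cancel, h.self_centralizing] at this
    exact this
  have h2 : (⟨⁅x, y⁆, h1⟩ : H) - B x y • h.toH α = 0 := by
    refine h.H_nondeg _ fun v => ?_
    push_cast
    rw [map_sub, LinearMap.sub_apply, map_smul, LinearMap.smul_apply, h.form_toH, h.invariant,
      ← lie_skew, hy v, smul_eq_mul, LinearMap.neg_apply, neg_smul, neg_neg, map_smul, smul_eq_mul]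
    ring
  have := congrArg (Subtype.val) (sub_eq_zero.1 h2)
  simpa using this

lemma neg_mem_wtSpace_ne_bot {α : Module.Dual k H} (hα : wtSpace H α ≠ ⊥) :
    wtSpace H (-α) ≠ ⊥ := by
  obtain ⟨x, hx, hne⟩ := (Submodule.ne_bot_iff _).1 hα
  obtain ⟨y, hy, hxy⟩ := h.exists_dual hx hne
  refine (Submodule.ne_bot_iff _).2 ⟨y, hy, ?_⟩
  rintro rfl
  simp at hxy

lemma neg_mem_aniso {α : Module.Dual k H} (hα : α ∈ anisoRootSet B H) :
    -α ∈ anisoRootSet B H := by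
  rw [h.mem_aniso] at hα ⊢
  exact ⟨h.neg_mem_wtSpace_ne_bot hα.1, by simpa using hα.2⟩

/-- An anisotropic root vector is part of an `sl₂`-triple. -/
lemma exists_sl2 {α : Module.Dual k H} (hα : α ∈ anisoRootSet B H) {x : E}
    (hx : x ∈ wtSpace H α) (hne : x ≠ 0) :
    ∃ y ∈ wtSpace H (-α), B x y = 2 / α (h.toH α) ∧
      IsSl2Triple (((2 / α (h.toH α)) • h.toH α : H) : E) x y := by
  obtain ⟨y, hy, hxy⟩ := h.exists_dual hx hne
  have h0 := (h.mem_aniso.1 hα).2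
  set c := 2 / α (h.toH α) with hc
  have hc2 : c * α (h.toH α) = 2 := by rw [hc]; field_simp
  have hc0 : c ≠ 0 := by rintro h; rw [h] at hc2; norm_num at hc2
  have hy' := (wtSpace H (-α)).smul_mem c hy
  have hB : B x (c • y) = c := by rw [map_smul, hxy, smul_eq_mul, mul_one]
  refine ⟨c • y, hy', hB, ?_, ?_, ?_, ?_⟩
  · intro h1
    have h2 : c • h.toH α = 0 := by exact_mod_cast h1
    rcases smul_eq_zero.1 h2 with h3 | h3
    · exact hc0 h3
    · rw [h3, map_zero] at h0
      exact h0 rfl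
  · rw [h.lie_eq_toH hx hy', hB]
    rfl
  · rw [hx (c • h.toH α), map_smul, smul_eq_mul, hc2]
    exact_mod_cast rfl
  · rw [hy' (c • h.toH α), map_smul, LinearMap.neg_apply, smul_eq_mul, mul_neg, hc2, neg_smul]
    exact_mod_cast rfl

lemma exists_int {α β : Module.Dual k H} (hα : α ∈ anisoRootSet B H) (hβ : wtSpace H β ≠ ⊥) :
    ∃ n : ℤ, 2 * β (h.toH α) = n * α (h.toH α) := by
  obtain ⟨x, hx, hne⟩ := (Submodule.ne_bot_iff _).1 (h.mem_aniso.1 hα).1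
  obtain ⟨v, hv, hvne⟩ := (Submodule.ne_bot_iff _).1 hβ
  obtain ⟨y, hy, -, t⟩ := h.exists_sl2 hα hx hne
  obtain ⟨n, hn⟩ := t.exists_int_of_nilpotent hvne (hv _) (h.ea2 α hα x hx v)
    (h.ea2 (-α) (h.neg_mem_aniso hα) y hy)
  refine ⟨n, ?_⟩
  rw [← hn, map_smul, smul_eq_mul]
  have h0 := (h.mem_aniso.1 hα).2
  field_simp

lemma iso_orthogonal_aux {δ α : Module.Dual k H} (hδ : δ ∈ isoRootSet B H)
    (hα : α ∈ anisoRootSet B H) (hne : δ (h.toH α) ≠ 0) :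
    ∃ n : ℤ, 3 ≤ |n| ∧ wtSpace H (α + n • δ) ≠ ⊥ := by
  obtain ⟨x, hx, hxne⟩ := (Submodule.ne_bot_iff _).1 (h.mem_iso.1 hδ).1
  have hδδ := (h.mem_iso.1 hδ).2
  obtain ⟨v, hv, hvne⟩ := (Submodule.ne_bot_iff _).1 (h.mem_aniso.1 hα).1
  obtain ⟨y, hy, hxy⟩ := h.exists_dual hx hxne
  have ht : ⁅x, y⁆ = (h.toH δ : E) := by rw [h.lie_eq_toH hx hy, hxy, one_smul]
  have htα : α (h.toH δ) ≠ 0 := by rwa [h.toH_symm]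
  have hxpow : ∀ N : ℕ, ∀ β, ∀ w ∈ wtSpace H β,
      (fun z => ⁅x, z⁆)^[N] w ∈ wtSpace H (β + (N : ℤ) • δ) := by
    intro N β w hw
    induction N with
    | zero => simpa using hw
    | succ N ih =>
      rw [Function.iterate_succ_apply']
      have := lie_mem_wtSpace hx ih
      convert this using 1
      push_cast
      rw [add_smul, one_smul]
      abel_nf
  have hypow : ∀ N : ℕ, ∀ β, ∀ w ∈ wtSpace H β,
      (fun z => ⁅y, z⁆)^[N] w ∈ wtSpace H (β + (-(N : ℤ)) • δ) := by
    intro N β w hw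
    induction N with
    | zero => simpa using hw
    | succ N ih =>
      rw [Function.iterate_succ_apply']
      have := lie_mem_wtSpace hy ih
      convert this using 1
      push_cast
      rw [neg_add, add_smul, neg_smul, neg_smul, one_smul]
      abel_nf
  by_cases hnil : ∃ N : ℕ, (fun z => ⁅x, z⁆)^[N] v = 0
  · classical
    have hne0 : Nat.find hnil ≠ 0 := fun h0 => hvne (by simpa [h0] using Nat.find_spec hnil)
    obtain ⟨n, hn⟩ := Nat.exists_eq_succ_of_ne_zero hne0
    have h1 : (fun z => ⁅x, z⁆)^[n + 1] v = 0 := by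
      have := Nat.find_spec hnil
      rwa [hn] at this
    have h2 : (fun z => ⁅x, z⁆)^[n] v ≠ 0 := Nat.find_min hnil (by omega)
    rw [Function.iterate_succ_apply'] at h1
    set w := (fun z => ⁅x, z⁆)^[n] v with hw
    have hwmem := hxpow n α v hv
    rw [← hw] at hwmem
    set c := α (h.toH δ) with hc
    have htw : ∀ m : ℕ, ⁅(h.toH δ : E), (fun z => ⁅y, z⁆)^[m] w⁆ = c • (fun z => ⁅y, z⁆)^[m] w := by
      intro m
      rw [hypow m _ _ hwmem (h.toH δ)]
      simp [hδδ, hc]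
    have key : ∀ m : ℕ, ⁅x, (fun z => ⁅y, z⁆)^[m + 1] w⁆
        = ((m + 1 : ℕ) * c) • (fun z => ⁅y, z⁆)^[m] w := by
      intro m
      induction m with
      | zero =>
        have := htw 0
        simp only [Function.iterate_zero, id] at this
        simp only [zero_add, Function.iterate_one, Function.iterate_zero, id]
        rw [leibniz_lie, ht, h1, lie_zero, this]
        simp
      | succ m ih =>
        rw [Function.iterate_succ_apply', leibniz_lie, ht, ih, htw, lie_smul,
          ← Function.iterate_succ_apply' (fun z => ⁅y, z⁆), ← add_smul]
        congr 1
        push_cast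
        ring
    have hnz : ∀ m : ℕ, (fun z => ⁅y, z⁆)^[m] w ≠ 0 := by
      intro m
      induction m with
      | zero => simpa using h2
      | succ m ih =>
        intro h0
        have h3 := key m
        rw [h0, lie_zero] at h3
        rcases smul_eq_zero.1 h3.symm with h4 | h4
        · rcases mul_eq_zero.1 h4 with h5 | h5
          · exact absurd h5 (by exact_mod_cast Nat.succ_ne_zero m)
          · exact htα h5
        · exact ih h4
    refine ⟨-3, by norm_num, (Submodule.ne_bot_iff _).2 ⟨_, ?_, hnz (n + 3)⟩⟩
    have := hypow (n + 3) _ _ hwmem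
    convert this using 1
    rw [add_assoc, ← add_smul, show (n : ℤ) + -((n + 3 : ℕ) : ℤ) = -3 by push_cast; ring]
  · push Not at hnil
    exact ⟨3, by norm_num, (Submodule.ne_bot_iff _).2 ⟨_, hxpow 3 _ _ hv, hnil 3⟩⟩

/-- Isotropic roots are orthogonal to anisotropic roots. -/
lemma iso_orthogonal {δ α : Module.Dual k H} (hδ : δ ∈ isoRootSet B H)
    (hα : α ∈ anisoRootSet B H) : δ (h.toH α) = 0 := by
  by_contra hne
  obtain ⟨n, hn, hroot⟩ := h.iso_orthogonal_aux hδ hα hne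
  obtain ⟨q, hq⟩ := h.exists_int hα (h.mem_iso.1 hδ).1
  have ha := (h.mem_aniso.1 hα).2
  have hδδ := (h.mem_iso.1 hδ).2
  set a := α (h.toH α) with ha'
  have hq0 : q ≠ 0 := by
    rintro rfl
    simp [hne] at hq
  have hnorm : (α + n • δ) (h.toH (α + n • δ)) = (1 + n * q) * a := by
    have h1 : α (h.toH δ) = δ (h.toH α) := h.toH_symm _ _
    simp only [map_add, map_zsmul, LinearMap.add_apply, LinearMap.smul_apply, hδδ, smul_zero,
      add_zero, h1, zsmul_eq_mul, ← ha']
    linear_combination (n : k) * hq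
  have hnq : 2 ≤ |1 + n * q| := by
    have h1 : 3 ≤ |n * q| := by
      rw [abs_mul]
      nlinarith [Int.one_le_abs hq0, abs_nonneg n]
    have h2 := abs_sub_abs_le_abs_sub (n * q) (-1)
    rw [abs_neg, abs_one, sub_neg_eq_add, add_comm _ (1 : ℤ)] at h2
    linarith
  have hnq0 : (1 + n * q : ℤ) ≠ 0 := by
    intro h0
    rw [h0] at hnq
    norm_num at hnq
  have hnq0' : (1 + n * q : k) ≠ 0 := by exact_mod_cast hnq0
  have han : α + n • δ ∈ anisoRootSet B H := by
    rw [h.mem_aniso]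
    exact ⟨hroot, by rw [hnorm]; exact mul_ne_zero hnq0' ha⟩
  obtain ⟨p, hp⟩ := h.exists_int han (h.mem_aniso.1 hα).1
  rw [hnorm, h.toH_symm] at hp
  have h3 : (2 : k) * (1 + n * q) - n * q = p * (1 + n * q) := by
    have : (α + n • δ) (h.toH α) = a + n * δ (h.toH α) := by simp [← ha']
    rw [this] at hp
    apply mul_right_cancel₀ ha
    linear_combination hp - (n : k) * hq
  have h4 : (2 : ℤ) * (1 + n * q) - n * q = p * (1 + n * q) := by exact_mod_cast h3
  have h5 : (1 + n * q) ∣ 1 := ⟨p - 1, by linear_combination h4⟩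
  have h6 := Int.le_of_dvd one_pos ((abs_dvd _ _).2 h5)
  linarith

end IsEALA

end Basics

section CoreStructure

variable {k E : Type*} [Field k] [CharZero k] [LieRing E] [LieAlgebra k E]
variable {B : E →ₗ[k] E →ₗ[k] k} {H : LieSubalgebra k E}

lemma mem_core_of_mem_wtSpace {α : Module.Dual k H} (hα : α ∈ anisoRootSet B H) {x : E}
    (hx : x ∈ wtSpace H α) : x ∈ core B H :=
  LieSubalgebra.subset_lieSpan (Set.mem_biUnion hα hx)

/-- Induction on membership in the core. -/
lemma core_induction {p : E → Prop}
    (hroot : ∀ α ∈ anisoRootSet B H, ∀ x ∈ wtSpace H α, p x)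
    (zero : p 0) (add : ∀ x y, x ∈ core B H → y ∈ core B H → p x → p y → p (x + y))
    (smul : ∀ (c : k) x, x ∈ core B H → p x → p (c • x))
    (lie : ∀ x y, x ∈ core B H → y ∈ core B H → p x → p y → p ⁅x, y⁆)
    {x : E} (hx : x ∈ core B H) : p x := by
  refine LieSubalgebra.lieSpan_induction (R := k) (p := fun x _ => p x) ?_ zero
    (fun x y hx hy => add x y hx hy) (fun c x hx => smul c x hx)
    (fun x y hx hy => lie x y hx hy) hx
  intro x hx
  obtain ⟨α, hα, hx⟩ := Set.mem_iUnion₂.1 hx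
  exact hroot α hα x hx

namespace IsEALA

variable (h : IsEALA B H)
include h

lemma aniso_or_iso {α : Module.Dual k H} (hα : wtSpace H α ≠ ⊥) :
    α ∈ anisoRootSet B H ∨ α ∈ isoRootSet B H := by
  rw [h.mem_aniso, h.mem_iso]
  by_cases h0 : α (h.toH α) = 0
  · exact Or.inr ⟨hα, h0⟩
  · exact Or.inl ⟨hα, h0⟩

lemma iso_add_aniso {α β : Module.Dual k H} (hβ : β ∈ isoRootSet B H)
    (hα : α ∈ anisoRootSet B H) (hne : wtSpace H (β + α) ≠ ⊥) :
    β + α ∈ anisoRootSet B H := by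
  rw [h.mem_aniso]
  refine ⟨hne, ?_⟩
  have h1 := h.iso_orthogonal hβ hα
  have h2 : α (h.toH β) = 0 := by rw [h.toH_symm, h1]
  have h3 := (h.mem_iso.1 hβ).2
  simp only [map_add, LinearMap.add_apply, h1, h2, h3]
  simpa using (h.mem_aniso.1 hα).2

lemma lie_mem_core (e : E) {x : E} (hx : x ∈ core B H) : ⁅e, x⁆ ∈ core B H := by
  refine core_induction (p := fun x => ∀ e : E, ⁅e, x⁆ ∈ core B H) ?_ ?_ ?_ ?_ ?_ hx e
  · intro α hα x hx e
    have := simWt_induction h.iSup_simWt ⊤ (fun _ _ _ => trivial)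
      ((core B H).toSubmodule.comap (LieAlgebra.ad k E x))
      (fun β e _ he => ?_) (Submodule.mem_top (x := e))
    · rw [← lie_skew]
      exact (core B H).neg_mem this
    · change ⁅x, e⁆ ∈ core B H
      rw [← lie_skew]
      refine (core B H).neg_mem ?_
      by_cases he0 : ⁅e, x⁆ = 0
      · rw [he0]; exact (core B H).zero_mem
      have he' : e ∈ wtSpace H β := he
      have hβ : wtSpace H β ≠ ⊥ :=
        (Submodule.ne_bot_iff _).2 ⟨e, he', fun h0 => he0 (by rw [h0, zero_lie])⟩
      rcases h.aniso_or_iso hβ with hβ | hβ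
      · exact (core B H).lie_mem (mem_core_of_mem_wtSpace hβ he') (mem_core_of_mem_wtSpace hα hx)
      · have h1 := lie_mem_wtSpace he' hx
        exact mem_core_of_mem_wtSpace (h.iso_add_aniso hβ hα
          ((Submodule.ne_bot_iff _).2 ⟨_, h1, he0⟩)) h1
  · intro e; rw [lie_zero]; exact (core B H).zero_mem
  · intro x y _ _ hx hy e; rw [lie_add]; exact (core B H).add_mem (hx e) (hy e)
  · intro c x _ hx e; rw [lie_smul]; exact (core B H).smul_mem c (hx e)
  · intro x y hx hy hx' hy' e
    rw [leibniz_lie]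
    exact (core B H).add_mem ((core B H).lie_mem (hx' e) hy) ((core B H).lie_mem hx (hy' e))

lemma toH_mem_core {α : Module.Dual k H} (hα : α ∈ anisoRootSet B H) :
    (h.toH α : E) ∈ core B H := by
  obtain ⟨x, hx, hxne⟩ := (Submodule.ne_bot_iff _).1 (h.mem_aniso.1 hα).1
  obtain ⟨y, hy, hxy⟩ := h.exists_dual hx hxne
  have := (core B H).lie_mem (mem_core_of_mem_wtSpace hα hx)
    (mem_core_of_mem_wtSpace (h.neg_mem_aniso hα) hy)
  rwa [h.lie_eq_toH hx hy, hxy, one_smul] at this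

lemma mem_span_lie_of_mem_core {x : E} (hx : x ∈ core B H) :
    x ∈ Submodule.span k {z : E | ∃ a ∈ core B H, ∃ b ∈ core B H, ⁅a, b⁆ = z} := by
  refine core_induction ?_ (Submodule.zero_mem _) (fun x y _ _ => Submodule.add_mem _)
    (fun c x _ => Submodule.smul_mem _ c) ?_ hx
  · intro α hα x hx
    have h0 := (h.mem_aniso.1 hα).2
    have : x = (α (h.toH α))⁻¹ • ⁅(h.toH α : E), x⁆ := by
      rw [hx, smul_smul, inv_mul_cancel₀ h0, one_smul]
    rw [this]
    exact Submodule.smul_mem _ _ (Submodule.subset_span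
      ⟨_, h.toH_mem_core hα, _, mem_core_of_mem_wtSpace hα hx, rfl⟩)
  · intro x y hx hy _ _
    exact Submodule.subset_span ⟨x, hx, y, hy, rfl⟩

lemma centralizes_core_iff {e : E} :
    (∀ x ∈ core B H, ⁅e, x⁆ = 0) ↔ ∀ x ∈ core B H, B e x = 0 := by
  constructor
  · intro he x hx
    have := Submodule.span_le (p := LinearMap.ker (B e)).2 ?_ (h.mem_span_lie_of_mem_core hx)
    · exact this
    · rintro _ ⟨a, ha, b, hb, rfl⟩
      change B e ⁅a, b⁆ = 0
      rw [← h.invariant, he a ha, map_zero, LinearMap.zero_apply]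
  · intro he x hx
    refine h.nondeg _ fun y => ?_
    rw [h.invariant, ← lie_skew, map_neg, he _ (h.lie_mem_core y hx), neg_zero]

lemma aniso_nonempty : (anisoRootSet B H).Nonempty := by
  by_contra hne
  rw [Set.not_nonempty_iff_eq_empty] at hne
  have hcore : ∀ x ∈ core B H, x = 0 := fun x hx =>
    core_induction (p := fun x => x = 0) (by simp [hne]) (Eq.refl (0 : E)) (by simp +contextual)
      (by simp +contextual) (by simp +contextual) hx
  apply h.H_ne_bot
  rw [eq_bot_iff]
  intro x _
  refine hcore x (h.ea4 x fun y hy => ?_)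
  rw [hcore y hy, lie_zero]

/-- Anisotropic root spaces are one-dimensional. -/
lemma exists_smul_eq {α : Module.Dual k H} (hα : α ∈ anisoRootSet B H) {x x' : E}
    (hx : x ∈ wtSpace H α) (hxne : x ≠ 0) (hx' : x' ∈ wtSpace H α) : ∃ c : k, x' = c • x := by
  obtain ⟨y, hy, hxy, t⟩ := h.exists_sl2 hα hx hxne
  have h0 := (h.mem_aniso.1 hα).2
  have hB : B x y ≠ 0 := by
    rw [hxy]
    exact div_ne_zero two_ne_zero h0
  refine ⟨B x' y / B x y, sub_eq_zero.1 ?_⟩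
  by_contra hne
  set w := x' - (B x' y / B x y) • x with hw
  have hwm : w ∈ wtSpace H α := Submodule.sub_mem _ hx' (Submodule.smul_mem _ _ hx)
  have hyw : ⁅y, w⁆ = 0 := by
    rw [← lie_skew, h.lie_eq_toH hwm hy]
    simp [hw, hB]
  obtain ⟨n, hn⟩ := t.symm.exists_nat_of_nilpotent hne (μ := (-2 : k)) (by
    rw [neg_lie, hwm, map_smul, smul_eq_mul, div_mul_cancel₀ _ h0, ← neg_smul]) hyw
    (h.ea2 α hα x hx w)
  have : ((n + 2 : ℕ) : k) = 0 := by push_cast; rw [← hn]; ring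
  norm_cast at this

lemma eq_zero_of_centralizes {α : Module.Dual k H} (hα : α ∈ anisoRootSet B H) {x : E}
    (hx : x ∈ wtSpace H α) (hc : ∀ y ∈ core B H, ⁅x, y⁆ = 0) : x = 0 := by
  by_contra hne
  obtain ⟨y, hy, hxy⟩ := h.exists_dual hx hne
  have h1 := h.centralizes_core_iff.1 hc y (mem_core_of_mem_wtSpace (h.neg_mem_aniso hα) hy)
  rw [hxy] at h1
  exact one_ne_zero h1

/-- A graded ideal of the core which is not central is everything. -/
lemma core_le_of_graded_ideal (I : Submodule k E) (hH : ∀ v : H, ∀ m ∈ I, ⁅(v : E), m⁆ ∈ I)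
    (hid : ∀ x ∈ core B H, ∀ y ∈ I, ⁅x, y⁆ ∈ I)
    (hne : ∃ x ∈ I, ∃ y ∈ core B H, ⁅x, y⁆ ≠ 0) {x : E} (hx : x ∈ core B H) : x ∈ I := by
  have hB : ∀ α ∈ anisoRootSet B H, ∀ v ∈ wtSpace H α, v ∈ I → v ≠ 0 → (h.toH α : E) ∈ I := by
    intro α hα v hv hvI hv0
    obtain ⟨y, hy, hxy⟩ := h.exists_dual hv hv0
    have := hid y (mem_core_of_mem_wtSpace (h.neg_mem_aniso hα) hy) v hvI
    rw [← lie_skew, h.lie_eq_toH hv hy, hxy, one_smul] at this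
    simpa using this
  have hB' : ∀ α, (h.toH α : E) ∈ I → ∀ β ∈ anisoRootSet B H, β (h.toH α) ≠ 0 →
      ∀ v ∈ wtSpace H β, v ∈ I := by
    intro α hα β hβ hne v hv
    have := hid v (mem_core_of_mem_wtSpace hβ hv) _ hα
    rw [← lie_skew, hv, ← neg_smul] at this
    exact (I.smul_mem_iff (neg_ne_zero.2 hne)).1 this
  have hA : ∃ α ∈ anisoRootSet B H, ∃ v ∈ wtSpace H α, v ∈ I ∧ v ≠ 0 := by
    obtain ⟨x, hxI, y, hy, hxy⟩ := hne
    obtain ⟨l, x, hxI, hxl, hxy⟩ : ∃ l, ∃ x ∈ I, x ∈ wtSpace H l ∧ ⁅x, y⁆ ≠ 0 := by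
      by_contra! hcon
      have := simWt_induction h.iSup_simWt I hH
        (LinearMap.ker (LieAlgebra.ad k E y))
        (fun α m hm hm' => by
          rw [LinearMap.mem_ker, LieAlgebra.ad_apply, ← lie_skew, hcon α m hm hm', neg_zero]) hxI
      rw [LinearMap.mem_ker, LieAlgebra.ad_apply, ← lie_skew, neg_eq_zero] at this
      exact hxy this
    have hx0 : x ≠ 0 := by rintro rfl; simp at hxy
    rcases h.aniso_or_iso ((Submodule.ne_bot_iff _).2 ⟨x, hxl, hx0⟩) with hl | hl
    · exact ⟨l, hl, x, hxl, hxI, hx0⟩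
    obtain ⟨β, hβ, v, hv, hxv⟩ : ∃ β ∈ anisoRootSet B H, ∃ v ∈ wtSpace H β, ⁅x, v⁆ ≠ 0 := by
      by_contra! hcon
      refine hxy (core_induction (p := fun y => ⁅x, y⁆ = 0) hcon (lie_zero x) ?_ ?_ ?_ hy)
      · intro y z _ _ hy hz; rw [lie_add, hy, hz, add_zero]
      · intro c y _ hy; rw [lie_smul, hy, smul_zero]
      · intro y z _ _ hy hz; rw [leibniz_lie, hy, hz, zero_lie, lie_zero, add_zero]
    have hm := lie_mem_wtSpace hxl hv
    refine ⟨l + β, h.iso_add_aniso hl hβ ((Submodule.ne_bot_iff _).2 ⟨_, hm, hxv⟩), _, hm, ?_, hxv⟩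
    have := hid v (mem_core_of_mem_wtSpace hβ hv) x hxI
    rw [← lie_skew]
    exact I.neg_mem this
  obtain ⟨α, hα, v, hv, hvI, hv0⟩ := hA
  have hall : ∀ β ∈ anisoRootSet B H, ∀ w ∈ wtSpace H β, w ∈ I := by
    by_contra! hcon
    obtain ⟨β, hβ, w, hw, hwI⟩ := hcon
    obtain ⟨a, ha, b, hb, t, ht, s, hs, hts⟩ := h.ea3
      {β | β ∈ anisoRootSet B H ∧ ∀ w ∈ wtSpace H β, w ∈ I}
      {β | β ∈ anisoRootSet B H ∧ ¬ ∀ w ∈ wtSpace H β, w ∈ I}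
      (by ext γ; simp only [Set.mem_union, Set.mem_ofPred_eq]; tauto)
      ⟨α, hα, hB' α (hB α hα v hv hvI hv0) α hα (h.mem_aniso.1 hα).2⟩
      ⟨β, hβ, fun hcon => hwI (hcon w hw)⟩
    rw [h.mem_reps] at ht hs
    subst ht hs
    rw [h.form_toH] at hts
    obtain ⟨u, hu, hu0⟩ := (Submodule.ne_bot_iff _).1 (h.mem_aniso.1 ha.1).1
    exact hb.2 (hB' a (hB a ha.1 u hu (ha.2 u hu) hu0) b hb.1 (by rwa [h.toH_symm]))
  exact core_induction hall I.zero_mem (fun x y _ _ => I.add_mem) (fun c x _ => I.smul_mem c)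
    (fun x y hx _ _ hy => hid x hx y hy) hx

end IsEALA

end CoreStructure

section WeightProjection

variable {k V M : Type*} [Field k] [AddCommGroup V] [Module k V] [AddCommGroup M] [Module k M]
  {τ : V → Module.End k M}

/-- The projection to a weight space; it preserves stable submodules. -/
lemma simWt_exists_stable_proj (htop : ⨆ α, simWt τ α = ⊤) (α : Module.Dual k V) :
    ∃ P : M →ₗ[k] M, (∀ x, P x ∈ simWt τ α) ∧ (∀ x ∈ simWt τ α, P x = x) ∧
      (∀ β, β ≠ α → ∀ x ∈ simWt τ β, P x = 0) ∧
      ∀ N : Submodule k M, (∀ v, ∀ m ∈ N, τ v m ∈ N) → ∀ x ∈ N, P x ∈ N := by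
  obtain ⟨P, h1, h2⟩ := simWt_exists_proj htop α
  refine ⟨P, fun x => ?_, h1, h2, fun N hN x hx => ?_⟩
  · have := simWt_induction htop ⊤ (fun _ _ _ => trivial) ((simWt τ α).comap P)
      (fun β m _ hm => ?_) (Submodule.mem_top (x := x))
    · exact this
    · rw [Submodule.mem_comap]
      by_cases hβ : β = α
      · subst hβ; rwa [h1 m hm]
      · rw [h2 β hβ m hm]; exact Submodule.zero_mem _
  · refine simWt_induction htop N hN (N.comap P) (fun β m hmN hm => ?_) hx
    rw [Submodule.mem_comap]
    by_cases hβ : β = α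
    · subst hβ; rwa [h1 m hm]
    · rw [h2 β hβ m hm]; exact Submodule.zero_mem _

end WeightProjection

section CoreQuotient

variable {k E L : Type*} [Field k] [CharZero k] [LieRing E] [LieAlgebra k E]
  [LieRing L] [LieAlgebra k L]

/-- `L` is the centreless core of the extended affine Lie algebra `(E, H, B)`. -/
structure CoreQuot (B : E →ₗ[k] E →ₗ[k] k) (H : LieSubalgebra k E) (L : Type*)
    [LieRing L] [LieAlgebra k L] where
  isEALA : IsEALA B H
  π : core B H →ₗ⁅k⁆ L
  surj : Function.Surjective π
  ker : ∀ x, π x = 0 ↔ ∀ y : core B H, ⁅x, y⁆ = 0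

variable {B : E →ₗ[k] E →ₗ[k] k} {H : LieSubalgebra k E}

namespace CoreQuot

variable (Q : CoreQuot B H L)

lemma pi_eq_zero_iff (x : core B H) : Q.π x = 0 ↔ ∀ y ∈ core B H, ⁅(x : E), y⁆ = 0 := by
  rw [Q.ker]
  constructor
  · intro hx y hy
    exact congrArg Subtype.val (hx ⟨y, hy⟩)
  · intro hx y
    exact Subtype.ext (hx y y.2)

lemma pi_eq_zero_iff_form (x : core B H) : Q.π x = 0 ↔ ∀ y ∈ core B H, B (x : E) y = 0 := by
  rw [Q.pi_eq_zero_iff, Q.isEALA.centralizes_core_iff]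

lemma exists_section : ∃ σ : L →ₗ[k] core B H, ∀ a, Q.π (σ a) = a := by
  obtain ⟨σ, hσ⟩ := (Q.π : core B H →ₗ[k] L).exists_rightInverse_of_surjective
    (LinearMap.range_eq_top.2 Q.surj)
  exact ⟨σ, fun a => LinearMap.congr_fun hσ a⟩

/-- A linear section of the quotient map. -/
noncomputable def sec : L →ₗ[k] core B H := Q.exists_section.choose

lemma pi_sec (a : L) : Q.π (Q.sec a) = a := Q.exists_section.choose_spec a

/-- The adjoint action of `E` on its core. -/
noncomputable def adCore : E →ₗ[k] Module.End k (core B H) where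
  toFun e := (LieAlgebra.ad k E e).restrict (p := (core B H).toSubmodule)
    (q := (core B H).toSubmodule) fun _ hx => Q.isEALA.lie_mem_core e hx
  map_add' e e' := by ext x; exact add_lie e e' (x : E)
  map_smul' c e := by ext x; exact smul_lie c e (x : E)

lemma coe_adCore (e : E) (x : core B H) : (Q.adCore e x : E) = ⁅e, (x : E)⁆ := rfl

lemma pi_adCore_eq_zero (e : E) (x : core B H) (hx : Q.π x = 0) : Q.π (Q.adCore e x) = 0 := by
  rw [Q.pi_eq_zero_iff] at hx ⊢
  intro y hy
  rw [coe_adCore, lie_lie, hx y hy, lie_zero, hx _ (Q.isEALA.lie_mem_core e hy), sub_zero]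

/-- The action of `E` on the centreless core. -/
noncomputable def rho : E →ₗ[k] Module.End k L where
  toFun e := (Q.π : core B H →ₗ[k] L) ∘ₗ Q.adCore e ∘ₗ Q.sec
  map_add' e e' := by ext x; simp
  map_smul' c e := by ext x; simp

lemma rho_pi (e : E) (x : core B H) : Q.rho e (Q.π x) = Q.π (Q.adCore e x) := by
  change Q.π (Q.adCore e (Q.sec (Q.π x))) = _
  rw [← sub_eq_zero, ← map_sub, ← map_sub]
  apply Q.pi_adCore_eq_zero
  rw [map_sub, Q.pi_sec, sub_self]

lemma rho_pi' (e : E) (x : E) (hx : x ∈ core B H) :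
    Q.rho e (Q.π ⟨x, hx⟩) = Q.π ⟨⁅e, x⁆, Q.isEALA.lie_mem_core e hx⟩ := Q.rho_pi e ⟨x, hx⟩

lemma rho_core (x : core B H) (a : L) : Q.rho (x : E) a = ⁅Q.π x, a⁆ := by
  obtain ⟨y, rfl⟩ := Q.surj a
  rw [rho_pi, ← LieHom.map_lie]
  rfl

lemma rho_lie (e e' : E) : Q.rho ⁅e, e'⁆ = Q.rho e * Q.rho e' - Q.rho e' * Q.rho e := by
  ext a
  obtain ⟨x, rfl⟩ := Q.surj a
  simp only [LinearMap.sub_apply, Module.End.mul_apply, rho_pi, ← map_sub]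
  congr 1
  ext
  simp [coe_adCore]

lemma rho_lie_apply (e : E) (a b : L) : Q.rho e ⁅a, b⁆ = ⁅Q.rho e a, b⁆ + ⁅a, Q.rho e b⁆ := by
  obtain ⟨x, rfl⟩ := Q.surj a
  obtain ⟨y, rfl⟩ := Q.surj b
  rw [← LieHom.map_lie, rho_pi, rho_pi, rho_pi, ← LieHom.map_lie, ← LieHom.map_lie, ← map_add]
  congr 1
  ext
  exact leibniz_lie e (x : E) (y : E)

include Q in
lemma mem_span_lie (a : L) : a ∈ Submodule.span k {z : L | ∃ b c : L, ⁅b, c⁆ = z} := by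
  obtain ⟨⟨x, hx⟩, rfl⟩ := Q.surj a
  have h1 := Q.isEALA.mem_span_lie_of_mem_core hx
  have : ∀ z ∈ Submodule.span k {z : E | ∃ a ∈ core B H, ∃ b ∈ core B H, ⁅a, b⁆ = z},
      ∃ hz : z ∈ core B H, Q.π ⟨z, hz⟩ ∈ Submodule.span k {z : L | ∃ b c : L, ⁅b, c⁆ = z} := by
    intro z hz
    induction hz using Submodule.span_induction with
    | mem z hz =>
      obtain ⟨a, ha, b, hb, rfl⟩ := hz
      exact ⟨(core B H).lie_mem ha hb, Submodule.subset_span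
        ⟨Q.π ⟨a, ha⟩, Q.π ⟨b, hb⟩, (Q.π.map_lie ⟨a, ha⟩ ⟨b, hb⟩).symm⟩⟩
    | zero => exact ⟨(core B H).zero_mem, by
        have := Submodule.zero_mem (Submodule.span k {z : L | ∃ b c : L, ⁅b, c⁆ = z})
        rwa [← map_zero Q.π] at this⟩
    | add u v _ _ hu hv =>
      obtain ⟨hu, hu'⟩ := hu
      obtain ⟨hv, hv'⟩ := hv
      refine ⟨(core B H).add_mem hu hv, ?_⟩
      have := Submodule.add_mem _ hu' hv'
      rwa [← map_add] at this
    | smul c u _ hu =>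
      obtain ⟨hu, hu'⟩ := hu
      refine ⟨(core B H).smul_mem c hu, ?_⟩
      have := Submodule.smul_mem _ c hu'
      rwa [← map_smul] at this
  exact (this x h1).2

include Q in
/-- Linear maps on `L` agreeing on brackets are equal. -/
lemma linearMap_ext {M : Type*} [AddCommGroup M] [Module k M] {f f' : L →ₗ[k] M}
    (hf : ∀ a b : L, f ⁅a, b⁆ = f' ⁅a, b⁆) : f = f' := by
  ext a
  have := Submodule.span_le (p := LinearMap.eqLocus f f').2 ?_ (Q.mem_span_lie a)
  · exact this
  · rintro _ ⟨b, c, rfl⟩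
    exact hf b c

/-- The form induced on the centreless core. -/
noncomputable def form : L →ₗ[k] L →ₗ[k] k :=
  B.compl₁₂ ((core B H).toSubmodule.subtype ∘ₗ Q.sec) ((core B H).toSubmodule.subtype ∘ₗ Q.sec)

lemma form_pi (x y : core B H) : Q.form (Q.π x) (Q.π y) = B (x : E) (y : E) := by
  have h1 : ∀ x z : core B H, B (Q.sec (Q.π x) : E) (z : E) = B (x : E) (z : E) := by
    intro x z
    rw [← sub_eq_zero, ← LinearMap.sub_apply, ← map_sub]
    refine (Q.pi_eq_zero_iff_form (Q.sec (Q.π x) - x)).1 ?_ z z.2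
    rw [map_sub, Q.pi_sec, sub_self]
  change B (Q.sec (Q.π x) : E) (Q.sec (Q.π y) : E) = _
  rw [h1, Q.isEALA.symm, h1, Q.isEALA.symm]

lemma form_nondeg (a : L) (ha : ∀ b : L, Q.form a b = 0) : a = 0 := by
  obtain ⟨x, rfl⟩ := Q.surj a
  rw [Q.pi_eq_zero_iff_form]
  intro y hy
  rw [← Q.form_pi x ⟨y, hy⟩, ha]

lemma form_rho (e : E) (a b : L) : Q.form (Q.rho e a) b = - Q.form a (Q.rho e b) := by
  obtain ⟨x, rfl⟩ := Q.surj a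
  obtain ⟨y, rfl⟩ := Q.surj b
  rw [rho_pi, rho_pi, form_pi, form_pi]
  exact Q.isEALA.form_lie_left _ _ _

lemma form_lie (a b c : L) : Q.form ⁅a, b⁆ c = Q.form a ⁅b, c⁆ := by
  obtain ⟨x, rfl⟩ := Q.surj a
  obtain ⟨y, rfl⟩ := Q.surj b
  obtain ⟨z, rfl⟩ := Q.surj c
  rw [← LieHom.map_lie, ← LieHom.map_lie, form_pi, form_pi]
  exact Q.isEALA.invariant _ _ _

include Q in
lemma eq_zero_of_lie (a : L) (ha : ∀ b : L, ⁅a, b⁆ = 0) : a = 0 := by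
  refine Q.form_nondeg a fun b => ?_
  have := Q.linearMap_ext (f := Q.form a) (f' := 0) fun b c => by
    rw [← Q.form_lie, ha, map_zero, LinearMap.zero_apply, LinearMap.zero_apply]
  rw [this, LinearMap.zero_apply]

lemma rho_eq_zero_iff (e : E) : Q.rho e = 0 ↔ ∀ x ∈ core B H, ⁅e, x⁆ = 0 := by
  constructor
  · intro he
    rw [Q.isEALA.centralizes_core_iff]
    intro x hx
    refine Submodule.span_le (p := LinearMap.ker (B e)).2 ?_ (Q.isEALA.mem_span_lie_of_mem_core hx)
    rintro _ ⟨a, ha, b, hb, rfl⟩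
    change B e ⁅a, b⁆ = 0
    rw [← Q.isEALA.invariant]
    refine (Q.pi_eq_zero_iff_form ⟨⁅e, a⁆, Q.isEALA.lie_mem_core e ha⟩).1 ?_ b hb
    rw [← Q.rho_pi' e a ha, he, LinearMap.zero_apply]
  · intro he
    ext a
    obtain ⟨x, rfl⟩ := Q.surj a
    rw [rho_pi]
    have : Q.adCore e x = 0 := Subtype.ext (he x x.2)
    rw [this, map_zero, LinearMap.zero_apply]

/-- The weight spaces of the centreless core. -/
noncomputable abbrev wt (α : Module.Dual k H) : Submodule k L := simWt (fun v : H => Q.rho v) α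

lemma pi_mem_wt {α : Module.Dual k H} {x : E} (hx : x ∈ core B H) (hxα : x ∈ wtSpace H α) :
    Q.π ⟨x, hx⟩ ∈ Q.wt α := by
  intro v
  rw [rho_pi', ← map_smul]
  congr 1
  ext
  exact hxα v

lemma iSup_wt : ⨆ α, Q.wt α = ⊤ := by
  rw [eq_top_iff]
  rintro a -
  obtain ⟨⟨x, hx⟩, rfl⟩ := Q.surj a
  obtain ⟨s, m, hm, rfl⟩ := simWt_exists_decomp Q.isEALA.iSup_simWt x
  have h1 := simWt_component_mem (core B H).toSubmodule
    (fun (v : H) m hm => Q.isEALA.lie_mem_core (v : E) hm) s m (fun α _ => hm α) hx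
  have : (⟨∑ α ∈ s, m α, hx⟩ : core B H) = ∑ α ∈ s.attach, ⟨m α, h1 α α.2⟩ := by
    ext
    push_cast
    exact (Finset.sum_attach s m).symm
  rw [this, map_sum]
  refine Submodule.sum_mem _ fun α _ => Submodule.mem_iSup_of_mem (α : Module.Dual k H) ?_
  exact Q.pi_mem_wt _ (hm α)

lemma rho_mem_wt {α β : Module.Dual k H} {e : E} {a : L} (he : e ∈ wtSpace H α)
    (ha : a ∈ Q.wt β) : Q.rho e a ∈ Q.wt (α + β) := by
  intro v
  have h1 := LinearMap.congr_fun (Q.rho_lie v e) a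
  rw [he v, map_smul, LinearMap.sub_apply, Module.End.mul_apply, Module.End.mul_apply, ha v,
    map_smul, LinearMap.smul_apply] at h1
  rw [LinearMap.add_apply, add_smul, h1, sub_add_cancel]

lemma lie_mem_wt {α β : Module.Dual k H} {a b : L} (ha : a ∈ Q.wt α) (hb : b ∈ Q.wt β) :
    ⁅a, b⁆ ∈ Q.wt (α + β) := by
  intro v
  rw [rho_lie_apply, ha v, hb v, smul_lie, lie_smul, ← add_smul, LinearMap.add_apply]

lemma exists_lift {α : Module.Dual k H} {a : L} (ha : a ∈ Q.wt α) :
    ∃ x, ∃ hx : x ∈ core B H, x ∈ wtSpace H α ∧ Q.π ⟨x, hx⟩ = a := by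
  obtain ⟨P, hP1, hP2, hP3, -⟩ := simWt_exists_stable_proj Q.iSup_wt α
  obtain ⟨P', hP1', hP2', hP3', hP4'⟩ := simWt_exists_stable_proj Q.isEALA.iSup_simWt α
  have hst : ∀ v : H, ∀ m ∈ (core B H).toSubmodule,
      LieAlgebra.ad k E v m ∈ (core B H).toSubmodule :=
    fun v m hm => Q.isEALA.lie_mem_core (v : E) hm
  have key : ∀ x (hx : x ∈ core B H), P (Q.π ⟨x, hx⟩) = Q.π ⟨P' x, hP4' _ hst x hx⟩ := by
    intro x hx
    obtain ⟨s, m, hm, hxs⟩ := simWt_exists_decomp Q.isEALA.iSup_simWt x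
    have h1 := simWt_component_mem (core B H).toSubmodule hst s m (fun α _ => hm α) (hxs ▸ hx)
    let f : core B H →ₗ[k] L := P ∘ₗ (Q.π : core B H →ₗ[k] L)
    let f' : core B H →ₗ[k] L := (Q.π : core B H →ₗ[k] L) ∘ₗ
      (P'.restrict (p := (core B H).toSubmodule) (q := (core B H).toSubmodule) (hP4' _ hst))
    change f ⟨x, hx⟩ = f' ⟨x, hx⟩
    have : (⟨x, hx⟩ : core B H) = ∑ α ∈ s.attach, ⟨m α, h1 α α.2⟩ := by
      ext
      push_cast
      rw [hxs]
      exact (Finset.sum_attach s m).symm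
    rw [this, map_sum, map_sum]
    refine Finset.sum_congr rfl fun β _ => ?_
    change P (Q.π ⟨m β, _⟩) = Q.π ⟨P' (m β), _⟩
    by_cases hβ : (β : Module.Dual k H) = α
    · rw [hP2 _ (hβ ▸ Q.pi_mem_wt _ (hm β))]
      congr 1
      ext
      exact (hP2' _ (hβ ▸ hm β)).symm
    · rw [hP3 β hβ _ (Q.pi_mem_wt _ (hm β))]
      symm
      convert map_zero Q.π
      exact Subtype.ext (hP3' β hβ _ (hm β))
  obtain ⟨⟨x, hx⟩, rfl⟩ := Q.surj a
  exact ⟨P' x, hP4' _ hst x hx, hP1' x, by rw [← key x hx, hP2 _ ha]⟩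

lemma wtSpace_ne_bot {α : Module.Dual k H} {a : L} (ha : a ∈ Q.wt α) (hne : a ≠ 0) :
    wtSpace H α ≠ ⊥ := by
  obtain ⟨x, hx, hxα, rfl⟩ := Q.exists_lift ha
  refine (Submodule.ne_bot_iff _).2 ⟨x, hxα, ?_⟩
  rintro rfl
  exact hne (map_zero Q.π)

/-- A stable ideal of the centreless core is trivial. -/
lemma stable_ideal (I : Submodule k L) (hH : ∀ v : H, ∀ a ∈ I, Q.rho v a ∈ I)
    (hid : ∀ a : L, ∀ b ∈ I, ⁅a, b⁆ ∈ I) (hne : I ≠ ⊥) : I = ⊤ := by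
  rw [eq_top_iff]
  rintro a -
  obtain ⟨⟨x, hx⟩, rfl⟩ := Q.surj a
  have hmem : ∀ x, x ∈ (I.comap (Q.π : core B H →ₗ[k] L)).map (core B H).toSubmodule.subtype ↔
      ∃ hx : x ∈ core B H, Q.π ⟨x, hx⟩ ∈ I := by
    intro x
    constructor
    · rintro ⟨y, hy, rfl⟩
      exact ⟨y.2, hy⟩
    · rintro ⟨hx, hxI⟩
      exact ⟨⟨x, hx⟩, hxI, rfl⟩
  have := Q.isEALA.core_le_of_graded_ideal
    ((I.comap (Q.π : core B H →ₗ[k] L)).map (core B H).toSubmodule.subtype) ?_ ?_ ?_ hx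
  · exact ((hmem x).1 this).2
  · intro v m hm
    obtain ⟨hm, hm'⟩ := (hmem m).1 hm
    refine (hmem _).2 ⟨Q.isEALA.lie_mem_core _ hm, ?_⟩
    rw [← Q.rho_pi' _ m hm]
    exact hH v _ hm'
  · intro y hy m hm
    obtain ⟨hm, hm'⟩ := (hmem m).1 hm
    refine (hmem _).2 ⟨Q.isEALA.lie_mem_core _ hm, ?_⟩
    rw [← Q.rho_pi' _ m hm, Q.rho_core ⟨y, hy⟩]
    exact hid _ _ hm'
  · obtain ⟨a, ha, ha0⟩ := (Submodule.ne_bot_iff _).1 hne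
    obtain ⟨⟨y, hy⟩, rfl⟩ := Q.surj a
    refine ⟨y, (hmem y).2 ⟨hy, ha⟩, ?_⟩
    by_contra! hcon
    exact ha0 ((Q.pi_eq_zero_iff ⟨y, hy⟩).2 hcon)

lemma iterate_lie_pi (x : core B H) (y : core B H) (N : ℕ) :
    (fun b => ⁅Q.π x, b⁆)^[N] (Q.π y) =
      Q.π ((fun z => ⁅x, z⁆)^[N] y) := by
  induction N with
  | zero => rfl
  | succ N ih => rw [Function.iterate_succ_apply', Function.iterate_succ_apply', ih, LieHom.map_lie]

/-- An anisotropic root vector gives an `sl₂`-triple in the centreless core, with a weight vector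
of weight `0` for the neutral element. -/
lemma exists_sl2 {α : Module.Dual k H} (hα : α ∈ anisoRootSet B H) :
    ∃ h e f : L, IsSl2Triple h e f ∧ e ∈ Q.wt α ∧ h ∈ Q.wt 0 ∧
      (∀ b ∈ Q.wt α, ∃ c : k, b = c • e) ∧
      (∀ β, ∀ b ∈ Q.wt β, ⁅h, b⁆ = (2 * β (Q.isEALA.toH α) / α (Q.isEALA.toH α)) • b) ∧
      (∀ b : L, ∃ N : ℕ, (fun z => ⁅f, z⁆)^[N] b = 0) := by
  have hE := Q.isEALA
  obtain ⟨x, hx, hxne⟩ := (Submodule.ne_bot_iff _).1 (hE.mem_aniso.1 hα).1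
  obtain ⟨y, hy, hxy, t⟩ := hE.exists_sl2 hα hx hxne
  have hα' := hE.neg_mem_aniso hα
  have hxc := mem_core_of_mem_wtSpace hα hx
  have hyc := mem_core_of_mem_wtSpace hα' hy
  set c := 2 / α (hE.toH α) with hc
  have h0 := (hE.mem_aniso.1 hα).2
  have hc0 : c ≠ 0 := div_ne_zero two_ne_zero h0
  have htc : ((c • hE.toH α : H) : E) ∈ core B H :=
    (core B H).smul_mem c (hE.toH_mem_core hα)
  have hπx : Q.π ⟨x, hxc⟩ ≠ 0 := fun h1 =>
    hxne (hE.eq_zero_of_centralizes hα hx ((Q.pi_eq_zero_iff ⟨x, hxc⟩).1 h1))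
  have h1 : ⁅(⟨_, htc⟩ : core B H), (⟨x, hxc⟩ : core B H)⁆ = 2 • ⟨x, hxc⟩ :=
    Subtype.ext t.lie_h_e_nsmul
  have h2 : ⁅(⟨_, htc⟩ : core B H), (⟨y, hyc⟩ : core B H)⁆ = -(2 • ⟨y, hyc⟩) :=
    Subtype.ext t.lie_h_f_nsmul
  have h3 : ⁅(⟨x, hxc⟩ : core B H), (⟨y, hyc⟩ : core B H)⁆ = ⟨_, htc⟩ :=
    Subtype.ext t.lie_e_f
  refine ⟨Q.π ⟨_, htc⟩, Q.π ⟨x, hxc⟩, Q.π ⟨y, hyc⟩, ⟨?_, ?_, ?_, ?_⟩, Q.pi_mem_wt hxc hx, ?_, ?_,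
    ?_, ?_⟩
  · intro h4
    have h5 := Q.π.map_lie ⟨_, htc⟩ ⟨x, hxc⟩
    rw [h4, zero_lie, h1, map_nsmul, ← Nat.cast_smul_eq_nsmul k, smul_eq_zero] at h5
    exact hπx (h5.resolve_left (by norm_num))
  · rw [← LieHom.map_lie, h3]
  · rw [← LieHom.map_lie, h1, map_nsmul]
  · rw [← LieHom.map_lie, h2, map_neg, map_nsmul]
  · refine Q.pi_mem_wt htc ?_
    rw [hE.self_centralizing]
    exact (c • hE.toH α : H).2
  · intro b hb
    obtain ⟨z, hz, hzα, rfl⟩ := Q.exists_lift hb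
    obtain ⟨d, rfl⟩ := hE.exists_smul_eq hα hx hxne hzα
    exact ⟨d, Q.π.map_smul d ⟨x, hxc⟩⟩
  · intro β b hb
    rw [← Q.rho_core ⟨_, htc⟩]
    change Q.rho ((c • hE.toH α : H) : E) b = _
    rw [hb, map_smul, smul_eq_mul, hc]
    congr 1
    ring
  · intro b
    obtain ⟨z, rfl⟩ := Q.surj b
    obtain ⟨N, hN⟩ := hE.ea2 _ hα' y hy (z : E)
    refine ⟨N, ?_⟩
    rw [Q.iterate_lie_pi]
    have : ((((fun w => ⁅(⟨y, hyc⟩ : core B H), w⁆)^[N] z : core B H)) : E) = 0 := by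
      rw [← hN]
      clear hN
      induction N with
      | zero => rfl
      | succ N ih =>
        rw [Function.iterate_succ_apply', Function.iterate_succ_apply', ← ih]
        rfl
    exact (congrArg Q.π (Subtype.ext this : _ = (0 : core B H))).trans (map_zero _)

end CoreQuot

end CoreQuotient

section Centroid

variable {k E L : Type*} [Field k] [CharZero k] [LieRing E] [LieAlgebra k E]
  [LieRing L] [LieAlgebra k L]

variable (k L) in
/-- The centroid of a Lie algebra. -/
def centroidAlg : Subalgebra k (Module.End k L) where
  carrier := {χ | ∀ a b : L, χ ⁅a, b⁆ = ⁅χ a, b⁆}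
  mul_mem' := by
    intro χ ψ hχ hψ a b
    rw [Module.End.mul_apply, hψ, hχ, Module.End.mul_apply]
  add_mem' := by
    intro χ ψ hχ hψ a b
    rw [LinearMap.add_apply, hψ, hχ, LinearMap.add_apply, add_lie]
  algebraMap_mem' := by
    intro c a b
    rw [Module.algebraMap_end_apply, Module.algebraMap_end_apply, smul_lie]

lemma centroidAlg_lie_right {χ : Module.End k L} (hχ : χ ∈ centroidAlg k L) (a b : L) :
    χ ⁅a, b⁆ = ⁅a, χ b⁆ := by
  rw [← lie_skew, map_neg, hχ, lie_skew]

variable {B : E →ₗ[k] E →ₗ[k] k} {H : LieSubalgebra k E}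

namespace CoreQuot

variable (Q : CoreQuot B H L)

include Q in
lemma centroid_comm {χ ψ : Module.End k L} (hχ : χ ∈ centroidAlg k L) (hψ : ψ ∈ centroidAlg k L) :
    χ * ψ = ψ * χ := by
  refine Q.linearMap_ext fun a b => ?_
  rw [Module.End.mul_apply, Module.End.mul_apply, centroidAlg_lie_right hψ, hχ, hχ,
    centroidAlg_lie_right hψ]

lemma rho_commutator_mem (e : E) {χ : Module.End k L} (hχ : χ ∈ centroidAlg k L) :
    Q.rho e * χ - χ * Q.rho e ∈ centroidAlg k L := by
  intro a b
  simp only [LinearMap.sub_apply, Module.End.mul_apply, rho_lie_apply, map_add, hχ a b,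
    hχ (Q.rho e a) b, hχ a (Q.rho e b), sub_lie]
  abel

/-- Homogeneous elements of the centroid. -/
def ctdWt (γ : Module.Dual k H) : Submodule k (Module.End k L) where
  carrier := {χ | χ ∈ centroidAlg k L ∧ ∀ v : H, Q.rho v * χ - χ * Q.rho v = γ v • χ}
  add_mem' := by
    rintro χ ψ ⟨h1, h2⟩ ⟨h3, h4⟩
    refine ⟨add_mem h1 h3, fun v => ?_⟩
    rw [smul_add, ← h2, ← h4, mul_add, add_mul]
    abel
  zero_mem' := ⟨zero_mem _, by simp⟩
  smul_mem' := by
    rintro c χ ⟨h1, h2⟩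
    refine ⟨Subalgebra.smul_mem _ h1 c, fun v => ?_⟩
    rw [smul_comm, ← h2, smul_sub, mul_smul_comm, smul_mul_assoc]

lemma ctdWt_mul {γ δ : Module.Dual k H} {χ ψ : Module.End k L} (hχ : χ ∈ Q.ctdWt γ)
    (hψ : ψ ∈ Q.ctdWt δ) : χ * ψ ∈ Q.ctdWt (γ + δ) := by
  refine ⟨mul_mem hχ.1 hψ.1, fun v => ?_⟩
  have h1 := hχ.2 v
  have h2 := hψ.2 v
  rw [LinearMap.add_apply, add_smul, ← smul_mul_assoc, ← mul_smul_comm, ← h1, ← h2]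
  noncomm_ring

lemma one_mem_ctdWt : (1 : Module.End k L) ∈ Q.ctdWt 0 :=
  ⟨one_mem _, fun v => by simp⟩

lemma ctdWt_apply {γ α : Module.Dual k H} {χ : Module.End k L} (hχ : χ ∈ Q.ctdWt γ) {a : L}
    (ha : a ∈ Q.wt α) : χ a ∈ Q.wt (γ + α) := by
  intro v
  have h1 := LinearMap.congr_fun (hχ.2 v) a
  rw [LinearMap.sub_apply, Module.End.mul_apply, Module.End.mul_apply, ha v, map_smul,
    LinearMap.smul_apply] at h1
  rw [LinearMap.add_apply, add_smul, ← h1, sub_add_cancel]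

lemma centroid_eq_zero {α : Module.Dual k H} {e : L} (he : e ∈ Q.wt α) (hne : e ≠ 0)
    {χ : Module.End k L} (hχ : χ ∈ centroidAlg k L) (h0 : χ e = 0) : χ = 0 := by
  let I : Submodule k L :=
    { carrier := {a | ∀ χ ∈ centroidAlg k L, χ e = 0 → χ a = 0}
      add_mem' := fun ha hb χ h1 h2 => by rw [map_add, ha χ h1 h2, hb χ h1 h2, add_zero]
      zero_mem' := fun χ _ _ => map_zero χ
      smul_mem' := fun c a ha χ h1 h2 => by rw [map_smul, ha χ h1 h2, smul_zero] }
  have hI : I = ⊤ := by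
    refine Q.stable_ideal I ?_ ?_ ?_
    · intro v a ha χ h1 h2
      have h3 := ha _ (Q.rho_commutator_mem (v : E) h1) (by
        rw [LinearMap.sub_apply, Module.End.mul_apply, Module.End.mul_apply, h2, map_zero, he v,
          map_smul, h2, smul_zero, sub_zero])
      rw [LinearMap.sub_apply, Module.End.mul_apply, Module.End.mul_apply, ha χ h1 h2, map_zero,
        zero_sub, neg_eq_zero] at h3
      exact h3
    · intro a b hb χ h1 h2
      rw [centroidAlg_lie_right h1, hb χ h1 h2, lie_zero]
    · exact (Submodule.ne_bot_iff _).2 ⟨e, fun χ _ h2 => h2, hne⟩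
  ext a
  have : a ∈ I := hI ▸ Submodule.mem_top
  exact this χ hχ h0

lemma ctdWt_inv {γ : Module.Dual k H} {χ : Module.End k L} (hχ : χ ∈ Q.ctdWt γ) (hne : χ ≠ 0) :
    ∃ ψ ∈ Q.ctdWt (-γ), χ * ψ = 1 ∧ ψ * χ = 1 := by
  have hcomm : ∀ (v : H) a, Q.rho v (χ a) = χ (Q.rho v a) + γ v • χ a := by
    intro v a
    have h1 := LinearMap.congr_fun (hχ.2 v) a
    rw [LinearMap.sub_apply, Module.End.mul_apply, Module.End.mul_apply,
      LinearMap.smul_apply] at h1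
    rw [← h1]
    abel
  have hker : LinearMap.ker χ = ⊥ := by
    by_contra hk
    have := Q.stable_ideal _ (fun v a ha => ?_) (fun a b hb => ?_) hk
    · exact hne (LinearMap.ker_eq_top.1 this)
    · rw [LinearMap.mem_ker] at ha ⊢
      have h1 := hcomm v a
      rw [ha, map_zero, smul_zero, add_zero] at h1
      exact h1.symm
    · rw [LinearMap.mem_ker] at hb ⊢
      rw [centroidAlg_lie_right hχ.1, hb, lie_zero]
  have hrange : LinearMap.range χ = ⊤ := by
    refine Q.stable_ideal _ ?_ ?_ ?_
    · rintro v _ ⟨a, rfl⟩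
      exact ⟨Q.rho v a + γ v • a, by rw [hcomm, map_add, map_smul]⟩
    · rintro a _ ⟨b, rfl⟩
      exact ⟨⁅a, b⁆, centroidAlg_lie_right hχ.1 a b⟩
    · rwa [ne_eq, LinearMap.range_eq_bot]
  let e := LinearEquiv.ofBijective χ ⟨LinearMap.ker_eq_bot.1 hker, LinearMap.range_eq_top.1 hrange⟩
  have h1 : ∀ a, χ (e.symm a) = a := e.apply_symm_apply
  have h2 : ∀ a, e.symm (χ a) = a := e.symm_apply_apply
  have h3 : χ * (e.symm : L →ₗ[k] L) = 1 := LinearMap.ext h1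
  have h4 : (e.symm : L →ₗ[k] L) * χ = 1 := LinearMap.ext h2
  have h5 := LinearMap.ker_eq_bot.1 hker
  refine ⟨(e.symm : L →ₗ[k] L), ⟨?_, fun v => ?_⟩, h3, h4⟩
  · intro a b
    apply h5
    change χ (e.symm _) = χ ⁅e.symm a, b⁆
    rw [h1, hχ.1, h1]
  · have h6 := hχ.2 v
    set ψ : Module.End k L := (e.symm : L →ₗ[k] L)
    calc Q.rho v * ψ - ψ * Q.rho v = (ψ * χ) * Q.rho v * ψ - ψ * Q.rho v * (χ * ψ) := by
          rw [h3, h4, one_mul, mul_one]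
      _ = - (ψ * (Q.rho v * χ - χ * Q.rho v) * ψ) := by noncomm_ring
      _ = _ := by
        rw [h6, mul_smul_comm, h4, smul_mul_assoc, one_mul, LinearMap.neg_apply, neg_smul]

lemma ctdWt_zero {χ : Module.End k L} (hχ : χ ∈ Q.ctdWt 0) : ∃ c : k, χ = c • 1 := by
  obtain ⟨α, hα⟩ := Q.isEALA.aniso_nonempty
  obtain ⟨h, e, f, t, he, -, h1, -⟩ := Q.exists_sl2 hα
  obtain ⟨c, hc⟩ := h1 (χ e) (by simpa using Q.ctdWt_apply hχ he)
  refine ⟨c, sub_eq_zero.1 (Q.centroid_eq_zero he t.e_ne_zero ?_ ?_)⟩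
  · exact sub_mem hχ.1 (Subalgebra.smul_mem _ (one_mem _) c)
  · rw [LinearMap.sub_apply, hc]
    simp

lemma ctdWt_isotropic {γ : Module.Dual k H} {χ : Module.End k L} (hχ : χ ∈ Q.ctdWt γ)
    (hne : χ ≠ 0) : γ ∈ isoRootSet B H := by
  have hE := Q.isEALA
  obtain ⟨α, hα⟩ := hE.aniso_nonempty
  obtain ⟨ψ, hψ, hχψ, hψχ⟩ := Q.ctdWt_inv hχ hne
  have hroot : wtSpace H γ ≠ ⊥ := by
    obtain ⟨h, e, f, t, he, hh, h1, -⟩ := Q.exists_sl2 hα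
    refine Q.wtSpace_ne_bot (a := χ h) (by simpa using Q.ctdWt_apply hχ hh) fun h0 => t.h_ne_zero ?_
    have := LinearMap.congr_fun hψχ h
    rw [Module.End.mul_apply, h0, map_zero] at this
    exact this.symm
  rcases hE.aniso_or_iso hroot with hγ | hγ
  · exfalso
    obtain ⟨h, e, f, t, he, hh, -, h1, h2⟩ := Q.exists_sl2 hγ
    have h0 := (hE.mem_aniso.1 hγ).2
    have hψ3 := Q.ctdWt_mul (Q.ctdWt_mul hψ hψ) hψ
    have hw := Q.ctdWt_apply hψ3 he
    have hwne : (ψ * ψ * ψ) e ≠ 0 := by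
      intro hw0
      apply t.e_ne_zero
      have h3 : (χ * χ * χ) * (ψ * ψ * ψ) = 1 := by
        calc (χ * χ * χ) * (ψ * ψ * ψ) = χ * (χ * (χ * ψ) * ψ) * ψ := by noncomm_ring
          _ = 1 := by rw [hχψ, mul_one, hχψ, mul_one, hχψ]
      have h4 := LinearMap.congr_fun h3 e
      rw [Module.End.mul_apply, hw0, map_zero] at h4
      exact h4.symm
    obtain ⟨n, hn⟩ := t.exists_nat_of_nilpotent (μ := (-4 : k)) hwne (by
      rw [h1 _ _ hw]
      congr 1
      simp only [LinearMap.add_apply, LinearMap.neg_apply]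
      field_simp
      ring) (by
      rw [← centroidAlg_lie_right hψ3.1, lie_self, map_zero]) (h2 _)
    have : ((n + 4 : ℕ) : k) = 0 := by push_cast; rw [← hn]; ring
    norm_cast at this
  · exact hγ

/-- Every centroid element is a sum of homogeneous ones. -/
lemma centroid_induction (N : Submodule k (Module.End k L))
    (hN : ∀ γ, ∀ χ ∈ Q.ctdWt γ, χ ∈ N) {χ : Module.End k L} (hχ : χ ∈ centroidAlg k L) :
    χ ∈ N := by
  obtain ⟨α, hα⟩ := Q.isEALA.aniso_nonempty
  obtain ⟨h, e, f, t, he, -⟩ := Q.exists_sl2 hα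
  let C := Subalgebra.toSubmodule (centroidAlg k L)
  let τ' : H → Module.End k C := fun v =>
    ((LinearMap.mulLeft k (Q.rho v) - LinearMap.mulRight k (Q.rho v)).restrict
      (p := C) (q := C) fun χ hχ => Q.rho_commutator_mem (v : E) hχ)
  have htop : ⨆ γ, simWt τ' γ = ⊤ :=
    simWt_iSup_eq_top_of_injective Q.iSup_wt (LinearMap.applyₗ e ∘ₗ C.subtype)
      (by
        rw [injective_iff_map_eq_zero]
        intro χ h0
        exact Subtype.ext (Q.centroid_eq_zero he t.e_ne_zero χ.2 h0)) α
      (by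
        intro v χ
        change (Q.rho v * χ.1 - χ.1 * Q.rho v) e = Q.rho v (χ.1 e) - α v • χ.1 e
        rw [LinearMap.sub_apply, Module.End.mul_apply, Module.End.mul_apply, he v, map_smul])
  obtain ⟨s, m, hm, hs⟩ := simWt_exists_decomp htop ⟨χ, hχ⟩
  have : χ = ∑ γ ∈ s, (m γ : Module.End k L) := by
    have := congrArg C.subtype hs
    rwa [map_sum] at this
  rw [this]
  refine Submodule.sum_mem _ fun γ _ => hN γ _ ⟨(m γ).2, fun v => ?_⟩
  exact congrArg Subtype.val (hm γ v)

/-- The group of degrees of the centroid. -/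
def ctdDeg : AddSubgroup (Module.Dual k H) where
  carrier := {γ | Q.ctdWt γ ≠ ⊥}
  add_mem' := by
    intro γ δ hγ hδ
    obtain ⟨χ, hχ, hχ0⟩ := (Submodule.ne_bot_iff _).1 hγ
    obtain ⟨ψ, hψ, hψ0⟩ := (Submodule.ne_bot_iff _).1 hδ
    refine (Submodule.ne_bot_iff _).2 ⟨_, Q.ctdWt_mul hχ hψ, fun h0 => hψ0 ?_⟩
    obtain ⟨χ', -, -, h1⟩ := Q.ctdWt_inv hχ hχ0
    rw [← one_mul ψ, ← h1, mul_assoc, h0, mul_zero]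
  zero_mem' := by
    obtain ⟨α, hα⟩ := Q.isEALA.aniso_nonempty
    obtain ⟨h, e, f, t, he, -⟩ := Q.exists_sl2 hα
    exact (Submodule.ne_bot_iff _).2 ⟨1, Q.one_mem_ctdWt, fun h0 =>
      t.e_ne_zero (LinearMap.congr_fun h0 e)⟩
  neg_mem' := by
    intro γ hγ
    obtain ⟨χ, hχ, hχ0⟩ := (Submodule.ne_bot_iff _).1 hγ
    obtain ⟨ψ, hψ, h1, -⟩ := Q.ctdWt_inv hχ hχ0
    refine (Submodule.ne_bot_iff _).2 ⟨ψ, hψ, fun h0 => hχ0 ?_⟩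
    rw [← one_mul χ, ← h1, h0, mul_zero, zero_mul]

lemma exists_ctdDeg_equiv : ∃ m : ℕ, Nonempty ((Fin m → ℤ) ≃+ Q.ctdDeg) := by
  obtain ⟨n, ⟨φ⟩⟩ := Q.isEALA.ea5
  have hle : Q.ctdDeg ≤ AddSubgroup.closure (isoRootSet B H) := by
    intro γ hγ
    obtain ⟨χ, hχ, hχ0⟩ := (Submodule.ne_bot_iff _).1 hγ
    exact AddSubgroup.subset_closure (Q.ctdWt_isotropic hχ hχ0)
  let j : Q.ctdDeg →ₗ[ℤ] (Fin n → ℤ) :=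
    (φ.toAddMonoidHom.comp (AddSubgroup.inclusion hle)).toIntLinearMap
  have hj : Function.Injective j := φ.injective.comp (AddSubgroup.inclusion_injective hle)
  obtain ⟨m, ⟨b⟩⟩ := Submodule.nonempty_basis_of_pid (Pi.basisFun ℤ (Fin n)) (LinearMap.range j)
  exact ⟨m, ⟨((b.equivFun.symm).trans (LinearEquiv.ofInjective j hj).symm).toAddEquiv⟩⟩

/-- The centroid is a ring of Laurent polynomials. -/
lemma exists_laurent : ∃ (m : ℕ) (deg : (Fin m → ℤ) →+ Module.Dual k H)
    (Φ : AddMonoidAlgebra k (Fin m → ℤ) →ₐ[k] Module.End k L),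
    Function.Injective deg ∧ Function.Injective Φ ∧ (∀ r, Φ r ∈ centroidAlg k L) ∧
    (∀ χ ∈ centroidAlg k L, ∃ r, Φ r = χ) ∧
    ∀ n, Φ (AddMonoidAlgebra.single n 1) ∈ Q.ctdWt (deg n) := by
  obtain ⟨m, ⟨φ⟩⟩ := Q.exists_ctdDeg_equiv
  let deg : (Fin m → ℤ) →+ Module.Dual k H := Q.ctdDeg.subtype.comp φ.toAddMonoidHom
  have hdeg : Function.Injective deg := Subtype.val_injective.comp φ.injective
  have hmem : ∀ n, deg n ∈ Q.ctdDeg := fun n => (φ n).2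
  let _ : CommRing (centroidAlg k L) :=
    { (inferInstance : Ring (centroidAlg k L)) with
      mul_comm := fun χ ψ => Subtype.ext (Q.centroid_comm χ.2 ψ.2) }
  have hunit : ∀ γ ∈ Q.ctdDeg, ∃ u : (centroidAlg k L)ˣ,
      (u : centroidAlg k L).1 ∈ Q.ctdWt γ ∧ (↑u⁻¹ : centroidAlg k L).1 ∈ Q.ctdWt (-γ) := by
    intro γ hγ
    obtain ⟨χ, hχ, hχ0⟩ := (Submodule.ne_bot_iff _).1 hγ
    obtain ⟨ψ, hψ, h1, h2⟩ := Q.ctdWt_inv hχ hχ0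
    exact ⟨⟨⟨χ, hχ.1⟩, ⟨ψ, hψ.1⟩, Subtype.ext h1, Subtype.ext h2⟩, hχ, hψ⟩
  choose! c hc hc' using fun i : Fin m => hunit (deg (Pi.single i 1)) (hmem _)
  let U : (Fin m → ℤ) →ₗ[ℤ] Additive (centroidAlg k L)ˣ :=
    (Pi.basisFun ℤ (Fin m)).constr ℤ fun i => Additive.ofMul (c i)
  have hU : ∀ n, (((U n).toMul : (centroidAlg k L)ˣ) : centroidAlg k L).1 ∈ Q.ctdWt (deg n) := by
    let S : AddSubgroup (Fin m → ℤ) :=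
      { carrier := {n | (((U n).toMul : (centroidAlg k L)ˣ) : centroidAlg k L).1 ∈ Q.ctdWt (deg n)
          ∧ ((((U n).toMul)⁻¹ : (centroidAlg k L)ˣ) : centroidAlg k L).1 ∈ Q.ctdWt (-deg n)}
        add_mem' := by
          rintro a b ⟨h1, h2⟩ ⟨h3, h4⟩
          refine ⟨?_, ?_⟩
          · rw [map_add, map_add, toMul_add]
            exact Q.ctdWt_mul h1 h3
          · rw [map_add, map_add, toMul_add, mul_inv, neg_add]
            exact Q.ctdWt_mul h2 h4
        zero_mem' := by
          refine ⟨?_, ?_⟩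
          · rw [map_zero, map_zero]
            exact Q.one_mem_ctdWt
          · rw [map_zero, map_zero, neg_zero, toMul_zero, inv_one]
            exact Q.one_mem_ctdWt
        neg_mem' := by
          rintro a ⟨h1, h2⟩
          refine ⟨?_, ?_⟩
          · rw [map_neg, map_neg, toMul_neg]
            exact h2
          · rw [map_neg, map_neg, toMul_neg, inv_inv, neg_neg]
            exact h1 }
    intro n
    have hS : ∀ i, Pi.single i 1 ∈ S := by
      intro i
      have : U (Pi.single i 1) = Additive.ofMul (c i) := by
        have := (Pi.basisFun ℤ (Fin m)).constr_basis ℤ (fun i => Additive.ofMul (c i)) i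
        rwa [Pi.basisFun_apply] at this
      refine ⟨?_, ?_⟩
      · rw [this]; exact hc i
      · rw [this]; exact hc' i
    have : n ∈ S := by
      rw [← (Pi.basisFun ℤ (Fin m)).sum_repr n]
      refine S.sum_mem fun i _ => ?_
      rw [Pi.basisFun_apply]
      exact S.zsmul_mem (hS i) _
    exact this.1
  let F : Multiplicative (Fin m → ℤ) →* centroidAlg k L :=
    (Units.coeHom _).comp (AddMonoidHom.toMultiplicativeLeft U.toAddMonoidHom)
  let Φ : AddMonoidAlgebra k (Fin m → ℤ) →ₐ[k] Module.End k L :=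
    (centroidAlg k L).val.comp (AddMonoidAlgebra.lift k (centroidAlg k L) (Fin m → ℤ) F)
  have hΦ : ∀ n d, Φ (AddMonoidAlgebra.single n d)
      = d • (((U n).toMul : (centroidAlg k L)ˣ) : centroidAlg k L).1 := by
    intro n d
    change ((AddMonoidAlgebra.lift k (centroidAlg k L) (Fin m → ℤ) F) _ : centroidAlg k L).1 = _
    rw [AddMonoidAlgebra.lift_single]
    rfl
  obtain ⟨α, hα⟩ := Q.isEALA.aniso_nonempty
  obtain ⟨h, e, f, t, he, -⟩ := Q.exists_sl2 hα
  refine ⟨m, deg, Φ, hdeg, ?_, fun r => Subtype.prop _, ?_, fun n => ?_⟩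
  · rw [injective_iff_map_eq_zero]
    intro r hr
    ext n
    by_contra hn
    have hsum : r = ∑ n ∈ r.coeff.support, AddMonoidAlgebra.single n (r.coeff n) :=
      (AddMonoidAlgebra.sum_coeff_single r).symm
    rw [hsum, map_sum] at hr
    have h1 := LinearMap.congr_fun hr e
    rw [LinearMap.sum_apply, LinearMap.zero_apply] at h1
    classical
    have h2 := simWt_sum_eq_zero (τ := fun v : H => Q.rho v)
      (r.coeff.support.image fun n => deg n + α)
      (fun β => ∑ n ∈ r.coeff.support with deg n + α = β,
        Φ (AddMonoidAlgebra.single n (r.coeff n)) e) (by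
        intro β _
        refine Submodule.sum_mem _ fun n hn => ?_
        rw [← (Finset.mem_filter.1 hn).2, hΦ]
        exact Submodule.smul_mem _ _ (Q.ctdWt_apply (hU n) he)) (by
        rw [Finset.sum_image' (fun n => Φ (AddMonoidAlgebra.single n (r.coeff n)) e)]
        · exact h1
        · intro n _
          rfl) (deg n + α) (Finset.mem_image_of_mem _ (by simpa using hn))
    have h3 : (r.coeff.support.filter fun n' => deg n' + α = deg n + α) = {n} := by
      ext n'
      simp only [Finset.mem_filter, add_left_inj, hdeg.eq_iff, Finset.mem_singleton]
      constructor
      · exact fun h => h.2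
      · rintro rfl
        exact ⟨by simpa using hn, rfl⟩
    rw [h3, Finset.sum_singleton, hΦ, LinearMap.smul_apply, smul_eq_zero] at h2
    rcases h2 with h2 | h2
    · exact hn h2
    · have h4 := congrArg Subtype.val (Units.inv_mul (U n).toMul)
      have h5 := LinearMap.congr_fun h4 e
      apply t.e_ne_zero
      refine h5.symm.trans ?_
      exact (congrArg (((U n).toMul)⁻¹ : (centroidAlg k L)ˣ).1.1 h2).trans (map_zero _)
  · intro χ hχ
    refine Q.centroid_induction (LinearMap.range Φ.toLinearMap) (fun γ χ hχ => ?_) hχ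
    by_cases hχ0 : χ = 0
    · rw [hχ0]; exact Submodule.zero_mem _
    have hγ : γ ∈ Q.ctdDeg := (Submodule.ne_bot_iff _).2 ⟨χ, hχ, hχ0⟩
    obtain ⟨n, hn⟩ := φ.surjective ⟨γ, hγ⟩
    have hn' : deg n = γ := congrArg Subtype.val hn
    have h1 := hU (-n)
    rw [map_neg, map_neg, hn', toMul_neg] at h1
    have h2 := Q.ctdWt_mul h1 hχ
    rw [neg_add_cancel] at h2
    obtain ⟨d, hd⟩ := Q.ctdWt_zero h2
    refine ⟨AddMonoidAlgebra.single n d, ?_⟩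
    change Φ _ = χ
    rw [hΦ]
    have h4 : ((((U n).toMul : (centroidAlg k L)ˣ) : centroidAlg k L).1) *
        ((((U n).toMul)⁻¹ : (centroidAlg k L)ˣ) : centroidAlg k L).1 = 1 :=
      congrArg Subtype.val (Units.mul_inv (U n).toMul)
    rw [← mul_one (((U n).toMul : (centroidAlg k L)ˣ) : centroidAlg k L).1, ← mul_smul_comm, ← hd,
      ← mul_assoc, h4, one_mul]
  · rw [hΦ, one_smul]
    exact hU n

end CoreQuot

end Centroid

section CentroidalStructure

variable {k E L : Type*} [Field k] [CharZero k] [LieRing E] [LieAlgebra k E]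
  [LieRing L] [LieAlgebra k L]

/-- Laurent polynomials in `m` variables. -/
abbrev Laurent (k : Type*) [Field k] (m : ℕ) := AddMonoidAlgebra k (Fin m → ℤ)

lemma Laurent.induction_single {m : ℕ} {p : Laurent k m → Prop} (r : Laurent k m)
    (h0 : p 0) (hadd : ∀ r s, p r → p s → p (r + s))
    (hs : ∀ n (c : k), p (AddMonoidAlgebra.single n c)) : p r := by
  rw [← AddMonoidAlgebra.sum_coeff_single r]
  exact Finset.sum_induction _ p hadd h0 fun n _ => hs n _

lemma Laurent.single_eq_smul {m : ℕ} (n : Fin m → ℤ) (c : k) :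
    (AddMonoidAlgebra.single n c : Laurent k m) = c • AddMonoidAlgebra.single n 1 := by
  rw [AddMonoidAlgebra.smul_single, smul_eq_mul, mul_one]

variable {B : E →ₗ[k] E →ₗ[k] k} {H : LieSubalgebra k E}

namespace CoreQuot

variable (Q : CoreQuot B H L)

/-- The action of Laurent polynomials on `L` identifies them with the centroid. -/
structure Centroidal (Q : CoreQuot B H L) (m : ℕ) [LieAlgebra (Laurent k m) L] where
  deg : (Fin m → ℤ) →+ Module.Dual k H
  deg_injective : Function.Injective deg
  exists_smul : ∀ χ ∈ centroidAlg k L, ∃ r : Laurent k m, ∀ a : L, χ a = r • a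
  faithful : ∀ r : Laurent k m, (∀ a : L, r • a = 0) → r = 0
  smul_mem_wt : ∀ (n : Fin m → ℤ) (α : Module.Dual k H) (a : L), a ∈ Q.wt α →
    (AddMonoidAlgebra.single n 1 : Laurent k m) • a ∈ Q.wt (α + deg n)

namespace Centroidal

variable {Q} {m : ℕ} [LieAlgebra (Laurent k m) L] [IsScalarTower k (Laurent k m) L]
  (C : Q.Centroidal m)

include C

lemma eq_of_smul {r s : Laurent k m} (h : ∀ a : L, r • a = s • a) : r = s :=
  sub_eq_zero.1 (C.faithful _ fun a => by rw [sub_smul, h, sub_self])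

lemma exists_der (e : E) (r : Laurent k m) :
    ∃ s : Laurent k m, ∀ a : L, Q.rho e (r • a) - r • Q.rho e a = s • a := by
  have hr : Algebra.lsmul k k L r ∈ centroidAlg k L := fun a b => (smul_lie r a b).symm
  obtain ⟨s, hs⟩ := C.exists_smul _ (Q.rho_commutator_mem e hr)
  exact ⟨s, fun a => hs a⟩

/-- The underlying function of `der`. -/
noncomputable def derFun (e : E) (r : Laurent k m) : Laurent k m := (C.exists_der e r).choose

lemma derFun_smul (e : E) (r : Laurent k m) (a : L) :
    C.derFun e r • a = Q.rho e (r • a) - r • Q.rho e a := ((C.exists_der e r).choose_spec a).symm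

/-- The derivation of the centroid induced by an element of the extended affine Lie algebra. -/
noncomputable def der : E →ₗ[k] Derivation k (Laurent k m) (Laurent k m) where
  toFun e := Derivation.mk'
    { toFun := C.derFun e
      map_add' := fun r s => C.eq_of_smul fun a => by
        simp only [add_smul, derFun_smul, map_add]
        abel
      map_smul' := fun c r => C.eq_of_smul fun a => by
        simp only [RingHom.id_apply, smul_assoc, derFun_smul, map_smul, smul_sub] }
    fun r s => C.eq_of_smul fun a => by
      change C.derFun e (r * s) • a = (r • C.derFun e s + s • C.derFun e r) • a
      simp only [add_smul, smul_eq_mul, mul_comm s, mul_smul, derFun_smul, smul_sub]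
      abel
  map_add' e e' := Derivation.ext fun r => C.eq_of_smul fun a => by
    change C.derFun (e + e') r • a = (C.derFun e r + C.derFun e' r) • a
    simp only [add_smul, derFun_smul, map_add, LinearMap.add_apply, smul_add]
    abel
  map_smul' c e := Derivation.ext fun r => C.eq_of_smul fun a => by
    change C.derFun (c • e) r • a = (c • C.derFun e r) • a
    rw [smul_assoc, derFun_smul, derFun_smul, LinearMap.map_smul, LinearMap.smul_apply,
      LinearMap.smul_apply, smul_sub, smul_comm c r]

lemma rho_smul (e : E) (r : Laurent k m) (a : L) :
    Q.rho e (r • a) = C.der e r • a + r • Q.rho e a := by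
  have h : C.der e r • a = Q.rho e (r • a) - r • Q.rho e a := C.derFun_smul e r a
  rw [h, sub_add_cancel]

lemma der_lie (e e' : E) (r : Laurent k m) :
    C.der ⁅e, e'⁆ r = C.der e (C.der e' r) - C.der e' (C.der e r) := by
  refine C.eq_of_smul fun a => ?_
  have h := C.rho_smul ⁅e, e'⁆ r a
  simp only [Q.rho_lie, LinearMap.sub_apply, Module.End.mul_apply, C.rho_smul, map_add,
    smul_sub] at h
  rw [sub_smul]
  rw [← sub_eq_zero] at h ⊢
  rw [← neg_eq_zero, ← h]
  abel

lemma der_core {x : E} (hx : x ∈ core B H) : C.der x = 0 := by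
  refine Derivation.ext fun r => C.eq_of_smul fun a => ?_
  have h := C.rho_smul x r a
  rw [Q.rho_core ⟨x, hx⟩, Q.rho_core ⟨x, hx⟩, lie_smul, right_eq_add] at h
  rw [h, Derivation.zero_apply, zero_smul]

lemma der_H_single (v : H) (n : Fin m → ℤ) (c : k) :
    C.der v (AddMonoidAlgebra.single n c) = C.deg n v • AddMonoidAlgebra.single n c := by
  rw [Laurent.single_eq_smul, Derivation.map_smul, smul_comm]
  congr 1
  refine C.eq_of_smul fun a => ?_
  have := simWt_ext Q.iSup_wt
    (f := Algebra.lsmul k k L (C.der v (AddMonoidAlgebra.single n 1)))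
    (g := Algebra.lsmul k k L (C.deg n v • AddMonoidAlgebra.single n 1 : Laurent k m))
    fun α x hx => by
      change C.der v _ • x = (C.deg n v • _ : Laurent k m) • x
      have h := C.rho_smul (v : E) (AddMonoidAlgebra.single n 1) x
      rw [C.smul_mem_wt n α x hx v, hx v, LinearMap.add_apply, add_smul, smul_comm (α v),
        add_comm] at h
      rw [smul_assoc]
      exact (add_right_cancel h).symm
  exact LinearMap.congr_fun this a

lemma coeff_der_H (v : H) (r : Laurent k m) (n : Fin m → ℤ) :
    (C.der v r).coeff n = C.deg n v * r.coeff n := by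
  induction r using Laurent.induction_single with
  | h0 => simp
  | hadd r s hr hs => simp [hr, hs, mul_add]
  | hs n' c =>
    rw [C.der_H_single]
    by_cases h : n' = n
    · subst h; simp
    · simp [h]

/-- A weight vector in the ring of Laurent polynomials is a monomial. -/
lemma eq_single_of_der_H {γ : Module.Dual k H} {r : Laurent k m}
    (hr : ∀ v : H, C.der v r = γ v • r) {n : Fin m → ℤ} (hn : r.coeff n ≠ 0) :
    C.deg n = γ ∧ r = AddMonoidAlgebra.single n (r.coeff n) := by
  have h1 : ∀ n', r.coeff n' ≠ 0 → C.deg n' = γ := fun n' hn' => LinearMap.ext fun v => by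
    have h := congrArg (fun s : Laurent k m => s.coeff n') (hr v)
    simp only [C.coeff_der_H, AddMonoidAlgebra.coeff_smul, Finsupp.smul_apply, smul_eq_mul] at h
    exact mul_right_cancel₀ hn' h
  refine ⟨h1 n hn, ?_⟩
  ext n'
  by_cases h : n = n'
  · subst h; simp
  · have : r.coeff n' = 0 := by
      by_contra h2
      exact h (C.deg_injective ((h1 n hn).trans (h1 n' h2).symm))
    simp [h, this]

lemma der_H_der {α : Module.Dual k H} {e : E} (he : e ∈ wtSpace H α) {n : Fin m → ℤ} {c : k}
    (v : H) : C.der v (C.der e (AddMonoidAlgebra.single n c)) =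
      (α + C.deg n) v • C.der e (AddMonoidAlgebra.single n c) := by
  have h := C.der_lie (v : E) e (AddMonoidAlgebra.single n c)
  rw [he v, LinearMap.map_smul, C.der_H_single, Derivation.map_smul, Derivation.smul_apply] at h
  rw [LinearMap.add_apply, add_smul, h, sub_add_cancel]

end Centroidal

end CoreQuot

end CentroidalStructure

section HomogeneousBasis

variable {k E L : Type*} [Field k] [CharZero k] [LieRing E] [LieAlgebra k E]
  [LieRing L] [LieAlgebra k L] {B : E →ₗ[k] E →ₗ[k] k} {H : LieSubalgebra k E}

namespace CoreQuot.Centroidal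

variable {Q : CoreQuot B H L} {m : ℕ} [LieAlgebra (Laurent k m) L]
  [IsScalarTower k (Laurent k m) L] (C : Q.Centroidal m)

include C

lemma smul_single_mem_wt (n : Fin m → ℤ) (c : k) {α : Module.Dual k H} {a : L}
    (ha : a ∈ Q.wt α) : (AddMonoidAlgebra.single n c : Laurent k m) • a ∈ Q.wt (α + C.deg n) := by
  rw [Laurent.single_eq_smul, smul_assoc]
  exact Submodule.smul_mem _ _ (C.smul_mem_wt n α a ha)

lemma proj_smul {α ν : Module.Dual k H} {P : L →ₗ[k] L} (h1 : ∀ x ∈ Q.wt ν, P x = x)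
    (h2 : ∀ β, β ≠ ν → ∀ x ∈ Q.wt β, P x = 0) {x : L} (hx : x ∈ Q.wt α) {n : Fin m → ℤ}
    (hn : α + C.deg n = ν) (r : Laurent k m) :
    P (r • x) = (AddMonoidAlgebra.single n (r.coeff n) : Laurent k m) • x := by
  induction r using Laurent.induction_single with
  | h0 => simp
  | hadd r s hr hs => simp [add_smul, hr, hs, AddMonoidAlgebra.single_add]
  | hs n' c =>
    by_cases h : n' = n
    · subst h
      rw [h1 _ (hn ▸ C.smul_single_mem_wt n' c hx)]
      simp
    · rw [h2 (α + C.deg n') (fun h' => h (C.deg_injective (add_left_cancel (h'.trans hn.symm)))) _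
        (C.smul_single_mem_wt n' c hx)]
      simp [h]

lemma proj_smul_eq_zero {α ν : Module.Dual k H} {P : L →ₗ[k] L}
    (h2 : ∀ β, β ≠ ν → ∀ x ∈ Q.wt β, P x = 0) {x : L} (hx : x ∈ Q.wt α)
    (hn : ∀ n, α + C.deg n ≠ ν) (r : Laurent k m) : P (r • x) = 0 := by
  induction r using Laurent.induction_single with
  | h0 => simp
  | hadd r s hr hs => simp [add_smul, hr, hs]
  | hs n' c => exact h2 _ (hn n') _ (C.smul_single_mem_wt n' c hx)

lemma proj_smul_exists {α ν : Module.Dual k H} {P : L →ₗ[k] L} (h1 : ∀ x ∈ Q.wt ν, P x = x)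
    (h2 : ∀ β, β ≠ ν → ∀ x ∈ Q.wt β, P x = 0) {x : L} (hx : x ∈ Q.wt α) (r : Laurent k m) :
    ∃ q : Laurent k m, P (r • x) = q • x ∧
      ∀ n, α + C.deg n = ν → q = AddMonoidAlgebra.single n (r.coeff n) := by
  by_cases h : ∃ n, α + C.deg n = ν
  · obtain ⟨n, hn⟩ := h
    refine ⟨_, C.proj_smul h1 h2 hx hn r, fun n' hn' => ?_⟩
    rw [C.deg_injective (add_left_cancel (hn.trans hn'.symm))]
  · push Not at h
    exact ⟨0, by rw [C.proj_smul_eq_zero h2 hx h, zero_smul], fun n hn => absurd hn (h n)⟩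

lemma exists_homogeneous_generators [Module.Finite (Laurent k m) L] :
    ∃ s : Finset L, (∀ x ∈ s, ∃ α, x ∈ Q.wt α) ∧
      Submodule.span (Laurent k m) (s : Set L) = ⊤ := by
  classical
  obtain ⟨s, hs⟩ := Module.Finite.fg_top (R := Laurent k m) (M := L)
  have h : ∀ x : L, ∃ t : Finset L, (∀ y ∈ t, ∃ α, y ∈ Q.wt α) ∧
      x ∈ Submodule.span (Laurent k m) (t : Set L) := by
    intro x
    obtain ⟨t, f, hf, hx⟩ := simWt_exists_decomp Q.iSup_wt x
    refine ⟨t.image f, fun y hy => ?_, ?_⟩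
    · obtain ⟨α, -, rfl⟩ := Finset.mem_image.1 hy
      exact ⟨α, hf α⟩
    · rw [hx]
      exact Submodule.sum_mem _ fun α hα =>
        Submodule.subset_span (Finset.mem_coe.2 (Finset.mem_image_of_mem _ hα))
  choose t ht ht' using h
  refine ⟨s.biUnion t, fun y hy => ?_, ?_⟩
  · obtain ⟨x, -, hy⟩ := Finset.mem_biUnion.1 hy
    exact ht x y hy
  · rw [eq_top_iff, ← hs, Submodule.span_le]
    intro x hx
    refine Submodule.span_mono ?_ (ht' x)
    intro y hy
    exact Finset.mem_coe.2 (Finset.mem_biUnion.2 ⟨x, hx, hy⟩)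

lemma exists_linearIndependent_generators (s : Finset L) (hs : ∀ x ∈ s, ∃ α, x ∈ Q.wt α)
    (hspan : Submodule.span (Laurent k m) (s : Set L) = ⊤) :
    ∃ t : Finset L, (∀ x ∈ t, ∃ α, x ∈ Q.wt α) ∧
      Submodule.span (Laurent k m) (t : Set L) = ⊤ ∧
      LinearIndependent (Laurent k m) (fun x : t => (x : L)) := by
  classical
  induction hn : s.card using Nat.strong_induction_on generalizing s with
  | _ N ih =>
  by_cases hli : LinearIndependent (Laurent k m) (fun x : s => (x : L))
  · exact ⟨s, hs, hspan, hli⟩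
  rw [Fintype.not_linearIndependent_iff] at hli
  obtain ⟨g, hg, j, hj⟩ := hli
  obtain ⟨n, hn'⟩ : ∃ n, (g j).coeff n ≠ 0 := by
    by_contra! hcon
    exact hj (by ext n; simpa using hcon n)
  choose! wtf hwtf using hs
  obtain ⟨P, h1, h2⟩ := simWt_exists_proj Q.iSup_wt (wtf j + C.deg n)
  choose q hq hq' using fun i : s => C.proj_smul_exists h1 h2 (hwtf i i.2) (g i)
  have hsum : ∑ i : s, q i • (i : L) = 0 := by
    rw [← map_zero P, ← hg, map_sum]
    exact Finset.sum_congr rfl fun i _ => (hq i).symm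
  rw [← Finset.add_sum_erase _ _ (Finset.mem_univ j), hq' j n rfl] at hsum
  have hjmem : (j : L) ∈ Submodule.span (Laurent k m) ((s.erase (j : L) : Finset L) : Set L) := by
    have h3 : (j : L) = (AddMonoidAlgebra.single (-n) ((g j).coeff n)⁻¹ : Laurent k m) •
        -∑ i ∈ Finset.univ.erase j, q i • (i : L) := by
      rw [← eq_neg_of_add_eq_zero_left hsum, smul_smul, AddMonoidAlgebra.single_mul_single,
        inv_mul_cancel₀ hn', neg_add_cancel, ← AddMonoidAlgebra.one_def, one_smul]
    refine (congrArg (· ∈ Submodule.span (Laurent k m) ((s.erase (j : L) : Finset L) : Set L))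
      h3).mpr ?_
    refine Submodule.smul_mem _ _ (Submodule.neg_mem _ (Submodule.sum_mem _ fun i hi =>
      Submodule.smul_mem _ _ (Submodule.subset_span ?_)))
    exact Finset.mem_coe.2 (Finset.mem_erase.2
      ⟨fun h => (Finset.mem_erase.1 hi).1 (Subtype.ext h), i.2⟩)
  refine ih (s.erase j).card ?_ (s.erase j) (fun x hx => ⟨_, hwtf x (Finset.mem_erase.1 hx).2⟩) ?_
    rfl
  · rw [← hn]
    exact Finset.card_erase_lt_of_mem j.2
  · rw [eq_top_iff, ← hspan, Submodule.span_le]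
    intro x hx
    by_cases hxj : x = j
    · rw [hxj]; exact hjmem
    · exact Submodule.subset_span (Finset.mem_coe.2 (Finset.mem_erase.2 ⟨hxj, hx⟩))

/-- The centreless core has a homogeneous basis over its centroid. -/
lemma exists_basis [Module.Finite (Laurent k m) L] :
    ∃ (N : ℕ) (b : Module.Basis (Fin N) (Laurent k m) L) (wtb : Fin N → Module.Dual k H),
      ∀ i, b i ∈ Q.wt (wtb i) := by
  obtain ⟨s, hs, hspan⟩ := C.exists_homogeneous_generators
  obtain ⟨t, ht, htspan, hli⟩ := C.exists_linearIndependent_generators s hs hspan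
  let b : Module.Basis t (Laurent k m) L := Module.Basis.mk hli (by
    rw [← htspan, Subtype.range_coe_subtype]
    exact le_of_eq (by simp))
  choose! f hf using ht
  refine ⟨t.card, b.reindex t.equivFin, fun i => f (t.equivFin.symm i), fun i => ?_⟩
  rw [Module.Basis.reindex_apply, Module.Basis.mk_apply]
  exact hf _ (t.equivFin.symm i).2

end CoreQuot.Centroidal

end HomogeneousBasis

section KillingForm

variable {k E L : Type*} [Field k] [CharZero k] [LieRing E] [LieAlgebra k E]
  [LieRing L] [LieAlgebra k L] {B : E →ₗ[k] E →ₗ[k] k} {H : LieSubalgebra k E}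

namespace CoreQuot.Centroidal

variable {Q : CoreQuot B H L} {m : ℕ} [LieAlgebra (Laurent k m) L]
  [IsScalarTower k (Laurent k m) L] (C : Q.Centroidal m)
  {ι : Type*} [Fintype ι] [DecidableEq ι] (b : Module.Basis ι (Laurent k m) L)

/-- The commutator of `rho e` with a centroid-linear map. -/
noncomputable def comm (e : E) : Module.End (Laurent k m) L →ₗ[k] Module.End (Laurent k m) L where
  toFun A :=
    { toFun := fun a => Q.rho e (A a) - A (Q.rho e a)
      map_add' := fun x y => by simp only [map_add]; abel
      map_smul' := fun r x => by
        simp only [map_smul, C.rho_smul, map_add, RingHom.id_apply, smul_sub]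
        abel }
  map_add' A A' := LinearMap.ext fun x => by
    simp only [LinearMap.add_apply, LinearMap.coe_mk, AddHom.coe_mk, map_add]
    abel
  map_smul' c A := LinearMap.ext fun x => by
    simp only [LinearMap.smul_apply, LinearMap.coe_mk, AddHom.coe_mk, map_smul, RingHom.id_apply,
      smul_sub]

lemma comm_apply (e : E) (A : Module.End (Laurent k m) L) (a : L) :
    C.comm e A a = Q.rho e (A a) - A (Q.rho e a) := rfl

lemma comm_mul (e : E) (A A' : Module.End (Laurent k m) L) :
    C.comm e (A * A') = C.comm e A * A' + A * C.comm e A' := LinearMap.ext fun x => by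
  simp only [comm_apply, Module.End.mul_apply, LinearMap.add_apply, map_sub]
  abel

lemma comm_ad (e : E) (a : L) :
    C.comm e (LieAlgebra.ad (Laurent k m) L a) = LieAlgebra.ad (Laurent k m) L (Q.rho e a) :=
  LinearMap.ext fun x => by
    simp only [comm_apply, LieAlgebra.ad_apply, Q.rho_lie_apply, add_sub_cancel_right]

variable (Q) in
/-- The matrix of the action of `e` on a basis of `L` over its centroid. -/
noncomputable def mat (e : E) : Matrix ι ι (Laurent k m) := b.toMatrix fun j => Q.rho e (b j)

omit [DecidableEq ι] [IsScalarTower k (Laurent k m) L] in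
lemma mat_apply (e : E) (i j : ι) : mat Q b e i j = b.repr (Q.rho e (b j)) i := rfl

omit [DecidableEq ι] [IsScalarTower k (Laurent k m) L] in
lemma rho_basis (e : E) (j : ι) : Q.rho e (b j) = ∑ i, mat Q b e i j • b i :=
  (b.sum_repr _).symm

lemma repr_rho (e : E) (a : L) (i : ι) :
    b.repr (Q.rho e a) i = C.der e (b.repr a i) + ∑ j, mat Q b e i j * b.repr a j := by
  conv_lhs => rw [← b.sum_repr a, map_sum]
  simp only [C.rho_smul, map_sum, map_add, map_smul, Finset.sum_add_distrib, Finsupp.coe_add,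
    Pi.add_apply, Finsupp.coe_finsetSum, Finset.sum_apply, Finsupp.coe_smul, Pi.smul_apply,
    smul_eq_mul, b.repr_self]
  congr 1
  · simp [Finsupp.single_apply]
  · exact Finset.sum_congr rfl fun j _ => mul_comm _ _

lemma toMatrix_comm (e : E) (A : Module.End (Laurent k m) L) :
    LinearMap.toMatrix b b (C.comm e A) = (LinearMap.toMatrix b b A).map (C.der e) +
      (mat Q b e * LinearMap.toMatrix b b A - LinearMap.toMatrix b b A * mat Q b e) := by
  ext1 i j
  rw [LinearMap.toMatrix_apply, comm_apply, map_sub, Finsupp.sub_apply, C.repr_rho, rho_basis,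
    map_sum, map_sum]
  simp only [Matrix.add_apply, Matrix.sub_apply, Matrix.map_apply, Matrix.mul_apply,
    LinearMap.toMatrix_apply, map_smul, Finsupp.coe_finsetSum, Finset.sum_apply, Finsupp.coe_smul,
    Pi.smul_apply, smul_eq_mul]
  rw [add_sub_assoc]
  congr 2
  exact Finset.sum_congr rfl fun j _ => mul_comm _ _

lemma mat_lie (e e' : E) :
    mat Q b ⁅e, e'⁆ = (mat Q b e').map (C.der e) - (mat Q b e).map (C.der e') +
      (mat Q b e * mat Q b e' - mat Q b e' * mat Q b e) := by
  ext1 i j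
  rw [mat_apply, Q.rho_lie, LinearMap.sub_apply, Module.End.mul_apply, Module.End.mul_apply,
    map_sub, Finsupp.sub_apply, C.repr_rho b e (Q.rho e' (b j)), C.repr_rho b e' (Q.rho e (b j))]
  simp only [Matrix.add_apply, Matrix.sub_apply, Matrix.map_apply, Matrix.mul_apply, ← mat_apply]
  ring

include b in
lemma trace_comm (e : E) (A : Module.End (Laurent k m) L) :
    LinearMap.trace (Laurent k m) L (C.comm e A) = C.der e (LinearMap.trace (Laurent k m) L A) := by
  rw [LinearMap.trace_eq_matrix_trace _ b, LinearMap.trace_eq_matrix_trace _ b, C.toMatrix_comm,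
    Matrix.trace_add, Matrix.trace_sub, Matrix.trace_mul_comm, sub_self, add_zero]
  simp only [Matrix.trace, Matrix.diag, Matrix.map_apply, map_sum]

omit [IsScalarTower k (Laurent k m) L] in
lemma mat_core {x : E} (hx : x ∈ core B H) :
    mat Q b x = LinearMap.toMatrix b b (LieAlgebra.ad (Laurent k m) L (Q.π ⟨x, hx⟩)) := by
  ext1 i j
  rw [mat_apply, LinearMap.toMatrix_apply, Q.rho_core ⟨x, hx⟩, LieAlgebra.ad_apply]

include b in
lemma killingForm_rho (e : E) (x y : L) :
    killingForm (Laurent k m) L (Q.rho e x) y + killingForm (Laurent k m) L x (Q.rho e y) =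
      C.der e (killingForm (Laurent k m) L x y) := by
  simp only [killingForm_apply_apply]
  change LinearMap.trace _ _ (_ * _) + LinearMap.trace _ _ (_ * _) =
    C.der e (LinearMap.trace _ _ (_ * _))
  rw [← C.trace_comm b, C.comm_mul, map_add, C.comm_ad, C.comm_ad]

end CoreQuot.Centroidal

end KillingForm

section Unimodular

variable {k E L : Type*} [Field k] [CharZero k] [LieRing E] [LieAlgebra k E]
  [LieRing L] [LieAlgebra k L] {B : E →ₗ[k] E →ₗ[k] k} {H : LieSubalgebra k E}

lemma Derivation.map_prod_of_eigen {R A ι : Type*} [CommRing R] [CommRing A] [Algebra R A]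
    (D : Derivation R A A) (s : Finset ι) (x : ι → A) (c : ι → R)
    (h : ∀ i ∈ s, D (x i) = c i • x i) :
    D (∏ i ∈ s, x i) = (∑ i ∈ s, c i) • ∏ i ∈ s, x i := by
  classical
  induction s using Finset.induction_on with
  | empty => simp
  | insert a s ha ih =>
    rw [Finset.prod_insert ha, Finset.sum_insert ha, D.leibniz, h a (Finset.mem_insert_self _ _),
      ih fun i hi => h i (Finset.mem_insert_of_mem hi), add_smul, smul_eq_mul, smul_eq_mul,
      mul_smul_comm, mul_smul_comm, mul_comm _ (x a), add_comm]

namespace CoreQuot.Centroidal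

variable {Q : CoreQuot B H L} {m : ℕ} [LieAlgebra (Laurent k m) L]
  [IsScalarTower k (Laurent k m) L] (C : Q.Centroidal m)
  {ι : Type*} [Fintype ι] [DecidableEq ι] (b : Module.Basis ι (Laurent k m) L)
  {wtb : ι → Module.Dual k H} (hb : ∀ i, b i ∈ Q.wt (wtb i))

include C b

lemma der_killingForm {α β : Module.Dual k H} {x y : L} (hx : x ∈ Q.wt α) (hy : y ∈ Q.wt β)
    (v : H) : C.der v (killingForm (Laurent k m) L x y) =
      (α v + β v) • killingForm (Laurent k m) L x y := by
  rw [← C.killingForm_rho b, hx v, hy v, ← algebraMap_smul (Laurent k m) (α v) x,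
    ← algebraMap_smul (Laurent k m) (β v) y, map_smul, map_smul, LinearMap.smul_apply,
    algebraMap_smul, algebraMap_smul, add_smul]

/-- The Gram matrix of the Killing form of `L` over its centroid. -/
noncomputable def gram : Matrix ι ι (Laurent k m) :=
  Matrix.of fun i j => killingForm (Laurent k m) L (b i) (b j)

omit C in
lemma gram_mulVec (a : L) (i : ι) :
    (gram b).mulVec (b.repr a) i = killingForm (Laurent k m) L (b i) a := by
  conv_rhs => rw [← b.sum_repr a, map_sum]
  simp only [Matrix.mulVec, dotProduct, gram, Matrix.of_apply, map_smul, smul_eq_mul]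
  exact Finset.sum_congr rfl fun j _ => mul_comm _ _

include hb

lemma der_gram_det (v : H) :
    C.der v (gram b).det = (∑ i, (wtb i + wtb i)) v • (gram b).det := by
  rw [Matrix.det_apply, map_sum, Finset.smul_sum]
  refine Finset.sum_congr rfl fun σ _ => ?_
  rw [Units.smul_def, map_zsmul, smul_comm]
  congr 1
  rw [Derivation.map_prod_of_eigen (C.der v) _ (fun i => gram b (σ i) i) (fun i => wtb (σ i) v + wtb i v)
    fun i _ => C.der_killingForm b (hb _) (hb _) v]
  congr 1
  rw [Finset.sum_add_distrib, Equiv.sum_comp σ (fun i => wtb i v), LinearMap.sum_apply,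
    ← Finset.sum_add_distrib]
  rfl

lemma killingForm_ne_zero : killingForm (Laurent k m) L ≠ 0 := by
  intro h0
  obtain ⟨α, hα⟩ := Q.isEALA.aniso_nonempty
  obtain ⟨h, e, f, t, he, -, -, hwt, -⟩ := Q.exists_sl2 hα
  have hαα : α (Q.isEALA.toH α) ≠ 0 := (Q.isEALA.mem_aniso.1 hα).2
  have hn : ∀ i, ∃ n : ℤ, ⁅h, b i⁆ = (n : k) • b i := fun i => by
    obtain ⟨n, hn⟩ := Q.isEALA.exists_int hα (Q.wtSpace_ne_bot (hb i) (b.ne_zero i))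
    exact ⟨n, by rw [hwt _ _ (hb i), hn, mul_div_cancel_right₀ _ hαα]⟩
  choose n hn using hn
  have h1 : killingForm (Laurent k m) L h h = algebraMap k _ ((∑ i, n i ^ 2 : ℤ) : k) := by
    rw [killingForm_apply_apply, LinearMap.trace_eq_matrix_trace _ b, Matrix.trace]
    rw [Int.cast_sum, map_sum]
    refine Finset.sum_congr rfl fun i _ => ?_
    rw [Matrix.diag_apply, LinearMap.toMatrix_apply, LinearMap.comp_apply, LieAlgebra.ad_apply,
      LieAlgebra.ad_apply, hn, lie_smul, hn, smul_smul, ← algebraMap_smul (Laurent k m), map_smul,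
      b.repr_self, Finsupp.smul_apply, Finsupp.single_eq_same, smul_eq_mul, mul_one, sq,
      Int.cast_mul]
  rw [h0, LinearMap.zero_apply, LinearMap.zero_apply, eq_comm,
    map_eq_zero_iff _ (algebraMap k (Laurent k m)).injective, Int.cast_eq_zero,
    Finset.sum_eq_zero_iff_of_nonneg fun i _ => sq_nonneg _] at h1
  have h2 : LieAlgebra.ad (Laurent k m) L h = 0 := b.ext fun i => by
    rw [LieAlgebra.ad_apply, hn, pow_eq_zero_iff two_ne_zero |>.1 (h1 i (Finset.mem_univ i)),
      Int.cast_zero, zero_smul, LinearMap.zero_apply]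
  have h3 := LinearMap.congr_fun h2 e
  rw [LieAlgebra.ad_apply, t.lie_h_e_nsmul, LinearMap.zero_apply] at h3
  have h4 : (2 : k) • e = 0 := by rw [two_smul, ← two_nsmul, h3]
  exact t.e_ne_zero ((smul_eq_zero.1 h4).resolve_left two_ne_zero)

lemma eq_zero_of_killingForm {a : L} (ha : ∀ x, killingForm (Laurent k m) L a x = 0) : a = 0 := by
  let I : Submodule k L :=
    { carrier := {a | ∀ x : L, killingForm (Laurent k m) L a x = 0}
      add_mem' := fun h1 h2 x => by rw [map_add, LinearMap.add_apply, h1 x, h2 x, add_zero]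
      zero_mem' := fun x => by rw [map_zero, LinearMap.zero_apply]
      smul_mem' := fun c a h x => by
        rw [← algebraMap_smul (Laurent k m) c a, map_smul, LinearMap.smul_apply, h x, smul_zero] }
  by_contra hne
  have hI : I = ⊤ := by
    refine Q.stable_ideal I ?_ ?_ ((Submodule.ne_bot_iff _).2 ⟨a, ha, hne⟩)
    · intro v c hc x
      have h1 := C.killingForm_rho b (v : E) c x
      rwa [hc, hc, map_zero, add_zero] at h1
    · intro c d hd x
      rw [LieModule.traceForm_apply_lie_apply', hd, neg_zero]
  refine C.killingForm_ne_zero b hb (LinearMap.ext fun x => LinearMap.ext fun y => ?_)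
  exact (hI ▸ Submodule.mem_top : x ∈ I) y

lemma isUnit_gram_det : IsUnit (gram b).det := by
  have hne : (gram b).det ≠ 0 := by
    intro h0
    obtain ⟨v, hv, hv0⟩ := Matrix.exists_mulVec_eq_zero_iff.2 h0
    refine hv ?_
    have h1 : b.equivFun.symm v = 0 := C.eq_zero_of_killingForm b hb fun x => by
      have h2 : killingForm (Laurent k m) L (b.equivFun.symm v) = 0 := b.ext fun i => by
        rw [LieModule.traceForm_comm, ← gram_mulVec]
        have : (b.repr (b.equivFun.symm v) : ι → Laurent k m) = v :=
          b.equivFun.apply_symm_apply v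
        rw [this, hv0]
        rfl
      rw [h2, LinearMap.zero_apply]
    exact (LinearEquiv.map_eq_zero_iff _).1 h1
  obtain ⟨n, hn⟩ : ∃ n, (gram b).det.coeff n ≠ 0 := by
    by_contra! hcon
    exact hne (by ext n; simpa using hcon n)
  rw [(C.eq_single_of_der_H (C.der_gram_det b hb) hn).2]
  refine IsUnit.of_mul_eq_one (AddMonoidAlgebra.single (-n) ((gram b).det.coeff n)⁻¹) ?_
  rw [AddMonoidAlgebra.single_mul_single, mul_inv_cancel₀ hn, add_neg_cancel,
    AddMonoidAlgebra.one_def]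

/-- The Killing form of `L` over its centroid is unimodular. -/
lemma exists_killingForm_eq (φ : L →ₗ[Laurent k m] Laurent k m) :
    ∃ y, killingForm (Laurent k m) L y = φ := by
  have hu := C.isUnit_gram_det b hb
  refine ⟨b.equivFun.symm ((gram b)⁻¹.mulVec fun i => φ (b i)), b.ext fun i => ?_⟩
  rw [LieModule.traceForm_comm, ← gram_mulVec]
  have : (b.repr (b.equivFun.symm ((gram b)⁻¹.mulVec fun i => φ (b i))) : ι → Laurent k m) = _ :=
    b.equivFun.apply_symm_apply _
  rw [this, Matrix.mulVec_mulVec, Matrix.mul_nonsing_inv _ hu, Matrix.one_mulVec]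

/-- Centroid-linear derivations of `L` are inner. -/
lemma exists_ad_eq (D : Module.End (Laurent k m) L) (hD : ∀ x y : L, D ⁅x, y⁆ = ⁅D x, y⁆ + ⁅x, D y⁆) :
    ∃ a, D = LieAlgebra.ad (Laurent k m) L a := by
  obtain ⟨a, ha⟩ := C.exists_killingForm_eq b hb
    (LinearMap.trace (Laurent k m) L ∘ₗ LinearMap.mulLeft (Laurent k m) D ∘ₗ
      (LieAlgebra.ad (Laurent k m) L : L →ₗ[Laurent k m] Module.End (Laurent k m) L))
  refine ⟨a, ?_⟩
  have h1 : ∀ y, LinearMap.trace (Laurent k m) L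
      ((D - LieAlgebra.ad (Laurent k m) L a) * LieAlgebra.ad (Laurent k m) L y) = 0 := fun y => by
    have := LinearMap.congr_fun ha y
    rw [killingForm_apply_apply] at this
    rw [sub_mul, map_sub, sub_eq_zero]
    exact this.symm
  rw [← sub_eq_zero]
  set D' := D - LieAlgebra.ad (Laurent k m) L a with hD'
  have h2 : ∀ x y : L, D' ⁅x, y⁆ = ⁅D' x, y⁆ + ⁅x, D' y⁆ := fun x y => by
    simp only [hD', LinearMap.sub_apply, LieAlgebra.ad_apply, hD, sub_lie, lie_sub, lie_lie]
    rw [leibniz_lie a x y]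
    abel
  refine LinearMap.ext fun x => C.eq_zero_of_killingForm b hb fun y => ?_
  have h3 : LieAlgebra.ad (Laurent k m) L (D' x) =
      D' * LieAlgebra.ad (Laurent k m) L x - LieAlgebra.ad (Laurent k m) L x * D' :=
    LinearMap.ext fun z => by
      simp only [LinearMap.sub_apply, Module.End.mul_apply, LieAlgebra.ad_apply, h2,
        add_sub_cancel_right]
  rw [killingForm_apply_apply, h3]
  change LinearMap.trace _ _ (_ * _) = 0
  have h4 := h1 ⁅x, y⁆
  have h5 : LieAlgebra.ad (Laurent k m) L ⁅x, y⁆ =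
      LieAlgebra.ad (Laurent k m) L x * LieAlgebra.ad (Laurent k m) L y -
        LieAlgebra.ad (Laurent k m) L y * LieAlgebra.ad (Laurent k m) L x :=
    LinearMap.ext fun z => by
      simp only [LinearMap.sub_apply, Module.End.mul_apply, LieAlgebra.ad_apply, lie_lie]
  rw [h5, mul_sub, map_sub, sub_eq_zero] at h4
  rw [sub_mul, map_sub, sub_eq_zero, mul_assoc, h4, ← mul_assoc, LinearMap.trace_mul_comm]
  rw [mul_assoc]

end CoreQuot.Centroidal

end Unimodular

section FormAndShift

variable {k E L : Type*} [Field k] [CharZero k] [LieRing E] [LieAlgebra k E]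
  [LieRing L] [LieAlgebra k L] {B : E →ₗ[k] E →ₗ[k] k} {H : LieSubalgebra k E}

namespace CoreQuot

variable {Q : CoreQuot B H L}

lemma form_eq_zero_of_wt {α β : Module.Dual k H} {x y : L} (hx : x ∈ Q.wt α) (hy : y ∈ Q.wt β)
    (hne : α + β ≠ 0) : Q.form x y = 0 := by
  obtain ⟨v, hv⟩ : ∃ v, (α + β) v ≠ 0 := by
    by_contra! hcon
    exact hne (LinearMap.ext hcon)
  have h1 := Q.form_rho (v : E) x y
  rw [hx v, hy v, map_smul, map_smul, LinearMap.smul_apply, ← add_eq_zero_iff_eq_neg, ← add_smul]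
    at h1
  exact (smul_eq_zero.1 h1).resolve_left hv

namespace Centroidal

variable {m : ℕ} [LieAlgebra (Laurent k m) L]
  [IsScalarTower k (Laurent k m) L] (C : Q.Centroidal m)
  {ι : Type*} [Fintype ι] [DecidableEq ι] (b : Module.Basis ι (Laurent k m) L)
  {wtb : ι → Module.Dual k H} (hb : ∀ i, b i ∈ Q.wt (wtb i))

omit [CharZero k] in
lemma coeff_single_mul (r : Laurent k m) (n : Fin m → ℤ) (c : k) :
    (AddMonoidAlgebra.single n c * r).coeff 0 = c * r.coeff (-n) :=
  AddMonoidAlgebra.coeff_single_mul_eq_mul_coeff _ fun n' _ => by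
    rw [add_comm, add_eq_zero_iff_eq_neg]

include C b hb

lemma exists_coeff_killingForm (a : L) :
    ∃ y, ∀ c, (killingForm (Laurent k m) L y c).coeff 0 = Q.form a c := by
  let N : Submodule k L :=
    { carrier := {a | ∃ y : L, ∀ c : L, (killingForm (Laurent k m) L y c).coeff 0 = Q.form a c}
      add_mem' := by
        rintro a a' ⟨y, hy⟩ ⟨y', hy'⟩
        exact ⟨y + y', fun c => by
          simp only [map_add, LinearMap.add_apply, AddMonoidAlgebra.coeff_add, Finsupp.add_apply,
            hy, hy']⟩
      zero_mem' := ⟨0, fun c => by simp⟩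
      smul_mem' := by
        rintro t a ⟨y, hy⟩
        exact ⟨algebraMap k (Laurent k m) t • y, fun c => by
          rw [map_smul, LinearMap.smul_apply, algebraMap_smul, AddMonoidAlgebra.coeff_smul,
            Finsupp.smul_apply, hy, map_smul, LinearMap.smul_apply]⟩ }
  refine simWt_induction Q.iSup_wt ⊤ (fun _ _ _ => trivial) N (fun α a _ ha => ?_)
    (Submodule.mem_top (x := a))
  have hp : ∀ i, ∃ p : Laurent k m, ∀ n, p.coeff (-n) =
      Q.form a ((AddMonoidAlgebra.single n 1 : Laurent k m) • b i) := by
    intro i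
    by_cases h : ∃ n, α + (wtb i + C.deg n) = 0
    · obtain ⟨n, hn⟩ := h
      refine ⟨AddMonoidAlgebra.single (-n)
        (Q.form a ((AddMonoidAlgebra.single n 1 : Laurent k m) • b i)), fun n' => ?_⟩
      by_cases h : n = n'
      · subst h; simp
      · rw [form_eq_zero_of_wt ha (C.smul_mem_wt n' _ _ (hb i)) fun h' => h (C.deg_injective
          (add_left_cancel (add_left_cancel (hn.trans h'.symm))))]
        simp [h]
    · push Not at h
      exact ⟨0, fun n => by
        rw [form_eq_zero_of_wt ha (C.smul_mem_wt n _ _ (hb i)) (h n)]; simp⟩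
  choose p hp using hp
  obtain ⟨y, hy⟩ := C.exists_killingForm_eq b hb (b.constr k p)
  refine ⟨y, fun c => ?_⟩
  rw [hy, ← b.sum_repr c, map_sum, AddMonoidAlgebra.coeff_sum, Finsupp.finsetSum_apply, map_sum]
  refine Finset.sum_congr rfl fun i _ => ?_
  generalize b.repr c i = r
  rw [map_smul, b.constr_basis, smul_eq_mul]
  induction r using Laurent.induction_single with
  | h0 => simp
  | hadd r s hr hs => rw [add_mul, add_smul, map_add, ← hr, ← hs]; rfl
  | hs n t =>
    rw [coeff_single_mul, hp, Laurent.single_eq_smul n t, smul_assoc, LinearMap.map_smul (Q.form a),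
      smul_eq_mul]

lemma eq_zero_of_coeff_killingForm {y : L}
    (hy : ∀ c, (killingForm (Laurent k m) L y c).coeff 0 = 0) : y = 0 := by
  refine C.eq_zero_of_killingForm b hb fun c => ?_
  ext n
  have h1 := hy ((AddMonoidAlgebra.single (-n) 1 : Laurent k m) • c)
  rw [map_smul, smul_eq_mul, coeff_single_mul, one_mul, neg_neg] at h1
  rw [h1]
  simp

/-- The form on `L` is the constant term of a multiple of the Killing form over the centroid. -/
lemma exists_form_eq : ∃ r : Laurent k m, ∀ x y,
    Q.form x y = (r * killingForm (Laurent k m) L x y).coeff 0 := by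
  choose T hT using C.exists_coeff_killingForm b hb
  have huniq : ∀ y y', (∀ c, (killingForm (Laurent k m) L y c).coeff 0 =
      (killingForm (Laurent k m) L y' c).coeff 0) → y = y' := fun y y' h => by
    rw [← sub_eq_zero]
    refine C.eq_zero_of_coeff_killingForm b hb fun c => ?_
    rw [map_sub, LinearMap.sub_apply, AddMonoidAlgebra.coeff_sub, Finsupp.sub_apply, h, sub_self]
  let χ : Module.End k L :=
    { toFun := T
      map_add' := fun a a' => huniq _ _ fun c => by
        simp only [map_add, LinearMap.add_apply, AddMonoidAlgebra.coeff_add, Finsupp.add_apply, hT]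
      map_smul' := fun t a => huniq _ _ fun c => by
        rw [← algebraMap_smul (Laurent k m) ((RingHom.id k) t) (T a), map_smul,
          LinearMap.smul_apply, algebraMap_smul, AddMonoidAlgebra.coeff_smul,
            Finsupp.smul_apply, hT, hT, map_smul, LinearMap.smul_apply, RingHom.id_apply] }
  obtain ⟨r, hr⟩ := C.exists_smul χ fun a a' => huniq _ _ fun c => by
    change (killingForm (Laurent k m) L (T _) c).coeff 0 =
      (killingForm (Laurent k m) L ⁅T a, a'⁆ c).coeff 0
    rw [hT, LieModule.traceForm_apply_lie_apply, hT, Q.form_lie]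
  refine ⟨r, fun x y => ?_⟩
  rw [← hT]
  change (killingForm (Laurent k m) L (χ x) y).coeff 0 = _
  rw [hr, map_smul, LinearMap.smul_apply, smul_eq_mul]

/-- The functional giving the form kills the values of the induced derivations. -/
lemma coeff_mul_der {r : Laurent k m}
    (hr : ∀ x y, Q.form x y = (r * killingForm (Laurent k m) L x y).coeff 0) (e : E)
    (s : Laurent k m) : (r * C.der e s).coeff 0 = 0 := by
  obtain ⟨α, hα⟩ := Q.isEALA.aniso_nonempty
  obtain ⟨h, e', f, t, -⟩ := Q.exists_sl2 hα
  obtain ⟨i⟩ : Nonempty ι := by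
    by_contra hcon
    rw [not_nonempty_iff] at hcon
    exact t.e_ne_zero (b.repr.injective (Subsingleton.elim _ _))
  obtain ⟨y, hy⟩ := C.exists_killingForm_eq b hb (b.coord i)
  have h1 : killingForm (Laurent k m) L (s • y) (b i) = s := by
    rw [map_smul, LinearMap.smul_apply, hy, b.coord_apply, b.repr_self, Finsupp.single_eq_same,
      smul_eq_mul, mul_one]
  rw [← h1, ← C.killingForm_rho b, mul_add, AddMonoidAlgebra.coeff_add, Finsupp.add_apply, ← hr,
    ← hr, Q.form_rho, neg_add_cancel]

/-- The twist of the action of `E` by a centroid-linear automorphism is inner. -/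
lemma exists_shift (g : L ≃ₗ⁅Laurent k m⁆ L) :
    ∃ l : E →ₗ[k] L, ∀ e a, g (Q.rho e (g.symm a)) = Q.rho e a + ⁅l e, a⁆ := by
  have h1 : ∀ e, ∃ x : L, ∀ a, g (Q.rho e (g.symm a)) = Q.rho e a + ⁅x, a⁆ := by
    intro e
    let D : Module.End (Laurent k m) L :=
      { toFun := fun a => g (Q.rho e (g.symm a)) - Q.rho e a
        map_add' := fun x y => by simp only [map_add]; abel
        map_smul' := fun r x => by
          simp only [map_smul, C.rho_smul, map_add, LieEquiv.apply_symm_apply, RingHom.id_apply,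
            smul_sub]
          abel }
    obtain ⟨x, hx⟩ := C.exists_ad_eq b hb D fun x y => by
      change g (Q.rho e (g.symm ⁅x, y⁆)) - Q.rho e ⁅x, y⁆ =
        ⁅g (Q.rho e (g.symm x)) - Q.rho e x, y⁆ + ⁅x, g (Q.rho e (g.symm y)) - Q.rho e y⁆
      simp only [LieEquiv.map_lie, Q.rho_lie_apply, map_add, LieEquiv.apply_symm_apply, sub_lie,
        lie_sub]
      abel
    refine ⟨x, fun a => ?_⟩
    have := LinearMap.congr_fun hx a
    rw [LieAlgebra.ad_apply] at this
    rw [← this]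
    exact (add_sub_cancel _ _).symm
  choose l hl using h1
  refine ⟨⟨⟨l, fun e e' => ?_⟩, fun c e => ?_⟩, fun e a => hl e a⟩
  · rw [← sub_eq_zero]
    refine Q.eq_zero_of_lie _ fun a => ?_
    have h1 := hl (e + e') a
    rw [map_add, LinearMap.add_apply, LinearMap.add_apply, map_add, hl, hl] at h1
    rw [sub_lie, add_lie, sub_eq_zero]
    rw [add_add_add_comm] at h1
    exact (add_left_cancel h1).symm
  · rw [← sub_eq_zero]
    refine Q.eq_zero_of_lie _ fun a => ?_
    have h1 := hl (c • e) a
    have h2 : ∀ z : L, g (c • z) = c • g z := fun z => by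
      rw [← algebraMap_smul (Laurent k m), map_smul, algebraMap_smul]
    rw [map_smul, LinearMap.smul_apply, LinearMap.smul_apply, h2, hl, smul_add] at h1
    rw [sub_lie, RingHom.id_apply, smul_lie, sub_eq_zero]
    exact (add_left_cancel h1).symm

end Centroidal

lemma shift_core (Q : CoreQuot B H L) {g : L → L} {g' : L → L} (hg : ∀ x y : L, g ⁅x, y⁆ = ⁅g x, g y⁆)
    (hgg' : ∀ x, g (g' x) = x) {l : E → L}
    (hl : ∀ e a, g (Q.rho e (g' a)) = Q.rho e a + ⁅l e, a⁆) {x : E} (hx : x ∈ core B H) :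
    l x = g (Q.π ⟨x, hx⟩) - Q.π ⟨x, hx⟩ := by
  rw [← sub_eq_zero]
  refine Q.eq_zero_of_lie _ fun a => ?_
  have h1 := hl x a
  rw [Q.rho_core ⟨x, hx⟩, Q.rho_core ⟨x, hx⟩, hg, hgg'] at h1
  rw [sub_lie, sub_lie, h1]
  abel

end CoreQuot

end FormAndShift

section Finiteness

variable {k E L : Type*} [Field k] [CharZero k] [LieRing E] [LieAlgebra k E]
  [LieRing L] [LieAlgebra k L] {B : E →ₗ[k] E →ₗ[k] k} {H : LieSubalgebra k E}

namespace CoreQuot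

/-- The sum of the weight spaces of `L` whose weights differ from `α` by an element of `S`. -/
noncomputable def shiftWt (Q : CoreQuot B H L) (S : Finset (Module.Dual k H))
    (α : Module.Dual k H) : Submodule k L := ⨆ s ∈ S, Q.wt (α + s)

variable {Q : CoreQuot B H L}

lemma mem_shiftWt {S : Finset (Module.Dual k H)} {α s : Module.Dual k H} (hs : s ∈ S) {x : L}
    (hx : x ∈ Q.wt (α + s)) : x ∈ Q.shiftWt S α :=
  Submodule.mem_iSup_of_mem s (Submodule.mem_iSup_of_mem hs hx)

lemma shiftWt_le {S : Finset (Module.Dual k H)} {α : Module.Dual k H} {N : Submodule k L}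
    (h : ∀ s ∈ S, Q.wt (α + s) ≤ N) : Q.shiftWt S α ≤ N := iSup₂_le h

lemma exists_mem_shiftWt (x : L) : ∃ S, x ∈ Q.shiftWt S 0 := by
  obtain ⟨s, m, hm, rfl⟩ := simWt_exists_decomp Q.iSup_wt x
  exact ⟨s, Submodule.sum_mem _ fun α hα => mem_shiftWt hα (by rw [zero_add]; exact hm α)⟩

/-- A linear map moving weights by elements of a finite set. -/
def BoundedShift (Q : CoreQuot B H L) (A : L → L) : Prop :=
  ∃ S, ∀ β, ∀ x ∈ Q.wt β, A x ∈ Q.shiftWt S β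

namespace Centroidal

variable {m : ℕ} [LieAlgebra (Laurent k m) L]
  [IsScalarTower k (Laurent k m) L] (C : Q.Centroidal m)
  {ι : Type*} [Fintype ι] [DecidableEq ι] (b : Module.Basis ι (Laurent k m) L)
  {wtb : ι → Module.Dual k H} (hb : ∀ i, b i ∈ Q.wt (wtb i))

include C b hb

lemma der_repr {β : Module.Dual k H} {x : L} (hx : x ∈ Q.wt β) (i : ι) (v : H) :
    C.der v (b.repr x i) = (β - wtb i) v • b.repr x i := by
  have h1 := C.repr_rho b v x i
  have h2 : ∀ c : k, b.repr (c • x) i = c • b.repr x i := fun c => by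
    rw [← algebraMap_smul (Laurent k m) c x, map_smul, Finsupp.smul_apply, algebraMap_smul]
  have h3 : ∀ j, mat Q b v i j = wtb j v • if j = i then (1 : Laurent k m) else 0 := fun j => by
    rw [mat_apply, hb j v, ← algebraMap_smul (Laurent k m) (wtb j v) (b j), map_smul,
      Finsupp.smul_apply, algebraMap_smul, b.repr_self, Finsupp.single_apply]
  rw [hx v, h2] at h1
  simp only [h3, smul_ite, smul_zero, ite_mul, zero_mul, Finset.sum_ite_eq', Finset.mem_univ,
    if_true, smul_mul_assoc, one_mul] at h1
  rw [LinearMap.sub_apply, sub_smul, h1, add_sub_cancel_right]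

lemma repr_eq_single {β : Module.Dual k H} {x : L} (hx : x ∈ Q.wt β) (i : ι)
    (hne : b.repr x i ≠ 0) :
    ∃ n c, b.repr x i = AddMonoidAlgebra.single n c ∧ wtb i + C.deg n = β := by
  obtain ⟨n, hn⟩ : ∃ n, (b.repr x i).coeff n ≠ 0 := by
    by_contra! hcon
    exact hne (by ext n; simpa using hcon n)
  obtain ⟨h1, h2⟩ := C.eq_single_of_der_H (C.der_repr b hb hx i) hn
  exact ⟨n, _, h2, by rw [h1, add_sub_cancel]⟩

/-- Centroid-linear maps move weights by elements of a finite set. -/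
lemma boundedShift (A : L →ₗ[Laurent k m] L) : Q.BoundedShift A := by
  classical
  choose S hS using fun j => exists_mem_shiftWt (Q := Q) (A (b j))
  refine ⟨Finset.univ.biUnion fun j => (S j).image fun s => s - wtb j, fun β x hx => ?_⟩
  rw [← b.sum_repr x, map_sum]
  refine Submodule.sum_mem _ fun j _ => ?_
  rw [map_smul]
  by_cases h0 : b.repr x j = 0
  · rw [h0, zero_smul]
    exact Submodule.zero_mem _
  obtain ⟨n, c, h1, h2⟩ := C.repr_eq_single b hb hx j h0
  rw [h1]
  have h3 : Q.shiftWt (S j) 0 ≤ (Q.shiftWt (Finset.univ.biUnion fun j => (S j).image fun s =>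
      s - wtb j) β).comap (Algebra.lsmul k k L (AddMonoidAlgebra.single n c)) := by
    refine shiftWt_le fun s hs y hy => ?_
    rw [zero_add] at hy
    refine mem_shiftWt (s := s - wtb j) (Finset.mem_biUnion.2 ⟨j, Finset.mem_univ _,
      Finset.mem_image_of_mem _ hs⟩) ?_
    have := C.smul_single_mem_wt n c hy
    rwa [show β + (s - wtb j) = s + C.deg n by rw [← h2]; abel]
  exact h3 (hS j)

/-- The shift of the action by an automorphism moves weights by elements of a finite set. -/
lemma exists_shift_mem {g : L ≃ₗ⁅Laurent k m⁆ L} {l : E →ₗ[k] L}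
    (hl : ∀ e a, g (Q.rho e (g.symm a)) = Q.rho e a + ⁅l e, a⁆) :
    ∃ S, ∀ α, ∀ e ∈ wtSpace H α, l e ∈ Q.shiftWt S α := by
  classical
  obtain ⟨S₁, hS₁⟩ := C.boundedShift b hb (g : L →ₗ[Laurent k m] L)
  obtain ⟨S₂, hS₂⟩ := C.boundedShift b hb (g.symm : L →ₗ[Laurent k m] L)
  refine ⟨insert 0 (Finset.image₂ (· + ·) S₂ S₁), fun α e he => ?_⟩
  set T := insert 0 (Finset.image₂ (· + ·) S₂ S₁) with hT
  have h1 : ∀ β, ∀ x ∈ Q.wt β, ⁅l e, x⁆ ∈ Q.shiftWt T (α + β) := by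
    intro β x hx
    have h2 : ⁅l e, x⁆ = g (Q.rho e (g.symm x)) - Q.rho e x := by rw [hl]; abel
    rw [h2]
    refine Submodule.sub_mem _ ?_ (mem_shiftWt (Finset.mem_insert_self 0 _)
      (by rw [add_zero]; exact Q.rho_mem_wt he hx))
    have h3 : Q.shiftWt S₂ β ≤ (Q.shiftWt T (α + β)).comap
        (((g : L →ₗ[Laurent k m] L).restrictScalars k) ∘ₗ Q.rho e) := by
      refine shiftWt_le fun s hs y hy => ?_
      have h4 : Q.shiftWt S₁ (α + (β + s)) ≤ Q.shiftWt T (α + β) :=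
        shiftWt_le fun s' hs' z hz => mem_shiftWt
          (Finset.mem_insert_of_mem (Finset.mem_image₂_of_mem hs hs')) (by
            rwa [show α + β + (s + s') = α + (β + s) + s' by abel])
      exact h4 (hS₁ _ _ (Q.rho_mem_wt he hy))
    exact h3 (hS₂ _ _ hx)
  obtain ⟨t, a, ha, hsum⟩ := simWt_exists_decomp Q.iSup_wt (l e)
  rw [hsum]
  refine Submodule.sum_mem _ fun γ hγ => ?_
  by_cases hγα : γ - α ∈ T
  · exact mem_shiftWt hγα (by rw [add_sub_cancel]; exact ha γ)
  have h0 : a γ = 0 := by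
    refine Q.eq_zero_of_lie _ fun x => ?_
    have := simWt_ext Q.iSup_wt (f := (LieAlgebra.ad k L (a γ) : L →ₗ[k] L)) (g := 0)
      fun β x hx => by
        obtain ⟨P, hP1, hP2⟩ := simWt_exists_proj Q.iSup_wt (γ + β)
        have h5 : P ⁅l e, x⁆ = 0 := by
          have : Q.shiftWt T (α + β) ≤ LinearMap.ker P := shiftWt_le fun s hs y hy =>
            hP2 _ (fun h => hγα (by
              rw [show γ - α = s by
                rw [sub_eq_iff_eq_add]; exact add_right_cancel (b := β) (by rw [← h]; abel)]
              exact hs)) y hy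
          exact this (h1 β x hx)
        rw [hsum, sum_lie, map_sum, Finset.sum_eq_single γ] at h5
        · rwa [hP1 _ (Q.lie_mem_wt (ha γ) hx)] at h5
        · exact fun δ _ hδ => hP2 (δ + β) (fun h => hδ (add_right_cancel h)) _
            (Q.lie_mem_wt (ha δ) hx)
        · exact fun h => absurd hγ h
    exact LinearMap.congr_fun this x
  rw [h0]
  exact Submodule.zero_mem _

omit hb b [DecidableEq ι] [Fintype ι] in
lemma fg_simWt_der (γ : Module.Dual k H) :
    (simWt (fun v : H => (C.der v : Laurent k m →ₗ[k] Laurent k m)) γ).FG := by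
  by_cases h : ∃ n, C.deg n = γ
  · obtain ⟨n, hn⟩ := h
    refine (Submodule.fg_span_singleton (R := k) (AddMonoidAlgebra.single n 1 : Laurent k m)).of_le
      fun r hr => ?_
    by_cases h0 : ∃ n', r.coeff n' ≠ 0
    · obtain ⟨n', hn'⟩ := h0
      obtain ⟨h1, h2⟩ := C.eq_single_of_der_H hr hn'
      obtain rfl := C.deg_injective (h1.trans hn.symm)
      refine Submodule.mem_span_singleton.2 ⟨r.coeff n', ?_⟩
      rw [← Laurent.single_eq_smul]
      exact h2.symm
    · push Not at h0
      rw [show r = 0 by ext n'; simpa using h0 n']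
      exact Submodule.zero_mem _
  · refine (Submodule.fg_bot (R := k) (M := Laurent k m)).of_le fun r hr => ?_
    by_cases h0 : ∃ n', r.coeff n' ≠ 0
    · obtain ⟨n', hn'⟩ := h0
      exact absurd ⟨n', (C.eq_single_of_der_H hr hn').1⟩ h
    · push Not at h0
      rw [show r = 0 by ext n'; simpa using h0 n']
      exact Submodule.zero_mem _

lemma fg_wt (β : Module.Dual k H) : (Q.wt β).FG := by
  let f : L →ₗ[k] ι → Laurent k m := (b.equivFun : L →ₗ[Laurent k m] ι → Laurent k m).restrictScalars k
  refine Submodule.fg_of_fg_map_injective f b.equivFun.injective ?_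
  refine (Submodule.fg_pi (p := fun i => simWt (fun v : H => (C.der v : Laurent k m →ₗ[k] Laurent k m))
    (β - wtb i)) fun i => C.fg_simWt_der _).of_le ?_
  rintro _ ⟨x, hx, rfl⟩ i -
  exact C.der_repr b hb hx i

omit hb b [DecidableEq ι] [Fintype ι] in
lemma der_eq_zero {δ : Derivation k (Laurent k m) (Laurent k m)}
    (h : ∀ i, δ (AddMonoidAlgebra.single (Pi.single i 1) 1) = 0) : δ = 0 := by
  let K : AddSubgroup (Fin m → ℤ) :=
    { carrier := {n | δ (AddMonoidAlgebra.single n 1) = 0}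
      add_mem' := fun {n n'} hn hn' => by
        have := δ.leibniz (AddMonoidAlgebra.single n 1) (AddMonoidAlgebra.single n' 1)
        rw [AddMonoidAlgebra.single_mul_single, mul_one, hn, hn', smul_zero, smul_zero,
          add_zero] at this
        exact this
      zero_mem' := δ.map_one_eq_zero
      neg_mem' := fun {n} hn => by
        have h1 := δ.leibniz (AddMonoidAlgebra.single n 1) (AddMonoidAlgebra.single (-n) 1)
        rw [AddMonoidAlgebra.single_mul_single, mul_one, hn, smul_zero, add_zero, add_neg_cancel,
          smul_eq_mul] at h1
        have h2 := congrArg (fun r => AddMonoidAlgebra.single (-n) 1 * r) h1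
        change _ = AddMonoidAlgebra.single (-n) 1 * (AddMonoidAlgebra.single n 1 * _) at h2
        rw [← mul_assoc, AddMonoidAlgebra.single_mul_single, neg_add_cancel, mul_one,
          ← AddMonoidAlgebra.one_def, one_mul] at h2
        change δ _ = 0
        rw [← h2]
        change _ * δ 1 = 0
        rw [δ.map_one_eq_zero, mul_zero] }
  have hK : ∀ n, n ∈ K := fun n => by
    rw [← Finset.univ_sum_single n]
    refine K.sum_mem fun i _ => ?_
    have : (Pi.single i (n i) : Fin m → ℤ) = n i • Pi.single i 1 := by
      rw [← Pi.single_smul, smul_eq_mul, mul_one]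
    rw [this]
    exact K.zsmul_mem (h i) _
  ext r
  induction r using Laurent.induction_single with
  | h0 => simp
  | hadd r s hr hs => rw [map_add, AddMonoidAlgebra.coeff_add, Finsupp.add_apply, hr, hs]; simp
  | hs n c =>
    rw [Laurent.single_eq_smul, Derivation.map_smul, show δ _ = 0 from hK n, smul_zero]
    rfl

lemma mem_core_of_der_eq_zero {e : E} (he : C.der e = 0) : e ∈ core B H := by
  let D : Module.End (Laurent k m) L :=
    { toFun := Q.rho e
      map_add' := fun x y => map_add _ x y
      map_smul' := fun r x => by rw [C.rho_smul, he]; simp }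
  obtain ⟨a, ha⟩ := C.exists_ad_eq b hb D fun x y => Q.rho_lie_apply e x y
  obtain ⟨x, rfl⟩ := Q.surj a
  have h1 : Q.rho (e - x) = 0 := by
    rw [map_sub, sub_eq_zero]
    ext y
    rw [Q.rho_core x]
    exact LinearMap.congr_fun ha y
  have h2 := Q.isEALA.ea4 _ ((Q.rho_eq_zero_iff _).1 h1)
  simpa using (core B H).add_mem h2 x.2

/-- The root spaces of the extended affine Lie algebra are finite-dimensional. -/
lemma fg_wtSpace (β : Module.Dual k H) : (wtSpace H β).FG := by
  let f : E →ₗ[k] Fin m → Laurent k m :=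
    { toFun := fun e i => C.der e (AddMonoidAlgebra.single (Pi.single i 1) 1)
      map_add' := fun e e' => by ext1 i; rw [map_add]; rfl
      map_smul' := fun c e => by ext1 i; rw [map_smul]; rfl }
  have hf : ∀ e, f e = 0 → e ∈ core B H := fun e he =>
    C.mem_core_of_der_eq_zero b hb (der_eq_zero C fun i => congrFun he i)
  have himg : ∀ β : Module.Dual k H, ((wtSpace H β).map f).FG := by
    intro β
    refine (Submodule.fg_pi (p := fun i => simWt
      (fun v : H => (C.der v : Laurent k m →ₗ[k] Laurent k m))
      (β + C.deg (Pi.single i 1))) fun i => C.fg_simWt_der _).of_le ?_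
    rintro _ ⟨e, he, rfl⟩ i -
    exact C.der_H_der he
  refine Submodule.fg_of_fg_map_of_fg_inf_ker f (himg β) ?_
  refine Submodule.FG.of_le (T := wtSpace H β ⊓ (core B H).toSubmodule) ?_
    (inf_le_inf_left _ fun e he => hf e he)
  refine Submodule.fg_of_fg_map_of_fg_inf_ker Q.rho ?_ ?_
  · refine ((C.fg_wt b hb β).map (LieAlgebra.ad k L : L →ₗ[k] Module.End k L)).of_le ?_
    rintro _ ⟨e, he, rfl⟩
    exact ⟨Q.π ⟨e, he.2⟩, Q.pi_mem_wt he.2 he.1, by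
      ext y; exact (Q.rho_core ⟨e, he.2⟩ y).symm⟩
  · set Z := (wtSpace H β ⊓ (core B H).toSubmodule) ⊓ LinearMap.ker Q.rho
    let f' := f.submoduleMap (wtSpace H (-β))
    obtain ⟨σ, hσ⟩ := f'.exists_rightInverse_of_surjective
      (LinearMap.range_eq_top.2 (f.submoduleMap_surjective _))
    have : Module.Finite k ((wtSpace H (-β)).map f) := Module.Finite.iff_fg.2 (himg (-β))
    rw [← Module.Finite.iff_fg]
    let F : Z →ₗ[k] Module.Dual k ((wtSpace H (-β)).map f) :=
      { toFun := fun z => B z ∘ₗ (wtSpace H (-β)).subtype ∘ₗ σ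
        map_add' := fun z z' => by ext; simp
        map_smul' := fun c z => by ext; simp }
    refine Module.Finite.of_injective F ((injective_iff_map_eq_zero _).2 fun z hz => ?_)
    by_contra hne
    obtain ⟨y, hy, hzy⟩ := Q.isEALA.exists_dual z.2.1.1 (fun h => hne (Subtype.ext h))
    have h1 := Q.isEALA.centralizes_core_iff.1 ((Q.rho_eq_zero_iff _).1 z.2.2)
    have h2 : B z (σ (f' ⟨y, hy⟩)) = 0 := LinearMap.congr_fun hz (f' ⟨y, hy⟩)
    have h3 : f (y - σ (f' ⟨y, hy⟩)) = 0 := by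
      rw [map_sub, sub_eq_zero]
      exact (congrArg Subtype.val (LinearMap.congr_fun hσ (f' ⟨y, hy⟩))).symm
    have h4 := h1 _ (hf _ h3)
    rw [map_sub, h2, sub_zero, hzy] at h4
    exact one_ne_zero h4

end Centroidal

end CoreQuot

end Finiteness

section TraceIdentity

/-- The cocycle identity for twists by commuting logarithmic derivatives. -/
lemma trace_cocycle_identity {k A : Type*} [Field k] [CharZero k] [Ring A] [Algebra k A]
    (T : A →ₗ[k] A →ₗ[k] k) (hsymm : ∀ x y, T x y = T y x)
    (hinv : ∀ x y z, T (x * y) z = T x (y * z)) (d₁ d₂ d₃ : A →ₗ[k] A)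
    (h₁ : ∀ x y, T x (d₁ y) = - T y (d₁ x)) (h₂ : ∀ x y, T x (d₂ y) = - T y (d₂ x))
    (h₃ : ∀ x y, T x (d₃ y) = - T y (d₃ x)) (a b c a' b' u₁ u₂ u₃ : A)
    (h12 : u₁ * u₂ = u₂ * u₁) (h13 : u₁ * u₃ = u₃ * u₁) (h23 : u₂ * u₃ = u₃ * u₂)
    (hconj : T (d₃ a') b' = T (d₃ a) b - T (u₃ * a' - a' * u₃) b')
    {M M' U M₂₃ M₁₃ U₂₃ U₁₃ l₁ l₂ : A}
    (hM : M = d₁ b - d₂ a + (a * b - b * a))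
    (hM' : M' = d₁ b' - d₂ a' + (u₁ * b' - b' * u₁) - (u₂ * a' - a' * u₂) + (a' * b' - b' * a'))
    (hU : U = d₁ u₂ - d₂ u₁)
    (hM₂₃ : M₂₃ = d₂ c - d₃ b + (b * c - c * b)) (hM₁₃ : M₁₃ = d₁ c - d₃ a + (a * c - c * a))
    (hU₂₃ : U₂₃ = d₂ u₃ - d₃ u₂) (hU₁₃ : U₁₃ = d₁ u₃ - d₃ u₁)
    (hl₁ : l₁ = a' + u₁ - a) (hl₂ : l₂ = b' + u₂ - b) :
    T (M' + U - M) c - T M' u₃ - 2⁻¹ * T U u₃ =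
      T l₁ M₂₃ - T a' U₂₃ - 2⁻¹ * T u₁ U₂₃ - (T l₂ M₁₃ - T b' U₁₃ - 2⁻¹ * T u₂ U₁₃) +
        T (d₃ l₁ + (c * l₁ - l₁ * c)) l₂ := by
  subst hM hM' hU hM₂₃ hM₁₃ hU₂₃ hU₁₃ hl₁ hl₂
  have s₁ : ∀ x y, T (d₁ x) y = T y (d₁ x) := fun x y => hsymm _ _
  have s₂ : ∀ x y, T (d₂ x) y = T y (d₂ x) := fun x y => hsymm _ _
  have s₃ : ∀ x y, T (d₃ x) y = T y (d₃ x) := fun x y => hsymm _ _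
  have hinv' : ∀ x y z, T x (y * z) = T (x * y) z := fun x y z => (hinv x y z).symm
  obtain ⟨P, hP⟩ : ∃ P : A → A → A → k, ∀ x y z, T (x * y) z = P x y z :=
    ⟨fun x y z => T (x * y) z, fun _ _ _ => rfl⟩
  have c₁ : ∀ x y z, P x y z = P y z x := fun x y z => by
    rw [← hP, ← hP, hsymm (y * z) x, hinv]
  have c₂ : ∀ x y z, P x y z = P z x y := fun x y z => by rw [c₁ z x y]
  have e₁ : P u₁ u₂ c = P u₂ u₁ c := by rw [← hP, ← hP, h12]
  have e₂ : P u₁ u₃ b' = P u₃ u₁ b' := by rw [← hP, ← hP, h13]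
  have e₃ : P u₂ u₃ a' = P u₃ u₂ a' := by rw [← hP, ← hP, h23]
  have hc1 := fun x => h₁ x c
  have hc2 := fun x => h₂ x c
  have hu1 := fun x => h₁ x u₃
  have hu2 := fun x => h₂ x u₃
  have ha := fun x => h₃ x a
  have ha' := fun x => h₃ x a'
  have hu := fun x => h₃ x u₁
  simp only [map_add, map_sub, LinearMap.add_apply, LinearMap.sub_apply, s₁, s₂, s₃, hinv', hP,
    mul_add, add_mul, mul_sub, sub_mul] at hconj ⊢
  simp only [hc1, hc2, hu1, hu2, ha, ha', hu] at hconj ⊢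
  simp only [c₁, c₂] at hconj e₁ e₂ e₃ ⊢
  linear_combination -hconj - e₁ + e₂ - e₃

end TraceIdentity

section Gauge

variable {k F n : Type*} [Field k] [Field F] [Algebra k F] [Fintype n] [DecidableEq n]

/-- Entrywise application of a derivation to matrices. -/
def Matrix.mapDer (δ : Derivation k F F) : Matrix n n F →ₗ[k] Matrix n n F :=
  (δ : F →ₗ[k] F).mapMatrix

namespace Matrix

lemma mapDer_apply (δ : Derivation k F F) (X : Matrix n n F) (i j : n) :
    X.mapDer δ i j = δ (X i j) := rfl

lemma mapDer_mul (δ : Derivation k F F) (X Y : Matrix n n F) :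
    (X * Y).mapDer δ = X.mapDer δ * Y + X * Y.mapDer δ := by
  ext i j
  simp only [mapDer_apply, mul_apply, add_apply, map_sum, Derivation.leibniz, smul_eq_mul,
    Finset.sum_add_distrib]
  rw [add_comm]
  congr 1
  exact Finset.sum_congr rfl fun _ _ => mul_comm _ _

lemma mapDer_one (δ : Derivation k F F) : (1 : Matrix n n F).mapDer δ = 0 := by
  ext i j
  rw [mapDer_apply, one_apply]
  split_ifs <;> simp

lemma trace_mapDer (δ : Derivation k F F) (X : Matrix n n F) :
    (X.mapDer δ).trace = δ X.trace := by
  simp [trace, mapDer_apply]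

lemma mapDer_lie (δ δ' : Derivation k F F) (X : Matrix n n F) :
    X.mapDer ⁅δ, δ'⁆ = (X.mapDer δ').mapDer δ - (X.mapDer δ).mapDer δ' := by
  ext i j
  simp [mapDer_apply, Derivation.commutator_apply]

lemma mapDer_add (δ δ' : Derivation k F F) (X : Matrix n n F) :
    X.mapDer (δ + δ') = X.mapDer δ + X.mapDer δ' := rfl

lemma mapDer_smul (c : k) (δ : Derivation k F F) (X : Matrix n n F) :
    X.mapDer (c • δ) = c • X.mapDer δ := rfl

lemma mapDer_zero (X : Matrix n n F) : X.mapDer (0 : Derivation k F F) = 0 := rfl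

/-- Differentiating an inverse. -/
lemma mapDer_mul_of_mul_eq_one (δ : Derivation k F F) {g g' : Matrix n n F} (h : g * g' = 1) :
    g.mapDer δ * g' = - (g * g'.mapDer δ) := by
  rw [eq_neg_iff_add_eq_zero, ← mapDer_mul, h, mapDer_one]

end Matrix

namespace Gauge

/-- The trace form composed with a functional. -/
noncomputable def form (n : Type*) [Fintype n] (ε : F →ₗ[k] k) :
    Matrix n n F →ₗ[k] Matrix n n F →ₗ[k] k :=
  (LinearMap.mul k (Matrix n n F)).compr₂ (ε ∘ₗ Matrix.traceLinearMap n k F)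

lemma form_apply (ε : F →ₗ[k] k) (X Y : Matrix n n F) : form n ε X Y = ε (X * Y).trace := rfl

lemma form_symm (ε : F →ₗ[k] k) (X Y : Matrix n n F) : form n ε X Y = form n ε Y X := by
  rw [form_apply, form_apply, Matrix.trace_mul_comm]

lemma form_mul (ε : F →ₗ[k] k) (X Y Z : Matrix n n F) :
    form n ε (X * Y) Z = form n ε X (Y * Z) := by
  rw [form_apply, form_apply, Matrix.mul_assoc]

lemma form_mapDer {ε : F →ₗ[k] k} {δ : Derivation k F F} (hδ : ∀ x, ε (δ x) = 0)
    (X Y : Matrix n n F) : form n ε X (Y.mapDer δ) = - form n ε Y (X.mapDer δ) := by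
  rw [form_symm ε Y, eq_neg_iff_add_eq_zero, form_apply, form_apply, ← map_add,
    ← Matrix.trace_add, add_comm, ← Matrix.mapDer_mul, Matrix.trace_mapDer, hδ]

/-- The bracket of first-order matrix differential operators. -/
def br (p q : Matrix n n F × Derivation k F F) : Matrix n n F × Derivation k F F :=
  (q.1.mapDer p.2 - p.1.mapDer q.2 + (p.1 * q.1 - q.1 * p.1), ⁅p.2, q.2⁆)

/-- The action of a first-order matrix differential operator on matrices. -/
def act (p : Matrix n n F × Derivation k F F) (X : Matrix n n F) : Matrix n n F :=
  X.mapDer p.2 + (p.1 * X - X * p.1)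

/-- The logarithmic derivative. -/
def logDer (g g' : Matrix n n F) : Matrix n n F × Derivation k F F →ₗ[k] Matrix n n F where
  toFun p := g * g'.mapDer p.2
  map_add' p q := by rw [Prod.snd_add, Matrix.mapDer_add, mul_add]
  map_smul' c p := by rw [Prod.smul_snd, Matrix.mapDer_smul, mul_smul_comm]; rfl

/-- Conjugation of the matrix part. -/
def conj (g g' : Matrix n n F) : Matrix n n F × Derivation k F F →ₗ[k] Matrix n n F where
  toFun p := g * p.1 * g'
  map_add' p q := by rw [Prod.fst_add, mul_add, add_mul]
  map_smul' c p := by rw [Prod.smul_fst, mul_smul_comm, smul_mul_assoc]; rfl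

/-- The difference between a first-order matrix differential operator and its conjugate. -/
def shift (g g' : Matrix n n F) : Matrix n n F × Derivation k F F →ₗ[k] Matrix n n F :=
  conj g g' + logDer g g' - LinearMap.fst k _ _

lemma logDer_apply (g g' : Matrix n n F) (p : Matrix n n F × Derivation k F F) :
    logDer g g' p = g * g'.mapDer p.2 := rfl

lemma conj_apply (g g' : Matrix n n F) (p : Matrix n n F × Derivation k F F) :
    conj g g' p = g * p.1 * g' := rfl

lemma shift_apply (g g' : Matrix n n F) (p : Matrix n n F × Derivation k F F) :
    shift g g' p = g * p.1 * g' + g * g'.mapDer p.2 - p.1 := rfl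

lemma mapDer_conj {g g' : Matrix n n F} (h : g * g' = 1) (h' : g' * g = 1)
    (δ : Derivation k F F) (X : Matrix n n F) : (g * X * g').mapDer δ = g * X.mapDer δ * g' -
      (g * g'.mapDer δ * (g * X * g') - (g * X * g') * (g * g'.mapDer δ)) := by
  have h1 : g.mapDer δ = - (g * g'.mapDer δ) * g := by
    rw [← Matrix.mapDer_mul_of_mul_eq_one δ h, mul_assoc, h', mul_one]
  rw [Matrix.mapDer_mul, Matrix.mapDer_mul, h1,
    show g * X * g' * (g * g'.mapDer δ) = g * X * (g' * g) * g'.mapDer δ by noncomm_ring, h',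
    mul_one]
  noncomm_ring

lemma mapDer_logDer {g g' : Matrix n n F} (h : g * g' = 1) (h' : g' * g = 1)
    (p q : Matrix n n F × Derivation k F F) : (logDer g g' q).mapDer p.2 =
      g * (g'.mapDer q.2).mapDer p.2 - logDer g g' p * logDer g g' q := by
  have h1 : g.mapDer p.2 = - (g * g'.mapDer p.2) * g := by
    rw [← Matrix.mapDer_mul_of_mul_eq_one p.2 h, mul_assoc, h', mul_one]
  rw [logDer_apply, Matrix.mapDer_mul, h1, logDer_apply]
  noncomm_ring

lemma logDer_br {g g' : Matrix n n F} (h : g * g' = 1) (h' : g' * g = 1)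
    (p q : Matrix n n F × Derivation k F F) : logDer g g' (br p q) =
      (logDer g g' q).mapDer p.2 - (logDer g g' p).mapDer q.2 +
        (logDer g g' p * logDer g g' q - logDer g g' q * logDer g g' p) := by
  rw [mapDer_logDer h h', mapDer_logDer h h', logDer_apply g g' (br p q)]
  change g * g'.mapDer ⁅p.2, q.2⁆ = _
  rw [Matrix.mapDer_lie, mul_sub]
  abel

lemma conj_br {g g' : Matrix n n F} (h : g * g' = 1) (h' : g' * g = 1)
    (p q : Matrix n n F × Derivation k F F) : conj g g' (br p q) =
      (conj g g' q).mapDer p.2 - (conj g g' p).mapDer q.2 +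
        (logDer g g' p * conj g g' q - conj g g' q * logDer g g' p) -
        (logDer g g' q * conj g g' p - conj g g' p * logDer g g' q) +
        (conj g g' p * conj g g' q - conj g g' q * conj g g' p) := by
  have h1 : ∀ X Y, g * X * g' * (g * Y * g') = g * (X * Y) * g' := fun X Y => by
    rw [show g * X * g' * (g * Y * g') = g * X * (g' * g) * Y * g' by noncomm_ring, h', mul_one]
    noncomm_ring
  simp only [conj_apply, logDer_apply, mapDer_conj h h', h1]
  change g * (q.1.mapDer p.2 - p.1.mapDer q.2 + (p.1 * q.1 - q.1 * p.1)) * g' = _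
  simp only [mul_add, mul_sub, add_mul, sub_mul]
  abel

lemma form_conj (ε : F →ₗ[k] k) {g g' : Matrix n n F} (h' : g' * g = 1) (X Y : Matrix n n F) :
    form n ε (g * X * g') (g * Y * g') = form n ε X Y := by
  rw [form_apply, form_apply,
    show g * X * g' * (g * Y * g') = g * X * (g' * g) * Y * g' by noncomm_ring, h', mul_one,
    Matrix.trace_mul_comm, mul_assoc g, ← mul_assoc g', h', one_mul]

lemma br_add_left (p q : Matrix n n F × Derivation k F F) (X : Matrix n n F) :
    br (p + (X, 0)) q = br p q + (- act q X, 0) := by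
  refine Prod.ext ?_ ?_
  · simp only [br, act, Prod.fst_add, Prod.snd_add, add_zero, map_add, add_mul, mul_add]
    abel
  · simp [br]

lemma act_add (p : Matrix n n F × Derivation k F F) (X Y : Matrix n n F) :
    act p (X + Y) = act p X + act p Y := by
  simp only [act, map_add, add_mul, mul_add]
  abel

lemma form_act {ε : F →ₗ[k] k} {p : Matrix n n F × Derivation k F F} (hp : ∀ x, ε (p.2 x) = 0)
    (X Y : Matrix n n F) : form n ε (act p X) Y = - form n ε X (act p Y) := by
  have h1 := form_mapDer hp X Y
  rw [form_symm ε Y] at h1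
  have h2 : form n ε (p.1 * X) Y = form n ε X (Y * p.1) := by
    rw [form_symm, ← form_mul, form_symm]
  have h3 := form_mul ε X p.1 Y
  simp only [act, map_add, map_sub, LinearMap.add_apply, LinearMap.sub_apply]
  rw [h1, h2, h3]
  ring

/-- The conjugation by a matrix admits a cocycle describing its lift. -/
def Liftable (ε : F →ₗ[k] k) (g g' : Matrix n n F) : Prop :=
  ∃ b : (Matrix n n F × Derivation k F F) →ₗ[k] (Matrix n n F × Derivation k F F) →ₗ[k] k,
    (∀ p q r : Matrix n n F × Derivation k F F, (∀ x, ε (p.2 x) = 0) → (∀ x, ε (q.2 x) = 0) →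
      (∀ x, ε (r.2 x) = 0) → b (br p q) r = b p (br q r) - b q (br p r) +
        form n ε (act r (shift g g' p)) (shift g g' q)) ∧
    ∀ (p : Matrix n n F × Derivation k F F) X, b p (X, 0) = form n ε (shift g g' p) X

lemma liftable_of_commute [CharZero k] {ε : F →ₗ[k] k} {g g' : Matrix n n F} (h : g * g' = 1)
    (h' : g' * g = 1) (hcomm : ∀ p q : Matrix n n F × Derivation k F F,
      logDer g g' p * logDer g g' q = logDer g g' q * logDer g g' p) : Liftable ε g g' := by
  refine ⟨(form n ε).compl₁₂ (shift g g') (LinearMap.fst k _ _) -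
    (form n ε).compl₁₂ (conj g g') (logDer g g') -
    (2 : k)⁻¹ • (form n ε).compl₁₂ (logDer g g') (logDer g g'), fun p q r hp hq hr => ?_,
    fun p X => ?_⟩
  · exact trace_cocycle_identity (form n ε) (form_symm ε) (form_mul ε) (Matrix.mapDer p.2)
      (Matrix.mapDer q.2) (Matrix.mapDer r.2) (form_mapDer hp) (form_mapDer hq) (form_mapDer hr)
      p.1 q.1 r.1 (conj g g' p) (conj g g' q) (logDer g g' p) (logDer g g' q) (logDer g g' r)
      (hcomm p q) (hcomm p r) (hcomm q r) (M := (br p q).1) (M' := conj g g' (br p q))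
      (U := logDer g g' (br p q)) (M₂₃ := (br q r).1) (M₁₃ := (br p r).1)
      (U₂₃ := logDer g g' (br q r)) (U₁₃ := logDer g g' (br p r)) (l₁ := shift g g' p)
      (l₂ := shift g g' q)
      (by rw [conj_apply, mapDer_conj h h', map_sub, LinearMap.sub_apply, conj_apply,
        form_conj ε h']; rfl)
      rfl (conj_br h h' p q)
      (by rw [logDer_br h h', hcomm p q, sub_self, add_zero]) rfl rfl
      (by rw [logDer_br h h', hcomm q r, sub_self, add_zero])
      (by rw [logDer_br h h', hcomm p r, sub_self, add_zero]) rfl rfl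
  · have h0 : logDer g g' ((X, 0) : Matrix n n F × Derivation k F F) = 0 := by
      rw [logDer_apply, Matrix.mapDer_zero, mul_zero]
    simp [h0]

/-- Lifts compose. -/
lemma Liftable.mul {ε : F →ₗ[k] k} {g g' h h' : Matrix n n F} (hhh : h * h' = 1)
    (hhh' : h' * h = 1) (hg : Liftable ε g g') (hh : Liftable ε h h') :
    Liftable ε (g * h) (h' * g') := by
  obtain ⟨b, hb1, hb2⟩ := hg
  obtain ⟨c, hc1, hc2⟩ := hh
  let P := Matrix n n F × Derivation k F F
  let τ : P →ₗ[k] P := LinearMap.prod (conj h h' + logDer h h') (LinearMap.snd k _ _)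
  have hτ : ∀ p, τ p = p + (shift h h' p, 0) := fun p => by
    refine Prod.ext ?_ (add_zero p.2).symm
    change _ = p.1 + shift h h' p
    rw [shift_apply, add_sub_cancel]
    rfl
  have hsh : ∀ p, shift (g * h) (h' * g') p = shift h h' p + shift g g' (τ p) := fun p => by
    rw [shift_apply, shift_apply, shift_apply]
    change _ = _ + (g * (h * p.1 * h' + h * h'.mapDer p.2) * g' + g * g'.mapDer p.2 -
      (h * p.1 * h' + h * h'.mapDer p.2))
    rw [Matrix.mapDer_mul, mul_add (g * h), show g * h * (h' * g'.mapDer p.2) =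
      g * (h * h') * g'.mapDer p.2 by noncomm_ring, hhh, mul_one]
    noncomm_ring
  have hbr : ∀ p q, τ (br p q) = br (τ p) (τ q) := fun p q => by
    refine Prod.ext ?_ rfl
    change conj h h' (br p q) + logDer h h' (br p q) =
      (conj h h' q + logDer h h' q).mapDer p.2 - (conj h h' p + logDer h h' p).mapDer q.2 +
      ((conj h h' p + logDer h h' p) * (conj h h' q + logDer h h' q) -
        (conj h h' q + logDer h h' q) * (conj h h' p + logDer h h' p))
    rw [conj_br hhh hhh', logDer_br hhh hhh']
    simp only [map_add, mul_add, add_mul]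
    abel
  refine ⟨c + b.compl₁₂ τ LinearMap.id, fun p q r hp hq hr => ?_, fun p X => ?_⟩
  · simp only [LinearMap.add_apply, LinearMap.compl₁₂_apply, LinearMap.id_apply, hbr, hsh]
    rw [hc1 p q r hp hq hr, hb1 (τ p) (τ q) r hp hq hr, hτ q, br_add_left, ← hτ q, hτ p,
      br_add_left, ← hτ p, map_add, map_add, hb2, hb2, act_add]
    simp only [map_add, map_neg, LinearMap.add_apply]
    rw [← form_act hr, form_symm ε (shift g g' (τ q))]
    ring
  · rw [LinearMap.add_apply, LinearMap.add_apply, hc2, LinearMap.compl₁₂_apply, LinearMap.id_apply,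
      hb2, hsh, map_add, LinearMap.add_apply]

end Gauge

end Gauge

section GaugeGL

variable {k F n : Type*} [Field k] [CharZero k] [Field F] [Algebra k F] [Fintype n] [DecidableEq n]

namespace Gauge

lemma liftable_diagonal (ε : F →ₗ[k] k) (D : n → F) (hD : (Matrix.diagonal D).det ≠ 0) :
    Liftable ε (Matrix.diagonal D) (Matrix.diagonal fun i => (D i)⁻¹) := by
  have h0 : ∀ i, D i ≠ 0 := by
    rw [Matrix.det_diagonal] at hD
    exact fun i => Finset.prod_ne_zero_iff.mp hD i (Finset.mem_univ i)
  have hdiag : ∀ p : Matrix n n F × Derivation k F F,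
      logDer (Matrix.diagonal D) (Matrix.diagonal fun i => (D i)⁻¹) p =
        Matrix.diagonal fun i => D i * p.2 (D i)⁻¹ := fun p => by
    have h1 : (Matrix.diagonal fun i => (D i)⁻¹).mapDer p.2 =
        Matrix.diagonal fun i => p.2 (D i)⁻¹ := by
      ext i j
      rw [Matrix.mapDer_apply, Matrix.diagonal_apply, Matrix.diagonal_apply]
      split_ifs <;> simp
    rw [logDer_apply, h1, Matrix.diagonal_mul_diagonal]
  refine liftable_of_commute ?_ ?_ fun p q => ?_
  · simp [Matrix.diagonal_mul_diagonal, h0]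
  · simp [Matrix.diagonal_mul_diagonal, h0]
  · simp only [hdiag, Matrix.diagonal_mul_diagonal, mul_comm]

lemma liftable_transvection (ε : F →ₗ[k] k) (t : Matrix.TransvectionStruct n F) :
    Liftable ε t.toMatrix t.inv.toMatrix := by
  have hlog : ∀ p : Matrix n n F × Derivation k F F,
      logDer t.toMatrix t.inv.toMatrix p = Matrix.single t.i t.j (p.2 (-t.c)) := fun p => by
    have h1 : t.inv.toMatrix.mapDer p.2 = Matrix.single t.i t.j (p.2 (-t.c)) := by
      change ((1 : Matrix n n F) + Matrix.single t.i t.j (-t.c)).mapDer p.2 = _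
      rw [map_add, Matrix.mapDer_one, zero_add]
      ext a b
      rw [Matrix.mapDer_apply, Matrix.single_apply, Matrix.single_apply]
      split_ifs <;> simp
    rw [logDer_apply, h1]
    change ((1 : Matrix n n F) + Matrix.single t.i t.j t.c) * _ = _
    rw [add_mul, one_mul, Matrix.single_mul_single_of_ne _ _ _ _ t.hij.symm, add_zero]
  refine liftable_of_commute t.mul_inv t.inv_mul fun p q => ?_
  rw [hlog, hlog, Matrix.single_mul_single_of_ne _ _ _ _ t.hij.symm,
    Matrix.single_mul_single_of_ne _ _ _ _ t.hij.symm]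

/-- Every invertible matrix over a field is liftable. -/
theorem liftable (ε : F →ₗ[k] k) {g g' : Matrix n n F} (h : g * g' = 1) (h' : g' * g = 1) :
    Liftable ε g g' := by
  suffices ∃ N, g * N = 1 ∧ N * g = 1 ∧ Liftable ε g N by
    obtain ⟨N, h1, _, h3⟩ := this
    have : N = g' := by rw [← one_mul N, ← h', mul_assoc, h1, mul_one]
    rwa [← this]
  refine Matrix.diagonal_transvection_induction_of_det_ne_zero
    (fun M => ∃ N, M * N = 1 ∧ N * M = 1 ∧ Liftable ε M N) g
    (fun h0 => by simpa [h0] using congrArg Matrix.det h) (fun D hD => ?_) (fun t => ?_) ?_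
  · refine ⟨Matrix.diagonal fun i => (D i)⁻¹, ?_, ?_, liftable_diagonal ε D hD⟩
    all_goals
      rw [Matrix.det_diagonal] at hD
      have h0 : ∀ i, D i ≠ 0 := fun i => Finset.prod_ne_zero_iff.mp hD i (Finset.mem_univ i)
      simp [Matrix.diagonal_mul_diagonal, h0]
  · exact ⟨_, t.mul_inv, t.inv_mul, liftable_transvection ε t⟩
  · rintro X Y _ _ ⟨X', hX, hX', hXl⟩ ⟨Y', hY, hY', hYl⟩
    refine ⟨Y' * X', ?_, ?_, hXl.mul hY hY' hYl⟩
    · rw [mul_assoc, ← mul_assoc Y, hY, one_mul, hX]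
    · rw [mul_assoc, ← mul_assoc X', hX', one_mul, hY']

end Gauge

end GaugeGL

section Euler

variable {k Γ : Type*} [Field k] [AddCommGroup Γ] [LinearOrder Γ] [IsOrderedAddMonoid Γ]

/-- Weighting the coefficients of Hahn series by an additive function of the exponents. -/
noncomputable def HahnSeries.eulerLinear (w : Γ →+ k) :
    HahnSeries Γ k →ₗ[k] HahnSeries Γ k where
  toFun x := ⟨fun a => w a * x.coeff a, x.isPWO_support.mono fun _ ha h => ha (by simp [h])⟩
  map_add' x y := by ext a; exact mul_add _ _ _
  map_smul' c x := by ext a; exact mul_left_comm _ _ _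

/-- The Euler derivation of Hahn series attached to an additive function of the exponents. -/
noncomputable def HahnSeries.euler (w : Γ →+ k) :
    Derivation k (HahnSeries Γ k) (HahnSeries Γ k) :=
  Derivation.mk' (HahnSeries.eulerLinear w) fun x y => by
    ext a
    have hc : ∀ z b, (HahnSeries.eulerLinear w z).coeff b = w b * z.coeff b := fun _ _ => rfl
    have hs : ∀ z, (HahnSeries.eulerLinear w z).support ⊆ z.support := fun z b hb h => hb (by
      rw [hc, h, mul_zero])
    rw [HahnSeries.coeff_add, smul_eq_mul, smul_eq_mul, mul_comm y,
      HahnSeries.coeff_mul_left' x.isPWO_support (hs x),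
      HahnSeries.coeff_mul_right' y.isPWO_support (hs y), hc, HahnSeries.coeff_mul, Finset.mul_sum,
      ← Finset.sum_add_distrib]
    refine Finset.sum_congr rfl fun ij hij => ?_
    rw [Finset.mem_antidiagonal] at hij
    rw [← hij.2.2, map_add, hc, hc]
    ring

end Euler

namespace Laurent

variable {k : Type*} [Field k] [CharZero k] {m : ℕ}

/-- The field of Hahn series in `m` variables, with exponents ordered lexicographically. -/
abbrev Hahn (k : Type*) [Field k] (m : ℕ) := HahnSeries (Lex (Fin m → ℤ)) k

/-- Laurent polynomials as Hahn series. -/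
noncomputable def toHahn : Laurent k m →ₐ[k] Hahn k m :=
  AddMonoidAlgebra.lift k (Hahn k m) (Fin m → ℤ)
    { toFun := fun n => HahnSeries.single (toLex n.toAdd) 1
      map_one' := rfl
      map_mul' := fun n n' => by
        rw [HahnSeries.single_mul_single, one_mul]
        rfl }

lemma toHahn_single (n : Fin m → ℤ) (c : k) :
    toHahn (AddMonoidAlgebra.single n c) = HahnSeries.single (toLex n) c := by
  rw [toHahn, AddMonoidAlgebra.lift_single]
  change c • HahnSeries.single (toLex n) (1 : k) = _
  ext a
  rw [HahnSeries.coeff_smul]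
  by_cases h : a = toLex n
  · rw [h, HahnSeries.coeff_single_same, HahnSeries.coeff_single_same, smul_eq_mul, mul_one]
  · rw [HahnSeries.coeff_single_of_ne h, HahnSeries.coeff_single_of_ne h, smul_zero]

lemma coeff_toHahn (r : Laurent k m) (n : Fin m → ℤ) :
    (toHahn r).coeff (toLex n) = r.coeff n := by
  induction r using Laurent.induction_single with
  | h0 => simp
  | hadd r s hr hs => simp [hr, hs]
  | hs n' c =>
    rw [toHahn_single]
    by_cases h : n = n'
    · subst h; simp
    · rw [HahnSeries.coeff_single_of_ne fun h' => h (toLex.injective h')]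
      simp [Ne.symm h]

/-- The logarithmic derivatives of the monomials. -/
noncomputable def logDeriv (δ : Derivation k (Laurent k m) (Laurent k m)) :
    (Fin m → ℤ) →+ Laurent k m where
  toFun n := δ (AddMonoidAlgebra.single n 1) * AddMonoidAlgebra.single (-n) 1
  map_zero' := by
    rw [← AddMonoidAlgebra.one_def, Derivation.map_one_eq_zero, zero_mul]
  map_add' n n' := by
    have h1 : (AddMonoidAlgebra.single (n + n') 1 : Laurent k m) =
      AddMonoidAlgebra.single n 1 * AddMonoidAlgebra.single n' 1 := by simp
    have h2 : (AddMonoidAlgebra.single (-(n + n')) 1 : Laurent k m) =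
      AddMonoidAlgebra.single (-n) 1 * AddMonoidAlgebra.single (-n') 1 := by
        simp [add_comm]
    have h3 : ∀ n : Fin m → ℤ, (AddMonoidAlgebra.single n 1 : Laurent k m) *
      AddMonoidAlgebra.single (-n) 1 = 1 := fun n => by
        simp [AddMonoidAlgebra.one_def]
    rw [h1, h2, Derivation.leibniz, smul_eq_mul, smul_eq_mul]
    linear_combination (δ (AddMonoidAlgebra.single n 1) * AddMonoidAlgebra.single (-n) 1) * h3 n' +
      (δ (AddMonoidAlgebra.single n' 1) * AddMonoidAlgebra.single (-n') 1) * h3 n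

lemma logDeriv_apply (δ : Derivation k (Laurent k m) (Laurent k m)) (n : Fin m → ℤ) :
    logDeriv δ n = δ (AddMonoidAlgebra.single n 1) * AddMonoidAlgebra.single (-n) 1 := rfl

lemma single_mul_single_neg (n : Fin m → ℤ) : (AddMonoidAlgebra.single n 1 : Laurent k m) *
    AddMonoidAlgebra.single (-n) 1 = 1 := by
  simp [AddMonoidAlgebra.one_def]

lemma der_single (δ : Derivation k (Laurent k m) (Laurent k m)) (n : Fin m → ℤ) (c : k) :
    δ (AddMonoidAlgebra.single n c) =
      (∑ i, n i • logDeriv δ (Pi.single i 1)) * AddMonoidAlgebra.single n c := by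
  have h1 : ∑ i, n i • logDeriv δ (Pi.single i 1) = logDeriv δ n := by
    conv_rhs => rw [← Finset.univ_sum_single n]
    rw [map_sum]
    refine Finset.sum_congr rfl fun i _ => ?_
    rw [← map_zsmul]
    congr 1
    ext j
    by_cases h : j = i
    · subst h; simp
    · simp [h]
  rw [h1, Laurent.single_eq_smul, Derivation.map_smul, mul_smul_comm, logDeriv_apply, mul_assoc,
    mul_comm (AddMonoidAlgebra.single (-n) 1), single_mul_single_neg, mul_one]

lemma logDeriv_lie (δ δ' : Derivation k (Laurent k m) (Laurent k m)) (n : Fin m → ℤ) :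
    logDeriv ⁅δ, δ'⁆ n = δ (logDeriv δ' n) - δ' (logDeriv δ n) := by
  have h1 : ∀ δ : Derivation k (Laurent k m) (Laurent k m),
      δ (AddMonoidAlgebra.single n 1) * AddMonoidAlgebra.single (-n) 1 +
        AddMonoidAlgebra.single n 1 * δ (AddMonoidAlgebra.single (-n) 1) = 0 := fun δ => by
    have := congrArg δ (single_mul_single_neg (k := k) n)
    rw [Derivation.leibniz, Derivation.map_one_eq_zero, smul_eq_mul, smul_eq_mul] at this
    rw [← this]
    ring
  simp only [logDeriv_apply, Derivation.leibniz, smul_eq_mul, Derivation.commutator_apply]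
  linear_combination
    (AddMonoidAlgebra.single (-n) 1) * δ (AddMonoidAlgebra.single n 1) * h1 δ' -
    (AddMonoidAlgebra.single (-n) 1) * δ' (AddMonoidAlgebra.single n 1) * h1 δ +
    (δ (AddMonoidAlgebra.single (-n) 1) * δ' (AddMonoidAlgebra.single n 1) -
      δ' (AddMonoidAlgebra.single (-n) 1) * δ (AddMonoidAlgebra.single n 1)) *
        single_mul_single_neg (k := k) n

/-- The Euler derivation in the `i`-th variable. -/
noncomputable def hahnEuler (k : Type*) [Field k] {m : ℕ} (i : Fin m) :
    Derivation k (Hahn k m) (Hahn k m) :=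
  HahnSeries.euler
    { toFun := fun n => ((ofLex n i : ℤ) : k)
      map_zero' := Int.cast_zero
      map_add' := fun _ _ => Int.cast_add _ _ }

lemma coeff_hahnEuler (i : Fin m) (x : Hahn k m) (n : Fin m → ℤ) :
    (hahnEuler k i x).coeff (toLex n) = (n i : k) * x.coeff (toLex n) := rfl

lemma hahnEuler_comm (i j : Fin m) (x : Hahn k m) :
    hahnEuler k i (hahnEuler k j x) = hahnEuler k j (hahnEuler k i x) := by
  ext n
  exact mul_left_comm _ _ _

/-- The extension of a derivation of Laurent polynomials to Hahn series. -/
noncomputable def hahnDer : Derivation k (Laurent k m) (Laurent k m) →ₗ[k]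
    Derivation k (Hahn k m) (Hahn k m) where
  toFun δ := ∑ i, toHahn (logDeriv δ (Pi.single i 1)) • hahnEuler k i
  map_add' δ δ' := by
    rw [← Finset.sum_add_distrib]
    refine Finset.sum_congr rfl fun i _ => ?_
    rw [← add_smul, ← map_add, logDeriv_apply, Derivation.add_apply, add_mul]
    rfl
  map_smul' c δ := by
    rw [RingHom.id_apply, Finset.smul_sum]
    refine Finset.sum_congr rfl fun i _ => ?_
    rw [logDeriv_apply, Derivation.smul_apply, smul_mul_assoc, map_smul, smul_assoc]
    rfl

lemma hahnDer_apply (δ : Derivation k (Laurent k m) (Laurent k m)) (x : Hahn k m) :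
    hahnDer δ x = ∑ i, toHahn (logDeriv δ (Pi.single i 1)) * hahnEuler k i x := by
  change (∑ i, toHahn (logDeriv δ (Pi.single i 1)) • hahnEuler k i :
    Derivation k (Hahn k m) (Hahn k m)) x = _
  rw [← Derivation.coeFnAddMonoidHom_apply, map_sum, Finset.sum_apply]
  rfl

lemma hahnDer_toHahn (δ : Derivation k (Laurent k m) (Laurent k m)) (r : Laurent k m) :
    hahnDer δ (toHahn r) = toHahn (δ r) := by
  induction r using Laurent.induction_single with
  | h0 => simp
  | hadd r s hr hs => simp [hr, hs]
  | hs n c =>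
    rw [der_single, map_mul, map_sum, Finset.sum_mul, hahnDer_apply]
    refine Finset.sum_congr rfl fun i _ => ?_
    rw [map_zsmul, smul_mul_assoc, ← mul_smul_comm]
    congr 1
    rw [toHahn_single]
    ext a
    by_cases h : a = toLex n
    · rw [h, coeff_hahnEuler, ← Int.cast_smul_eq_zsmul k, HahnSeries.coeff_smul, smul_eq_mul]
    · rw [← toLex_ofLex a, coeff_hahnEuler, toLex_ofLex, HahnSeries.coeff_single_of_ne h]
      rw [← Int.cast_smul_eq_zsmul k, HahnSeries.coeff_smul, HahnSeries.coeff_single_of_ne h]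
      simp

lemma hahnDer_lie (δ δ' : Derivation k (Laurent k m) (Laurent k m)) :
    hahnDer ⁅δ, δ'⁆ = ⁅hahnDer δ, hahnDer δ'⁆ := by
  refine Derivation.ext fun x => ?_
  rw [Derivation.commutator_apply, hahnDer_apply δ' x, hahnDer_apply δ x, hahnDer_apply, map_sum,
    map_sum]
  simp only [Derivation.leibniz, hahnDer_toHahn, logDeriv_lie, map_sub, smul_eq_mul,
    Finset.sum_add_distrib, sub_mul, Finset.sum_sub_distrib]
  have h1 : ∑ i, toHahn (logDeriv δ' (Pi.single i 1)) * hahnDer δ (hahnEuler k i x) =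
      ∑ i, toHahn (logDeriv δ (Pi.single i 1)) * hahnDer δ' (hahnEuler k i x) := by
    simp only [hahnDer_apply, Finset.mul_sum]
    rw [Finset.sum_comm]
    refine Finset.sum_congr rfl fun i _ => Finset.sum_congr rfl fun j _ => ?_
    rw [hahnEuler_comm i j]
    ring
  rw [h1]
  simp only [mul_comm (hahnEuler k _ x)]
  ring

/-- The functional `y ↦ (r y)₀` on Hahn series. -/
noncomputable def hahnFunctional (r : Laurent k m) : Hahn k m →ₗ[k] k where
  toFun y := (toHahn r * y).coeff 0
  map_add' x y := by rw [mul_add, HahnSeries.coeff_add]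
  map_smul' c x := by rw [mul_smul_comm, HahnSeries.coeff_smul]; rfl

lemma hahnFunctional_toHahn (r s : Laurent k m) :
    hahnFunctional r (toHahn s) = (r * s).coeff 0 := by
  change (toHahn r * toHahn s).coeff (toLex 0) = _
  rw [← map_mul, coeff_toHahn]

lemma hahnFunctional_hahnDer {r : Laurent k m} {δ : Derivation k (Laurent k m) (Laurent k m)}
    (h : ∀ s, (r * δ s).coeff 0 = 0) (y : Hahn k m) : hahnFunctional r (hahnDer δ y) = 0 := by
  set w : Hahn k m := ∑ i, hahnEuler k i (toHahn r * toHahn (logDeriv δ (Pi.single i 1))) with hw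
  have h1 : ∀ y, hahnFunctional r (hahnDer δ y) = - (w * y).coeff 0 := fun y => by
    have h2 : toHahn r * hahnDer δ y + w * y =
        ∑ i, hahnEuler k i (toHahn r * toHahn (logDeriv δ (Pi.single i 1)) * y) := by
      rw [hahnDer_apply, hw, Finset.mul_sum, Finset.sum_mul, ← Finset.sum_add_distrib]
      refine Finset.sum_congr rfl fun i _ => ?_
      rw [Derivation.leibniz _ _ y, smul_eq_mul, smul_eq_mul]
      ring
    have h3 := congrArg (fun z : Hahn k m => z.coeff (toLex 0)) h2
    simp only [HahnSeries.coeff_add, HahnSeries.coeff_sum, coeff_hahnEuler, Pi.zero_apply,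
      Int.cast_zero, zero_mul, Finset.sum_const_zero] at h3
    exact eq_neg_of_add_eq_zero_left h3
  have hw0 : w = 0 := by
    ext a
    have h2 := h1 (toHahn (AddMonoidAlgebra.single (-ofLex a) 1))
    rw [hahnDer_toHahn, hahnFunctional_toHahn, h, toHahn_single] at h2
    have h3 := HahnSeries.coeff_mul_single_add (r := (1 : k)) (x := w) (a := a)
      (b := toLex (-ofLex a))
    rw [show a + toLex (-ofLex a) = 0 from add_neg_cancel a, mul_one] at h3
    rw [← h3, HahnSeries.coeff_zero, ← neg_eq_zero, ← h2]
  rw [h1, hw0, zero_mul, HahnSeries.coeff_zero, neg_zero]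

end Laurent

section HahnOperators

variable {k E L : Type*} [Field k] [CharZero k] [LieRing E] [LieAlgebra k E]
  [LieRing L] [LieAlgebra k L] {B : E →ₗ[k] E →ₗ[k] k} {H : LieSubalgebra k E}

namespace CoreQuot.Centroidal

variable {Q : CoreQuot B H L} {m : ℕ} [LieAlgebra (Laurent k m) L]
  [IsScalarTower k (Laurent k m) L] (C : Q.Centroidal m)
  {ι : Type*} [Fintype ι] [DecidableEq ι] (b : Module.Basis ι (Laurent k m) L)

/-- The matrix over Hahn series of a centroid-linear map. -/
noncomputable def hahnMatrix (A : Module.End (Laurent k m) L) :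
    Matrix ι ι (Laurent.Hahn k m) := (LinearMap.toMatrix b b A).map Laurent.toHahn

omit [IsScalarTower k (Laurent k m) L] in
lemma hahnMatrix_mul (A A' : Module.End (Laurent k m) L) :
    hahnMatrix b (A * A') = hahnMatrix b A * hahnMatrix b A' := by
  rw [hahnMatrix, LinearMap.toMatrix_mul, Matrix.map_mul]
  rfl

omit [IsScalarTower k (Laurent k m) L] in
lemma hahnMatrix_one : hahnMatrix b (1 : Module.End (Laurent k m) L) = 1 := by
  rw [hahnMatrix, LinearMap.toMatrix_one, Matrix.map_one _ (map_zero _) (map_one _)]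

lemma mapDer_map_toHahn (δ : Derivation k (Laurent k m) (Laurent k m))
    (X : Matrix ι ι (Laurent k m)) : (X.map Laurent.toHahn).mapDer (Laurent.hahnDer δ) =
      (X.map δ).map Laurent.toHahn := by
  ext1 i j
  exact Laurent.hahnDer_toHahn δ (X i j)

/-- The first-order matrix differential operator over Hahn series attached to `e`. -/
noncomputable def hahnOp :
    E →ₗ[k] Matrix ι ι (Laurent.Hahn k m) × Derivation k (Laurent.Hahn k m) (Laurent.Hahn k m) :=
  LinearMap.prod
    { toFun := fun e => (mat Q b e).map Laurent.toHahn
      map_add' := fun e e' => by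
        ext1 i j
        simp only [Matrix.map_apply, mat_apply, map_add, LinearMap.add_apply, Finsupp.add_apply,
          Matrix.add_apply]
      map_smul' := fun c e => by
        ext1 i j
        simp only [Matrix.map_apply, mat_apply, RingHom.id_apply, Matrix.smul_apply]
        rw [LinearMap.map_smul, LinearMap.smul_apply, ← algebraMap_smul (Laurent k m) c, map_smul,
          Finsupp.smul_apply, algebraMap_smul, map_smul] }
    (Laurent.hahnDer ∘ₗ C.der)

lemma hahnOp_apply (e : E) :
    C.hahnOp b e = ((mat Q b e).map Laurent.toHahn, Laurent.hahnDer (C.der e)) := rfl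

lemma hahnOp_lie (e e' : E) : C.hahnOp b ⁅e, e'⁆ = Gauge.br (C.hahnOp b e) (C.hahnOp b e') := by
  simp only [hahnOp_apply, Gauge.br, mapDer_map_toHahn]
  refine Prod.ext ?_ ?_
  · rw [C.mat_lie]
    ext1 i j
    simp [Matrix.mul_apply]
  · change Laurent.hahnDer _ = ⁅Laurent.hahnDer _, Laurent.hahnDer _⁆
    rw [← Laurent.hahnDer_lie]
    congr 1
    exact Derivation.ext fun r => by rw [C.der_lie, Derivation.commutator_apply]

lemma hahnOp_core {x : E} (hx : x ∈ core B H) :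
    C.hahnOp b x = (hahnMatrix b (LieAlgebra.ad (Laurent k m) L (Q.π ⟨x, hx⟩)), 0) := by
  rw [hahnOp_apply, C.der_core hx, map_zero, mat_core b hx]
  rfl

lemma hahnMatrix_comm (e : E) (A : Module.End (Laurent k m) L) :
    hahnMatrix b (C.comm e A) = Gauge.act (C.hahnOp b e) (hahnMatrix b A) := by
  rw [hahnMatrix, C.toMatrix_comm, Gauge.act, hahnOp_apply, hahnMatrix, mapDer_map_toHahn]
  ext1 i j
  simp [Matrix.mul_apply]

lemma shift_hahnOp {g : L ≃ₗ⁅Laurent k m⁆ L} {l : E →ₗ[k] L}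
    (hl : ∀ e a, g (Q.rho e (g.symm a)) = Q.rho e a + ⁅l e, a⁆) (e : E) :
    Gauge.shift (hahnMatrix b (g : L →ₗ[Laurent k m] L))
      (hahnMatrix b (g.symm : L →ₗ[Laurent k m] L)) (C.hahnOp b e) =
      hahnMatrix b (LieAlgebra.ad (Laurent k m) L (l e)) := by
  have h1 : LieAlgebra.ad (Laurent k m) L (l e) =
      ((g : L →ₗ[Laurent k m] L) : Module.End (Laurent k m) L) *
        C.comm e (g.symm : L →ₗ[Laurent k m] L) := by
    refine LinearMap.ext fun a => ?_
    change ⁅l e, a⁆ = g (Q.rho e (g.symm a) - g.symm (Q.rho e a))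
    rw [map_sub, hl, LieEquiv.apply_symm_apply, add_sub_cancel_left]
  have h2 : hahnMatrix b (g : L →ₗ[Laurent k m] L) *
      hahnMatrix b (g.symm : L →ₗ[Laurent k m] L) = 1 := by
    rw [← hahnMatrix_mul, ← hahnMatrix_one b]
    congr 1
    exact LinearMap.ext fun a => g.apply_symm_apply a
  rw [h1, hahnMatrix_mul, C.hahnMatrix_comm, Gauge.act, Gauge.shift_apply, mul_add, mul_sub,
    ← mul_assoc, ← mul_assoc, h2, one_mul]
  abel

include C in
lemma form_hahnMatrix {r : Laurent k m}
    (hr : ∀ x y, Q.form x y = (r * killingForm (Laurent k m) L x y).coeff 0) (x y : L) :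
    Gauge.form ι (Laurent.hahnFunctional r) (hahnMatrix b (LieAlgebra.ad (Laurent k m) L x))
      (hahnMatrix b (LieAlgebra.ad (Laurent k m) L y)) = Q.form x y := by
  rw [Gauge.form_apply, ← hahnMatrix_mul, hr, ← Laurent.hahnFunctional_toHahn,
    killingForm_apply_apply, LinearMap.trace_eq_matrix_trace _ b, hahnMatrix]
  congr 1
  simp only [Matrix.trace, Matrix.diag, Matrix.map_apply, map_sum]
  rfl

include C in
/-- The cocycle describing the lift of a centroid-linear automorphism. -/
theorem exists_cocycle {wtb : ι → Module.Dual k H} (hb : ∀ i, b i ∈ Q.wt (wtb i))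
    {g : L ≃ₗ⁅Laurent k m⁆ L} {l : E →ₗ[k] L}
    (hl : ∀ e a, g (Q.rho e (g.symm a)) = Q.rho e a + ⁅l e, a⁆) :
    ∃ c : E →ₗ[k] E →ₗ[k] k,
      (∀ e₁ e₂ e₃, c ⁅e₁, e₂⁆ e₃ = c e₁ ⁅e₂, e₃⁆ - c e₂ ⁅e₁, e₃⁆ +
        Q.form (Q.rho e₃ (l e₁)) (l e₂)) ∧
      (∀ e x, ∀ hx : x ∈ core B H, c e x = Q.form (l e) (Q.π ⟨x, hx⟩)) ∧
      ∀ z, ∀ hz : z ∈ core B H, Q.π ⟨z, hz⟩ = 0 → ∀ e, c z e = 0 := by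
  obtain ⟨r, hr⟩ := C.exists_form_eq b hb
  have hε : ∀ e y, Laurent.hahnFunctional r ((C.hahnOp b e).2 y) = 0 := fun e y =>
    Laurent.hahnFunctional_hahnDer (C.coeff_mul_der b hb hr e) y
  obtain ⟨c, hc1, hc2⟩ := Gauge.liftable (Laurent.hahnFunctional r)
    (g := hahnMatrix b (g : L →ₗ[Laurent k m] L))
    (g' := hahnMatrix b (g.symm : L →ₗ[Laurent k m] L))
    (by
      rw [← hahnMatrix_mul, ← hahnMatrix_one b]
      congr 1
      exact LinearMap.ext fun a => g.apply_symm_apply a)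
    (by
      rw [← hahnMatrix_mul, ← hahnMatrix_one b]
      congr 1
      exact LinearMap.ext fun a => g.symm_apply_apply a)
  refine ⟨c.compl₁₂ (C.hahnOp b) (C.hahnOp b), fun e₁ e₂ e₃ => ?_, fun e x hx => ?_,
    fun z hz hz0 e => ?_⟩
  · simp only [LinearMap.compl₁₂_apply, C.hahnOp_lie]
    rw [hc1 _ _ _ (hε e₁) (hε e₂) (hε e₃), C.shift_hahnOp b hl, C.shift_hahnOp b hl,
      ← C.hahnMatrix_comm, C.comm_ad, C.form_hahnMatrix b hr]
  · rw [LinearMap.compl₁₂_apply, C.hahnOp_core b hx, hc2, C.shift_hahnOp b hl,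
      C.form_hahnMatrix b hr]
  · have h0 : C.hahnOp b z = 0 := by
      rw [C.hahnOp_core b hz, hz0, map_zero, hahnMatrix, map_zero, Matrix.map_zero _ (map_zero _)]
      rfl
    rw [LinearMap.compl₁₂_apply, h0, map_zero, LinearMap.zero_apply]

end CoreQuot.Centroidal

end HahnOperators

section Truncation

variable {k E : Type*} [Field k] [CharZero k] [LieRing E] [LieAlgebra k E]
  {B : E →ₗ[k] E →ₗ[k] k} {H : LieSubalgebra k E} (h : IsEALA B H)

namespace IsEALA

include h

@[elab_as_elim]
lemma wt_induction {p : E → Prop} (e : E) (hadd : ∀ x y, p x → p y → p (x + y)) (h0 : p 0)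
    (hwt : ∀ α, ∀ x ∈ wtSpace H α, p x) : p e := by
  obtain ⟨s, m, hm, rfl⟩ := simWt_exists_decomp h.iSup_simWt e
  exact Finset.sum_induction _ p hadd h0 fun α _ => hwt α _ (hm α)

lemma exists_wt_proj (U : Set (Module.Dual k H)) : ∃ P : E →ₗ[k] E,
    (∀ α ∈ U, ∀ x ∈ wtSpace H α, P x = x) ∧ ∀ α ∉ U, ∀ x ∈ wtSpace H α, P x = 0 := by
  classical
  obtain ⟨P, hP⟩ := simWt_exists_linearMap (M' := E) h.iSup_simWt
    (fun α => if α ∈ U then Submodule.subtype _ else 0)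
  refine ⟨P, fun α hα x hx => ?_, fun α hα x hx => ?_⟩
  · rw [hP α ⟨x, hx⟩, if_pos hα]
    rfl
  · rw [hP α ⟨x, hx⟩, if_neg hα]
    rfl

/-- Truncating a bilinear form to prescribed total weights. -/
lemma exists_truncation (c : E →ₗ[k] E →ₗ[k] k) (T : Set (Module.Dual k H)) :
    ∃ c' : E →ₗ[k] E →ₗ[k] k, ∀ α β, ∀ x ∈ wtSpace H α, ∀ y ∈ wtSpace H β,
      (α + β ∈ T → c' x y = c x y) ∧ (α + β ∉ T → c' x y = 0) := by
  choose P hP hP' using fun α => h.exists_wt_proj {β | α + β ∈ T}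
  obtain ⟨c', hc'⟩ := simWt_exists_linearMap (M' := E →ₗ[k] k) h.iSup_simWt
    (fun α => (c.compl₂ (P α)) ∘ₗ Submodule.subtype _)
  refine ⟨c', fun α β x hx y hy => ⟨fun hT => ?_, fun hT => ?_⟩⟩
  · rw [hc' α ⟨x, hx⟩]
    change c x (P α y) = _
    rw [hP α β hT y hy]
  · rw [hc' α ⟨x, hx⟩]
    change c x (P α y) = _
    rw [hP' α β hT y hy, map_zero]

lemma exists_form_eq_of_wt (hfg : ∀ β, (wtSpace H β).FG) {β : Module.Dual k H} (f : E →ₗ[k] k)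
    (hf : ∀ γ, γ ≠ β → ∀ y ∈ wtSpace H γ, f y = 0) : ∃ t, ∀ y, B t y = f y := by
  have : FiniteDimensional k (wtSpace H β) := Module.Finite.iff_fg.2 (hfg β)
  have : FiniteDimensional k (wtSpace H (-β)) := Module.Finite.iff_fg.2 (hfg (-β))
  let p : wtSpace H (-β) →ₗ[k] Module.Dual k (wtSpace H β) :=
    B.compl₁₂ (Submodule.subtype _) (Submodule.subtype _)
  have hp : ∀ x, p.flip x = 0 → x = 0 := fun x hx => by
    by_contra hne
    obtain ⟨y, hy, hxy⟩ := h.exists_dual x.2 fun h0 => hne (Subtype.ext h0)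
    have h1 : B y x = 0 := LinearMap.congr_fun hx ⟨y, hy⟩
    rw [h.symm, hxy] at h1
    exact one_ne_zero h1
  have hp' : ∀ x, p x = 0 → x = 0 := fun x hx => by
    by_contra hne
    obtain ⟨y, hy, hxy⟩ := h.exists_dual x.2 fun h0 => hne (Subtype.ext h0)
    rw [neg_neg] at hy
    have h1 : B x y = 0 := LinearMap.congr_fun hx ⟨y, hy⟩
    rw [hxy] at h1
    exact one_ne_zero h1
  have hd : Module.finrank k (wtSpace H (-β)) = Module.finrank k (Module.Dual k (wtSpace H β)) := by
    refine le_antisymm (LinearMap.finrank_le_finrank_of_injective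
      ((injective_iff_map_eq_zero p).2 hp')) ?_
    rw [Subspace.dual_finrank_eq, ← Subspace.dual_finrank_eq (V := wtSpace H (-β))]
    exact LinearMap.finrank_le_finrank_of_injective ((injective_iff_map_eq_zero p.flip).2 hp)
  obtain ⟨t, ht⟩ := (LinearMap.injective_iff_surjective_of_finrank_eq_finrank hd).1
    ((injective_iff_map_eq_zero p).2 hp') (f ∘ₗ Submodule.subtype _)
  refine ⟨t, fun y => LinearMap.congr_fun (simWt_ext h.iSup_simWt fun γ y hy => ?_) y⟩
  by_cases hγ : γ = β
  · subst hγ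
    exact LinearMap.congr_fun ht ⟨y, hy⟩
  · rw [hf γ hγ y hy]
    exact h.form_eq_zero t.2 hy fun h0 => hγ (neg_add_eq_zero.1 h0).symm

/-- A functional supported on finitely many weight spaces is represented by the form. -/
lemma exists_form_eq (hfg : ∀ β, (wtSpace H β).FG) (U : Finset (Module.Dual k H)) :
    ∀ f : E →ₗ[k] k, (∀ γ ∉ U, ∀ y ∈ wtSpace H γ, f y = 0) → ∃ t, ∀ y, B t y = f y := by
  classical
  induction U using Finset.induction_on with
  | empty =>
    intro f hf
    refine ⟨0, fun y => ?_⟩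
    have : f = 0 := simWt_ext h.iSup_simWt fun γ y hy => hf γ (by simp) y hy
    rw [this, map_zero]
  | insert β U hβ ih =>
    intro f hf
    obtain ⟨P, hP, hP'⟩ := h.exists_wt_proj {β}
    obtain ⟨t, ht⟩ := h.exists_form_eq_of_wt hfg (β := β) (f ∘ₗ P) fun γ hγ y hy => by
      rw [LinearMap.comp_apply, hP' γ hγ y hy, map_zero]
    obtain ⟨t', ht'⟩ := ih (f - f ∘ₗ P) fun γ hγ y hy => by
      rw [LinearMap.sub_apply, LinearMap.comp_apply]
      by_cases hγβ : γ = β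
      · rw [hP γ hγβ y hy, sub_self]
      · rw [hP' γ hγβ y hy, hf γ (by simp [hγ, hγβ]) y hy, map_zero, sub_zero]
    refine ⟨t + t', fun y => ?_⟩
    rw [map_add, LinearMap.add_apply, ht, ht']
    simp

lemma exists_linearMap_form_eq (c : E →ₗ[k] E →ₗ[k] k) (hc : ∀ e, ∃ t, ∀ y, B t y = c e y) :
    ∃ l : E →ₗ[k] E, ∀ e y, B (l e) y = c e y := by
  choose t ht using hc
  have huniq : ∀ x x', (∀ y, B x y = B x' y) → x = x' := fun x x' hx =>
    sub_eq_zero.1 (h.nondeg _ fun y => by rw [map_sub, LinearMap.sub_apply, hx, sub_self])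
  exact ⟨{
    toFun := t
    map_add' := fun x x' => huniq _ _ fun y => by simp [ht]
    map_smul' := fun a x => huniq _ _ fun y => by simp [ht] }, ht⟩

end IsEALA

end Truncation

section LiftConstruction

variable {k E L : Type*} [Field k] [CharZero k] [LieRing E] [LieAlgebra k E]
  [LieRing L] [LieAlgebra k L] {B : E →ₗ[k] E →ₗ[k] k} {H : LieSubalgebra k E}

namespace CoreQuot

variable (Q : CoreQuot B H L)

/-- A form solving the cocycle equation may be chosen with finitely many total weights. -/
lemma exists_bounded_cocycle {l : E →ₗ[k] L} {S : Finset (Module.Dual k H)}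
    (hS : ∀ α, ∀ e ∈ wtSpace H α, l e ∈ Q.shiftWt S α) {c : E →ₗ[k] E →ₗ[k] k}
    (h1 : ∀ e₁ e₂ e₃, c ⁅e₁, e₂⁆ e₃ = c e₁ ⁅e₂, e₃⁆ - c e₂ ⁅e₁, e₃⁆ +
      Q.form (Q.rho e₃ (l e₁)) (l e₂))
    (h2 : ∀ e x, ∀ hx : x ∈ core B H, c e x = Q.form (l e) (Q.π ⟨x, hx⟩))
    (h3 : ∀ z, ∀ hz : z ∈ core B H, Q.π ⟨z, hz⟩ = 0 → ∀ e, c z e = 0) :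
    ∃ (T : Finset (Module.Dual k H)) (c' : E →ₗ[k] E →ₗ[k] k),
      (∀ α β, α + β ∉ T → ∀ x ∈ wtSpace H α, ∀ y ∈ wtSpace H β, c' x y = 0) ∧
      (∀ e₁ e₂ e₃, c' ⁅e₁, e₂⁆ e₃ = c' e₁ ⁅e₂, e₃⁆ - c' e₂ ⁅e₁, e₃⁆ +
        Q.form (Q.rho e₃ (l e₁)) (l e₂)) ∧
      (∀ e x, ∀ hx : x ∈ core B H, c' e x = Q.form (l e) (Q.π ⟨x, hx⟩)) ∧
      ∀ z, ∀ hz : z ∈ core B H, Q.π ⟨z, hz⟩ = 0 → ∀ e, c' z e = 0 := by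
  classical
  have hE := Q.isEALA
  let T : Finset (Module.Dual k H) :=
    (S ×ˢ S).image (fun p => -(p.1 + p.2)) ∪ S.image (fun s => -s)
  have hT1 : ∀ s ∈ S, ∀ s' ∈ S, -(s + s') ∈ T := fun s hs s' hs' =>
    Finset.mem_union_left _ (Finset.mem_image.2 ⟨(s, s'), Finset.mk_mem_product hs hs', rfl⟩)
  have hT2 : ∀ s ∈ S, -s ∈ T := fun s hs =>
    Finset.mem_union_right _ (Finset.mem_image.2 ⟨s, hs, rfl⟩)
  obtain ⟨c', hc'⟩ := hE.exists_truncation c (T : Set (Module.Dual k H))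
  have hst : ∀ v : H, ∀ m ∈ (core B H).toSubmodule,
      LieAlgebra.ad k E v m ∈ (core B H).toSubmodule :=
    fun v m hm => hE.lie_mem_core (v : E) hm
  refine ⟨T, c', fun α β hαβ x hx y hy => (hc' α β x hx y hy).2 hαβ, ?_, ?_, ?_⟩
  · intro e₁ e₂ e₃
    refine hE.wt_induction e₁ (fun x y hx hy => ?_) ?_ fun α e₁ he₁ => ?_
    · simp only [add_lie, map_add, LinearMap.add_apply, hx, hy]
      abel
    · simp
    refine hE.wt_induction e₂ (fun x y hx hy => ?_) ?_ fun β e₂ he₂ => ?_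
    · simp only [add_lie, lie_add, map_add, LinearMap.add_apply, hx, hy]
      abel
    · simp
    refine hE.wt_induction e₃ (fun x y hx hy => ?_) ?_ fun γ e₃ he₃ => ?_
    · simp only [lie_add, map_add, LinearMap.add_apply, hx, hy]
      abel
    · simp
    have w1 := hc' _ _ _ (lie_mem_wtSpace he₁ he₂) _ he₃
    have w2 := hc' _ _ _ he₁ _ (lie_mem_wtSpace he₂ he₃)
    have w3 := hc' _ _ _ he₂ _ (lie_mem_wtSpace he₁ he₃)
    rw [← add_assoc] at w2
    rw [add_left_comm, ← add_assoc] at w3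
    by_cases hT : α + β + γ ∈ T
    · rw [w1.1 hT, w2.1 hT, w3.1 hT, h1]
    · rw [w1.2 hT, w2.2 hT, w3.2 hT, sub_zero, zero_add]
      have hz : ∀ s ∈ S, ∀ s' ∈ S, ∀ x ∈ Q.wt (α + s), ∀ y ∈ Q.wt (β + s'),
          Q.form (Q.rho e₃ x) y = 0 := fun s hs s' hs' x hx y hy => by
        refine form_eq_zero_of_wt (Q.rho_mem_wt he₃ hx) hy fun h0 => hT ?_
        have : α + β + γ = -(s + s') := by
          rw [eq_neg_iff_add_eq_zero, ← h0]
          abel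
        rw [this]
        exact hT1 s hs s' hs'
      have hz' : ∀ s ∈ S, ∀ x ∈ Q.wt (α + s), Q.form (Q.rho e₃ x) (l e₂) = 0 :=
        fun s hs x hx => shiftWt_le (N := LinearMap.ker (Q.form (Q.rho e₃ x)))
          (fun s' hs' y hy => hz s hs s' hs' x hx y hy) (hS β e₂ he₂)
      exact (shiftWt_le (N := LinearMap.ker (Q.form.flip (l e₂) ∘ₗ Q.rho e₃))
        (fun s hs x hx => hz' s hs x hx) (hS α e₁ he₁)).symm
  · intro e x hx
    refine hE.wt_induction e (fun u v hu hv => ?_) ?_ fun α e he => ?_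
    · simp only [map_add, LinearMap.add_apply, hu, hv]
    · simp
    let d : core B H →ₗ[k] k := c' e ∘ₗ (core B H).toSubmodule.subtype -
      Q.form (l e) ∘ₗ (Q.π : core B H →ₗ[k] L)
    have := simWt_induction hE.iSup_simWt (core B H).toSubmodule hst
      ((LinearMap.ker d).map (core B H).toSubmodule.subtype) (fun β y hy hyβ => ?_) hx
    · obtain ⟨y, hy, rfl⟩ := this
      exact sub_eq_zero.1 hy
    · refine ⟨⟨y, hy⟩, ?_, rfl⟩
      change c' e y - Q.form (l e) (Q.π ⟨y, hy⟩) = 0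
      by_cases hT : α + β ∈ T
      · rw [(hc' α β e he y hyβ).1 hT, h2 e y hy, sub_self]
      · rw [(hc' α β e he y hyβ).2 hT, zero_sub, neg_eq_zero]
        refine shiftWt_le (N := LinearMap.ker (Q.form.flip (Q.π ⟨y, hy⟩)))
          (fun s hs x hx => form_eq_zero_of_wt hx (Q.pi_mem_wt hy hyβ) fun h0 => hT ?_) (hS α e he)
        have : α + β = -s := by
          rw [eq_neg_iff_add_eq_zero, ← h0]
          abel
        rw [this]
        exact hT2 s hs
  · intro z hz hz0 e
    have := simWt_induction hE.iSup_simWt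
      ((LinearMap.ker (Q.π : core B H →ₗ[k] L)).map (core B H).toSubmodule.subtype)
      ?_ (LinearMap.ker c') (fun α y hy hyα => ?_)
      (⟨⟨z, hz⟩, hz0, rfl⟩ : z ∈ (LinearMap.ker (Q.π : core B H →ₗ[k] L)).map
        (core B H).toSubmodule.subtype)
    · exact LinearMap.congr_fun this e
    · rintro v _ ⟨y, hy, rfl⟩
      exact ⟨Q.adCore v y, Q.pi_adCore_eq_zero v y hy, rfl⟩
    · obtain ⟨y, hy, rfl⟩ := hy
      refine LinearMap.ext fun e => ?_
      refine hE.wt_induction e (fun u v hu hv => ?_) ?_ fun β e he => ?_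
      · rw [map_add, hu, hv, LinearMap.zero_apply, LinearMap.zero_apply, LinearMap.zero_apply,
          add_zero]
      · rw [map_zero, LinearMap.zero_apply]
      · by_cases hT : α + β ∈ T
        · rw [(hc' α β _ hyα e he).1 hT]
          exact h3 _ y.2 hy e
        · exact (hc' α β _ hyα e he).2 hT

/-- A cocycle with finitely many total weights yields a lift. -/
lemma exists_lift_of_bounded_cocycle (hfg : ∀ β, (wtSpace H β).FG) (g : L ≃ₗ⁅k⁆ L)
    {l : E →ₗ[k] L} (hl : ∀ e a, g (Q.rho e (g.symm a)) = Q.rho e a + ⁅l e, a⁆)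
    {T : Finset (Module.Dual k H)} {c : E →ₗ[k] E →ₗ[k] k}
    (hT : ∀ α β, α + β ∉ T → ∀ x ∈ wtSpace H α, ∀ y ∈ wtSpace H β, c x y = 0)
    (h1 : ∀ e₁ e₂ e₃, c ⁅e₁, e₂⁆ e₃ = c e₁ ⁅e₂, e₃⁆ - c e₂ ⁅e₁, e₃⁆ +
      Q.form (Q.rho e₃ (l e₁)) (l e₂))
    (h2 : ∀ e x, ∀ hx : x ∈ core B H, c e x = Q.form (l e) (Q.π ⟨x, hx⟩))
    (h3 : ∀ z, ∀ hz : z ∈ core B H, Q.π ⟨z, hz⟩ = 0 → ∀ e, c z e = 0) :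
    ∃ f : E ≃ₗ⁅k⁆ E, (∀ x, x ∈ core B H ↔ f x ∈ core B H) ∧
      ∀ x y : core B H, f x = y → g (Q.π x) = Q.π y := by
  classical
  have hE := Q.isEALA
  obtain ⟨t, ht⟩ := hE.exists_linearMap_form_eq c fun e => by
    refine hE.wt_induction e ?_ ?_ fun α e he => ?_
    · rintro x y ⟨t, ht⟩ ⟨t', ht'⟩
      exact ⟨t + t', fun z => by rw [map_add, map_add, LinearMap.add_apply, ht, ht',
        LinearMap.add_apply]⟩
    · exact ⟨0, by simp⟩
    · refine hE.exists_form_eq hfg (T.image fun s => s - α) _ fun γ hγ y hy =>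
        hT α γ (fun h0 => hγ ?_) e he y hy
      exact Finset.mem_image.2 ⟨_, h0, add_sub_cancel_left α γ⟩
  have key : ∀ e, ∃ he : t e ∈ core B H, Q.π ⟨t e, he⟩ = l e := fun e => by
    have h4 : ∀ y ∈ core B H, B (t e - Q.sec (l e)) y = 0 := fun y hy => by
      rw [map_sub, LinearMap.sub_apply, ht, h2 e y hy, ← Q.form_pi (Q.sec (l e)) ⟨y, hy⟩, Q.pi_sec,
        sub_self]
    have h5 := hE.ea4 _ (hE.centralizes_core_iff.2 h4)
    have h6 : t e ∈ core B H := by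
      have := (core B H).add_mem h5 (Q.sec (l e)).2
      rwa [sub_add_cancel] at this
    refine ⟨h6, ?_⟩
    rw [← Q.pi_sec (l e), ← sub_eq_zero, ← map_sub]
    exact (Q.pi_eq_zero_iff_form _).2 h4
  choose htc htπ using key
  let f : E →ₗ⁅k⁆ E :=
    { (LinearMap.id + t : E →ₗ[k] E) with
      map_lie' := fun {e₁ e₂} => by
        change ⁅e₁, e₂⁆ + t ⁅e₁, e₂⁆ = ⁅e₁ + t e₁, e₂ + t e₂⁆
        rw [← sub_eq_zero]
        refine hE.nondeg _ fun e₃ => ?_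
        have h7 : B ⁅t e₁, t e₂⁆ e₃ = Q.form (Q.rho e₃ (l e₁)) (l e₂) := by
          rw [← htπ e₁, ← htπ e₂, Q.rho_pi', Q.form_pi, hE.form_lie_left,
            hE.symm _ (t e₂), ← lie_skew (t e₁) e₃, map_neg, neg_neg]
        simp only [add_lie, lie_add, map_sub, map_add, LinearMap.sub_apply, LinearMap.add_apply]
        rw [h7, ht, h1, hE.invariant (t e₁) e₂ e₃, ht, hE.form_lie_left e₁ (t e₂) e₃, ht]
        ring }
  have hf : ∀ e, f e = e + t e := fun e => rfl
  have hcore : ∀ x, x ∈ core B H ↔ f x ∈ core B H := fun x => by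
    rw [hf]
    exact ((core B H).toSubmodule.add_mem_iff_left (htc x)).symm
  have hπ : ∀ x (hx : x ∈ core B H), Q.π ⟨f x, (hcore x).1 hx⟩ = g (Q.π ⟨x, hx⟩) := fun x hx => by
    have h8 := Q.shift_core (g := g) (g' := g.symm) (fun x y => g.map_lie x y)
      (fun x => g.apply_symm_apply x) hl hx
    have h9 : (⟨f x, (hcore x).1 hx⟩ : core B H) = ⟨x, hx⟩ + ⟨t x, htc x⟩ := rfl
    rw [h9, map_add, htπ, h8, add_sub_cancel]
  have hker : ∀ x (hx : x ∈ core B H), Q.π ⟨x, hx⟩ = 0 → f x = x := fun x hx h0 => by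
    have : t x = 0 := hE.nondeg _ fun y => by rw [ht, h3 x hx h0]
    rw [hf, this, add_zero]
  have hinj : Function.Injective f := (injective_iff_map_eq_zero f).2 fun x hx => by
    have hxc : x ∈ core B H := (hcore x).2 (hx ▸ (core B H).zero_mem)
    have h0 : g (Q.π ⟨x, hxc⟩) = 0 := by
      rw [← hπ x hxc, ← map_zero Q.π]
      congr 1
      exact Subtype.ext hx
    rw [← hker x hxc (g.injective (h0.trans (map_zero g).symm)), hx]
  have hcsurj : ∀ y ∈ core B H, ∃ x, f x = y := fun y hy => by
    obtain ⟨⟨x, hx⟩, hxy⟩ := Q.surj (g.symm (Q.π ⟨y, hy⟩))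
    have hz : Q.π (⟨y, hy⟩ - ⟨f x, (hcore x).1 hx⟩) = 0 := by
      rw [map_sub, hπ x hx, hxy, g.apply_symm_apply, sub_self]
    refine ⟨x + (y - f x), ?_⟩
    rw [map_add, hker (y - f x) _ hz, add_sub_cancel]
  have hsurj : Function.Surjective f := fun y => by
    obtain ⟨x, hx⟩ := hcsurj (t y) (htc y)
    exact ⟨y - x, by rw [map_sub, hx, hf, add_sub_cancel_right]⟩
  refine ⟨LieEquiv.ofBijective f ⟨hinj, hsurj⟩, hcore, ?_⟩
  rintro ⟨x, hx⟩ ⟨y, hy⟩ (rfl : f x = y)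
  exact (hπ x hx).symm

end CoreQuot

end LiftConstruction

section MainTheorem

variable {k E L : Type*} [Field k] [CharZero k] [IsAlgClosed k] [LieRing E] [LieAlgebra k E]
  [LieRing L] [LieAlgebra k L] {B : E →ₗ[k] E →ₗ[k] k} {H : LieSubalgebra k E}

namespace CoreQuot

lemma Centroidal.exists_lift {Q : CoreQuot B H L} {m : ℕ} [LieAlgebra (Laurent k m) L]
    [IsScalarTower k (Laurent k m) L] [Module.Finite (Laurent k m) L] (C : Q.Centroidal m)
    (g : L ≃ₗ⁅k⁆ L) (hg : ∀ (r : Laurent k m) (x : L), g (r • x) = r • g x) :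
    ∃ f : E ≃ₗ⁅k⁆ E, (∀ x, x ∈ core B H ↔ f x ∈ core B H) ∧
      ∀ x y : core B H, f x = y → g (Q.π x) = Q.π y := by
  let g' : L ≃ₗ⁅Laurent k m⁆ L :=
    { g with map_smul' := hg }
  obtain ⟨N, b, wtb, hb⟩ := C.exists_basis
  obtain ⟨l, hl⟩ := C.exists_shift b hb g'
  obtain ⟨S, hS⟩ := C.exists_shift_mem b hb hl
  obtain ⟨c, h1, h2, h3⟩ := C.exists_cocycle b hb hl
  obtain ⟨T, c', hT, h1', h2', h3'⟩ := Q.exists_bounded_cocycle hS h1 h2 h3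
  exact Q.exists_lift_of_bounded_cocycle (C.fg_wtSpace b hb) g hl hT h1' h2' h3'

theorem exists_lift_of_finite (Q : CoreQuot B H L)
    (hfin : ∃ s : Finset L, ∀ x : L,
      x ∈ Submodule.span k {y | ∃ χ ∈ centroidAlg k L, ∃ a ∈ s, χ a = y})
    (g : L ≃ₗ⁅k⁆ L) (hg : ∀ χ ∈ centroidAlg k L, ∀ x, g (χ x) = χ (g x)) :
    ∃ f : E ≃ₗ⁅k⁆ E, (∀ x, x ∈ core B H ↔ f x ∈ core B H) ∧
      ∀ x y : core B H, f x = y → g (Q.π x) = Q.π y := by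
  obtain ⟨m, deg, Φ, hdeg, hΦ, hmem, hsurj, hwt⟩ := Q.exists_laurent
  let _ : Module (Laurent k m) L := Module.compHom L Φ.toRingHom
  have hsmul : ∀ (r : Laurent k m) (x : L), r • x = Φ r x := fun r x => rfl
  let _ : LieAlgebra (Laurent k m) L :=
    { lie_smul := fun r x y => (centroidAlg_lie_right (hmem r) x y).symm }
  have : IsScalarTower k (Laurent k m) L := ⟨fun c r x => by
    rw [hsmul, hsmul, map_smul, LinearMap.smul_apply]⟩
  have : Module.Finite (Laurent k m) L := by
    obtain ⟨s, hs⟩ := hfin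
    refine ⟨⟨s, eq_top_iff.2 fun x _ => ?_⟩⟩
    have := Submodule.span_le (p := (Submodule.span (Laurent k m) (s : Set L)).restrictScalars k)
      (s := {y | ∃ χ ∈ centroidAlg k L, ∃ a ∈ s, χ a = y}) |>.2 ?_ (hs x)
    · exact this
    · rintro _ ⟨χ, hχ, a, ha, rfl⟩
      obtain ⟨r, rfl⟩ := hsurj χ hχ
      exact Submodule.smul_mem _ r (Submodule.subset_span ha)
  let C : Q.Centroidal m :=
    { deg := deg
      deg_injective := hdeg
      exists_smul := fun χ hχ => by
        obtain ⟨r, rfl⟩ := hsurj χ hχ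
        exact ⟨r, fun a => rfl⟩
      faithful := fun r hr => hΦ (by rw [map_zero]; exact LinearMap.ext hr)
      smul_mem_wt := fun n α a ha => add_comm (deg n) α ▸ Q.ctdWt_apply (hwt n) ha }
  exact C.exists_lift g fun r x => hg _ (hmem r) x

end CoreQuot

/-- The centreless core as a quotient of the core. -/
def IsEALA.coreQuot {B : E →ₗ[k] E →ₗ[k] k} {H : LieSubalgebra k E} (h : IsEALA B H) :
    CoreQuot B H (centrelessCore B H) where
  isEALA := h
  π :=
    { (LieSubmodule.Quotient.mk' (LieAlgebra.center k (core B H)) :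
        core B H →ₗ[k] centrelessCore B H) with
      map_lie' := fun {x y} => LieSubmodule.Quotient.mk_bracket _ x y }
  surj := LieSubmodule.Quotient.surjective_mk' _
  ker x := by
    refine (LieSubmodule.Quotient.mk_eq_zero (N := LieAlgebra.center k (core B H))).trans ?_
    rw [LieModule.mem_maxTrivSubmodule]
    refine forall_congr' fun y => ?_
    rw [← lie_skew, neg_eq_zero]

end MainTheorem

/-- Theorem 6.1(c) of the paper: if the centreless core `L = E_c/Z(E_c)`
of an EALA `(E,H,(·|·))` over an algebraically closed field of characteristic `0` is
finitely generated over its centroid `R = Ctd_k(L)`, then every `R`-linear automorphism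
`g` of `L` lifts to an automorphism `f` of `E`: `f(E_c) = E_c`, and the automorphism of
`L` induced by `f|_{E_c}` equals `g`. -/
theorem eala_fgc_lift_centroid_linear_automorphism
    {k E : Type*} [Field k] [CharZero k] [IsAlgClosed k] [LieRing E] [LieAlgebra k E]
    (B : E →ₗ[k] E →ₗ[k] k) (H : LieSubalgebra k E)
    (h : IsEALA B H)
    (hfgc : IsFgc B H)
    -- an `R`-linear automorphism `g` of the centreless core `L`
    (g : centrelessCore B H ≃ₗ⁅k⁆ centrelessCore B H)
    (hg : ∀ χ ∈ ccCentroid B H, ∀ x : centrelessCore B H, g (χ x) = χ (g x)) :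
    ∃ f : E ≃ₗ⁅k⁆ E,
      -- `f` preserves the core …
      (∀ x : E, x ∈ core B H ↔ f x ∈ core B H) ∧
      -- … and the automorphism of `L = E_c/Z(E_c)` induced by `f|_{E_c}` is `g`
      (∀ x y : core B H, f (x : E) = (y : E) → g (ccMk B H x) = ccMk B H y) := by
  exact h.coreQuot.exists_lift_of_finite hfgc g hg
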